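/- arXiv:1007.1314 — 5 statements merged into one kernel-verified Lean document; each statement's English description precedes it below -/
import Mathlib

section
/- Let R be a valuation ring of rank 1 with maximal ideal m, and let A be an integral domain that is a finitely generated R-algebra whose structure map R → A is injective. Then for every prime ideal p of A containing mA, one has ht(p) = ht(p/mA) + 1, where ht(p) is the height of p in A and ht(p/mA) is the height of the image of p in A/mA. -/
namespace SpecialFiber
open MvPolynomial

/-- Algebraic independence modulo a prime `q`, over the residue domain of `R` at `q`. -/
def Ind (R : Type*) {A : Type*} [CommRing R] [CommRing A] [Algebra R A] (q : Ideal A) {n : ℕ}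
    (f : Fin n → A) : Prop :=
  ∀ F : MvPolynomial (Fin n) R, aeval f F ∈ q → ∀ m, algebraMap R A (F.coeff m) ∈ q

section
variable {R A : Type*} [CommRing R] [CommRing A] [Algebra R A]

lemma aeval_mem (q : Ideal A) {n : ℕ} (f : Fin n → A) (F : MvPolynomial (Fin n) R)
    (h : ∀ m, algebraMap R A (F.coeff m) ∈ q) : aeval f F ∈ q := by
  rw [aeval_def, eval₂_eq]
  exact Ideal.sum_mem _ fun m _ => q.mul_mem_right _ (h m)

lemma aeval_cons {n : ℕ} (g : A) (f : Fin n → A) (F : MvPolynomial (Fin (n+1)) R) :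
    aeval (Fin.cons g f : Fin (n+1) → A) F =
      Polynomial.eval₂ (aeval f : MvPolynomial (Fin n) R →ₐ[R] A).toRingHom g
        (finSuccEquiv R n F) := by
  induction F using MvPolynomial.induction_on with
  | C a => simp [finSuccEquiv_apply]
  | add p q hp hq => simp [hp, hq, Polynomial.eval₂_add]
  | mul_X p i hp =>
    rw [map_mul, map_mul, Polynomial.eval₂_mul, hp, aeval_X]
    congr 1
    refine Fin.cases ?_ (fun j => ?_) i
    · rw [finSuccEquiv_X_zero]; simp
    · rw [finSuccEquiv_X_succ]; simp

lemma ind_cons_aux {q q' : Ideal A} [q.IsPrime] (hle : q ≤ q')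
    (hR : ∀ r, algebraMap R A r ∈ q' → algebraMap R A r ∈ q) {g : A} (hg' : g ∈ q') (hg : g ∉ q)
    {n : ℕ} {f : Fin n → A} (hf : Ind R q' f) (d : ℕ) :
    ∀ G : Polynomial (MvPolynomial (Fin n) R), G.natDegree ≤ d →
      Polynomial.eval₂ (aeval f : MvPolynomial (Fin n) R →ₐ[R] A).toRingHom g G ∈ q →
      ∀ i m, algebraMap R A ((G.coeff i).coeff m) ∈ q := by
  have key : ∀ G : Polynomial (MvPolynomial (Fin n) R),
      Polynomial.eval₂ (aeval f : MvPolynomial (Fin n) R →ₐ[R] A).toRingHom g G ∈ q →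
      Polynomial.eval₂ (aeval f : MvPolynomial (Fin n) R →ₐ[R] A).toRingHom g G.divX ∈ q ∧
      ∀ m, algebraMap R A ((G.coeff 0).coeff m) ∈ q := by
    intro G hG
    rw [← G.divX_mul_X_add, Polynomial.eval₂_add, Polynomial.eval₂_mul, Polynomial.eval₂_X,
      Polynomial.eval₂_C] at hG
    have h0 : aeval f (G.coeff 0) ∈ q' := by
      have := hle hG
      rwa [Ideal.add_mem_iff_right _ (q'.mul_mem_left _ hg')] at this
    have h1 : ∀ m, algebraMap R A ((G.coeff 0).coeff m) ∈ q := fun m => hR _ (hf _ h0 m)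
    refine ⟨?_, h1⟩
    have h2 : aeval f (G.coeff 0) ∈ q := aeval_mem _ _ _ h1
    rw [Ideal.add_mem_iff_left _ (by exact h2)] at hG
    exact (Ideal.IsPrime.mem_or_mem ‹_› hG).resolve_right hg
  induction d with
  | zero =>
    intro G hd hG i m
    rcases i with _ | i
    · exact (key G hG).2 m
    · rw [Polynomial.coeff_eq_zero_of_natDegree_lt (by omega)]; simp
  | succ d ih =>
    intro G hd hG i m
    rcases i with _ | i
    · exact (key G hG).2 m
    · rw [← Polynomial.coeff_divX]
      exact ih G.divX (by rw [Polynomial.natDegree_divX_eq_natDegree_tsub_one]; omega)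
        (key G hG).1 i m

lemma ind_cons {q q' : Ideal A} [q.IsPrime] (hle : q ≤ q')
    (hR : ∀ r, algebraMap R A r ∈ q' → algebraMap R A r ∈ q) {g : A} (hg' : g ∈ q') (hg : g ∉ q)
    {n : ℕ} {f : Fin n → A} (hf : Ind R q' f) : Ind R q (Fin.cons g f : Fin (n+1) → A) := by
  intro F hF m
  rw [aeval_cons] at hF
  have := ind_cons_aux hle hR hg' hg hf _ _ le_rfl hF (m 0) m.tail
  rwa [finSuccEquiv_coeff_coeff, Finsupp.cons_tail] at this

lemma exists_dvd [IsDomain R] [ValuationRing R] {ι : Type*} (a : ι → R) (s : Finset ι)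
    (hs : s.Nonempty) : ∃ i ∈ s, ∀ j ∈ s, a i ∣ a j := by
  classical
  induction hs using Finset.Nonempty.cons_induction with
  | singleton i => exact ⟨i, by simp⟩
  | cons i s hi hs ih =>
    obtain ⟨k, hk, h⟩ := ih
    rcases ValuationRing.dvd_total (a i) (a k) with h' | h'
    · refine ⟨i, by simp, fun j hj => ?_⟩
      rcases Finset.mem_cons.1 hj with rfl | hj
      · exact dvd_rfl
      · exact h'.trans (h j hj)
    · refine ⟨k, by simp [hk], fun j hj => ?_⟩
      rcases Finset.mem_cons.1 hj with rfl | hj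
      · exact h'
      · exact h j hj

lemma ind_cross [IsDomain R] [ValuationRing R] {q q' : Ideal A} [q.IsPrime] [q'.IsPrime]
    (hle : q ≤ q') (hq : ∀ r, algebraMap R A r ∈ q → r = 0)
    {n : ℕ} {f : Fin n → A} (hf : Ind R q' f) : Ind R q f := by
  intro F hF
  by_cases hF0 : F = 0
  · simp [hF0]
  exfalso
  obtain ⟨i, hi, h⟩ := exists_dvd (fun m => F.coeff m) F.support (by simpa using hF0)
  have hd : C (F.coeff i) ∣ F := by
    rw [C_dvd_iff_dvd_coeff]
    intro j
    by_cases hj : j ∈ F.support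
    · exact h j hj
    · rw [notMem_support_iff.1 hj]; exact dvd_zero _
  have hc : F.coeff i ≠ 0 := by simpa using hi
  obtain ⟨G, hG⟩ := hd
  have h1 : G.coeff i = 1 := by
    have := congrArg (coeff i) hG
    rw [coeff_C_mul] at this
    exact mul_left_cancel₀ hc (by rw [← this, mul_one])
  rw [hG, map_mul, aeval_C] at hF
  have := (Ideal.IsPrime.mem_or_mem ‹_› hF).resolve_left fun hh => hc (hq _ hh)
  have := hf G (hle this) i
  rw [h1, map_one] at this
  exact Ideal.IsPrime.one_notMem ‹q'.IsPrime› this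

lemma quasiFiniteAt_of {P S : Type*} [CommRing P] [CommRing S] [Algebra P S]
    [Algebra.FiniteType P S] (q : PrimeSpectrum S)
    (hmin : ∀ q' : PrimeSpectrum S, q' ≤ q →
      q'.comap (algebraMap P S) = q.comap (algebraMap P S) → q' = q)
    (hmax : ∀ q' : PrimeSpectrum S, q ≤ q' →
      q'.comap (algebraMap P S) = q.comap (algebraMap P S) → q' = q) :
    Algebra.QuasiFiniteAt P q.asIdeal := by
  apply Algebra.QuasiFiniteAt.of_isOpen_singleton_fiber
  let p := q.comap (algebraMap P S)
  let e := PrimeSpectrum.preimageHomeomorphFiber P S p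
  let e' := PrimeSpectrum.preimageOrderIsoFiber P S p
  have : IsNoetherianRing (p.asIdeal.Fiber S) :=
    Algebra.FiniteType.isNoetherianRing p.asIdeal.ResidueField _
  have : IsJacobsonRing (p.asIdeal.Fiber S) :=
    isJacobsonRing_of_finiteType (A := p.asIdeal.ResidueField)
  rw [← e.isOpen_image, Set.image_singleton]
  refine ((PrimeSpectrum.isOpen_singleton_tfae_of_isNoetherian_of_isJacobsonRing _).out 0 2).mpr ?_
  rw [PrimeSpectrum.isClosed_singleton_iff_isMaximal, ← PrimeSpectrum.isMax_iff,
    PrimeSpectrum.stableUnderGeneralization_singleton, ← PrimeSpectrum.isMin_iff]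
  change IsMax (e' _) ∧ IsMin (e' _)
  rw [OrderIso.isMax_apply, OrderIso.isMin_apply]
  constructor
  · rintro ⟨q', hq'⟩ h
    exact (hmax q' h hq').le
  · rintro ⟨q', hq'⟩ h
    exact (hmin q' h hq').ge

lemma ind_algebraicIndependent {q : Ideal A} {n : ℕ} {f : Fin n → A} (hf : Ind R q f) :
    AlgebraicIndependent (R ⧸ q.under R) (fun i => Ideal.Quotient.mk q (f i)) := by
  rw [algebraicIndependent_iff]
  intro F hF
  obtain ⟨G, rfl⟩ := MvPolynomial.map_surjective (Ideal.Quotient.mk (q.under R))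
    Ideal.Quotient.mk_surjective F
  have h1 : aeval (fun i => Ideal.Quotient.mk q (f i)) (map (Ideal.Quotient.mk (q.under R)) G)
      = Ideal.Quotient.mk q (aeval f G) := by
    rw [aeval_def, eval₂_map, aeval_def]
    exact (MvPolynomial.eval₂_comp_left (Ideal.Quotient.mk q) (algebraMap R A) f G).symm
  rw [h1, Ideal.Quotient.eq_zero_iff_mem] at hF
  ext m
  rw [coeff_map, coeff_zero, Ideal.Quotient.eq_zero_iff_mem]
  exact hf G hF m

lemma ind_bdd [Algebra.FiniteType R A] (q : Ideal A) [q.IsPrime] :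
    ∃ N, ∀ (n : ℕ) (f : Fin n → A), Ind R q f → n ≤ N := by
  have : Algebra.FiniteType R (A ⧸ q) := inferInstance
  have : Algebra.FiniteType (R ⧸ q.under R) (A ⧸ q) :=
    .of_restrictScalars_finiteType R _ _
  have h := trdeg_lt_aleph0_of_finiteType (R := R ⧸ q.under R) (S := A ⧸ q)
  obtain ⟨N, hN⟩ := Cardinal.lt_aleph0.1 h
  refine ⟨N, fun n f hf => ?_⟩
  have := (ind_algebraicIndependent hf).lift_cardinalMk_le_trdeg
  rw [hN] at this
  simpa using this

lemma zmain [Algebra.FiniteType R A] {p' p : Ideal A} [p'.IsPrime] [hp : p.IsPrime] (hle : p' ≤ p)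
    {N : ℕ} (h : Fin N → A)
    (hmin : ∀ q : Ideal A, q.IsPrime → p' ≤ q → q ≤ p →
      (∀ F : MvPolynomial (Fin N) R, aeval h F ∈ p → aeval h F ∈ q) → q = p)
    (hmax : ∀ q : Ideal A, q.IsPrime → p ≤ q →
      (∀ F : MvPolynomial (Fin N) R, aeval h F ∈ q → aeval h F ∈ p) → q = p)
    {n : ℕ} {f : Fin n → A} (hf : Ind R p' f) : n ≤ N := by
  let : Algebra (MvPolynomial (Fin N) R) (A ⧸ p') :=
    ((Ideal.Quotient.mk p').comp (aeval h : MvPolynomial (Fin N) R →ₐ[R] A).toRingHom).toAlgebra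
  have hmap : ∀ F : MvPolynomial (Fin N) R,
    algebraMap _ (A ⧸ p') F = Ideal.Quotient.mk p' (aeval h F) := fun _ => rfl
  have : IsScalarTower R (MvPolynomial (Fin N) R) (A ⧸ p') :=
    .of_algebraMap_eq fun r => by rw [hmap]; simp
  have : Algebra.FiniteType (MvPolynomial (Fin N) R) (A ⧸ p') :=
    .of_restrictScalars_finiteType R _ _
  have hcm : (p.map (Ideal.Quotient.mk p')).comap (Ideal.Quotient.mk p') = p := by
    rw [Ideal.comap_map_of_surjective _ Ideal.Quotient.mk_surjective, ← RingHom.ker_eq_comap_bot,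
      Ideal.mk_ker, sup_eq_left.2 hle]
  have hmem : ∀ x, Ideal.Quotient.mk p' x ∈ p.map (Ideal.Quotient.mk p') ↔ x ∈ p := by
    intro x; rw [← Ideal.mem_comap, hcm]
  have : (p.map (Ideal.Quotient.mk p')).IsPrime :=
    Ideal.map_isPrime_of_surjective Ideal.Quotient.mk_surjective (by simpa using hle)
  have hQ : Algebra.QuasiFiniteAt (MvPolynomial (Fin N) R) (p.map (Ideal.Quotient.mk p')) := by
    refine quasiFiniteAt_of ⟨p.map (Ideal.Quotient.mk p'), this⟩ ?_ ?_
    · intro q' hq' hqq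
      have := hmin (q'.asIdeal.comap (Ideal.Quotient.mk p')) inferInstance
        (fun x hx => by
          rw [Ideal.mem_comap, Ideal.Quotient.eq_zero_iff_mem.2 hx]; exact zero_mem _)
        (fun x hx => (hmem x).1 (hq' hx))
        (fun F hF => by
          have h1 : F ∈ (q'.comap (algebraMap (MvPolynomial (Fin N) R) (A ⧸ p'))).asIdeal := by
            rw [hqq]; exact (hmem _).2 hF
          exact h1)
      ext1
      change q'.asIdeal = p.map (Ideal.Quotient.mk p')
      rw [← this, Ideal.map_comap_of_surjective _ Ideal.Quotient.mk_surjective]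
    · intro q' hq' hqq
      have := hmax (q'.asIdeal.comap (Ideal.Quotient.mk p')) inferInstance
        (fun x hx => hq' ((hmem x).2 hx))
        (fun F hF => by
          have h1 : F ∈ (q'.comap (algebraMap (MvPolynomial (Fin N) R) (A ⧸ p'))).asIdeal := hF
          rw [hqq] at h1
          exact (hmem _).1 h1)
      ext1
      change q'.asIdeal = p.map (Ideal.Quotient.mk p')
      rw [← this, Ideal.map_comap_of_surjective _ Ideal.Quotient.mk_surjective]
  obtain ⟨r, hr, hri, hx⟩ := Algebra.zariskisMainProperty_iff.1
    (Algebra.ZariskisMainProperty.of_finiteType (R := MvPolynomial (Fin N) R)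
      (p.map (Ideal.Quotient.mk p')))
  have hr0 : r ≠ 0 := by rintro rfl; exact hr (zero_mem _)
  let B := Algebra.adjoin (R ⧸ p'.under R) (Set.range fun i => Ideal.Quotient.mk p' (h i))
  have hB : ∀ F : MvPolynomial (Fin N) R, algebraMap _ (A ⧸ p') F ∈ B := by
    intro F
    rw [hmap]
    induction F using MvPolynomial.induction_on with
    | C a =>
      rw [aeval_C]
      exact B.algebraMap_mem (Ideal.Quotient.mk _ a)
    | add a b ha hb => rw [map_add, map_add]; exact B.add_mem ha hb
    | mul_X a i ha =>
      rw [map_mul, map_mul, aeval_X]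
      exact B.mul_mem ha (Algebra.subset_adjoin ⟨i, rfl⟩)
  have hBint : ∀ x : A ⧸ p', IsIntegral (MvPolynomial (Fin N) R) x → IsIntegral B x := by
    rintro x ⟨G, hG, hG0⟩
    refine ⟨G.map ((algebraMap _ (A ⧸ p')).codRestrict B.toSubring hB), hG.map _, ?_⟩
    rw [Polynomial.eval₂_map]
    exact hG0
  have halg : Algebra.IsAlgebraic B (A ⧸ p') := by
    refine ⟨fun x => ?_⟩
    obtain ⟨m, hm⟩ := hx x
    refine IsAlgebraic.of_mul (y := r ^ m) ?_ ?_ ?_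
    · exact mem_nonZeroDivisors_of_ne_zero (pow_ne_zero _ hr0)
    · exact ((hBint r hri).pow m).isAlgebraic
    · exact (hBint _ hm).isAlgebraic
  have h1 := Algebra.IsAlgebraic.trdeg_le_cardinalMk (R ⧸ p'.under R)
    (Set.range fun i => Ideal.Quotient.mk p' (h i))
  have h2 := (ind_algebraicIndependent hf).lift_cardinalMk_le_trdeg
  have h3 : Cardinal.mk (Set.range fun i => Ideal.Quotient.mk p' (h i)) ≤ N := by
    have := Cardinal.mk_range_le_lift (f := fun i => Ideal.Quotient.mk p' (h i))
    simpa using this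
  have h4 := h1.trans h3
  have h5 : (n : Cardinal) ≤ Algebra.trdeg (R ⧸ p'.under R) (A ⧸ p') := by simpa using h2
  exact_mod_cast h5.trans h4

/-- The maximal size of a family of elements that is independent modulo `q`. -/
noncomputable def tt (R : Type*) {A : Type*} [CommRing R] [CommRing A] [Algebra R A]
    (q : Ideal A) : ℕ := sSup {n | ∃ f : Fin n → A, Ind R q f}

lemma le_tt [Algebra.FiniteType R A] (q : Ideal A) [q.IsPrime] {n : ℕ} {f : Fin n → A}
    (hf : Ind R q f) : n ≤ tt R q := by
  obtain ⟨N, hN⟩ := ind_bdd (R := R) q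
  exact le_csSup ⟨N, fun n ⟨f, hf⟩ => hN n f hf⟩ ⟨f, hf⟩

lemma exists_tt [Algebra.FiniteType R A] (q : Ideal A) [q.IsPrime] :
    ∃ f : Fin (tt R q) → A, Ind R q f := by
  obtain ⟨N, hN⟩ := ind_bdd (R := R) q
  refine Nat.sSup_mem (s := {n | ∃ f : Fin n → A, Ind R q f}) ⟨0, Fin.elim0, ?_⟩
    ⟨N, fun n ⟨f, hf⟩ => hN n f hf⟩
  intro F hF m
  obtain ⟨a, rfl⟩ := MvPolynomial.C_surjective (Fin 0) F
  obtain rfl : m = 0 := Subsingleton.elim _ _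
  simpa using hF

lemma tt_lt [Algebra.FiniteType R A] {q q' : Ideal A} [q.IsPrime] [q'.IsPrime] (hlt : q < q')
    (hR : ∀ r, algebraMap R A r ∈ q' → algebraMap R A r ∈ q) : tt R q' + 1 ≤ tt R q := by
  obtain ⟨f, hf⟩ := exists_tt (R := R) q'
  obtain ⟨g, hg', hg⟩ := SetLike.exists_of_lt hlt
  exact le_tt q (ind_cons hlt.le hR hg' hg hf)

lemma tt_le [IsDomain R] [ValuationRing R] [Algebra.FiniteType R A] {q q' : Ideal A} [q.IsPrime]
    [q'.IsPrime] (hle : q ≤ q') (hq : ∀ r, algebraMap R A r ∈ q → r = 0) :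
    tt R q' ≤ tt R q := by
  obtain ⟨f, hf⟩ := exists_tt (R := R) q'
  exact le_tt q (ind_cross hle hq hf)

/-- A maximal independent family modulo `p` has no larger prime with the same trace. -/
lemma max_of_ind [Algebra.FiniteType R A] {p : Ideal A} [p.IsPrime] {f : Fin (tt R p) → A}
    (hf : Ind R p f) (q : Ideal A) (hq : q.IsPrime) (hpq : p ≤ q)
    (h : ∀ F : MvPolynomial (Fin (tt R p)) R, aeval f F ∈ q → aeval f F ∈ p) : q = p := by
  by_contra hne
  obtain ⟨g, hg', hg⟩ := SetLike.exists_of_lt (lt_of_le_of_ne hpq (Ne.symm hne))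
  have h1 : Ind R q f := fun F hF m => hpq (hf F (h F hF) m)
  have := le_tt p (ind_cons hpq (fun r hr => by
    have := h (C r) (by simpa using hr)
    simpa using this) hg' hg h1)
  omega

/-- minimal primes over an extended ideal -/
lemma tt_bot_le [IsDomain A] [Algebra.FiniteType R A] {p : Ideal A} [p.IsPrime] (I : Ideal R)
    (hI : I.map (algebraMap R A) ≤ p)
    (hmin : ∀ q : Ideal A, q.IsPrime → I.map (algebraMap R A) ≤ q → q ≤ p → q = p) :
    tt R (⊥ : Ideal A) ≤ tt R p := by
  obtain ⟨f, hf⟩ := exists_tt (R := R) p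
  obtain ⟨f', hf'⟩ := exists_tt (R := R) (⊥ : Ideal A)
  refine zmain bot_le f ?_ (fun q hq h1 h2 => max_of_ind hf q hq h1 h2) hf'
  intro q hq _ hqp h
  refine hmin q hq ?_ hqp
  rw [Ideal.map_le_iff_le_comap] at hI ⊢
  intro r hr
  have := h (C r) (by simpa using hI hr)
  simpa using this

lemma tt_le_succ [Algebra.FiniteType R A] {p' p : Ideal A} [p'.IsPrime] [p.IsPrime] (hlt : p' < p)
    (hadj : ∀ q : Ideal A, q.IsPrime → p' < q → q ≤ p → q = p) :
    tt R p' ≤ tt R p + 1 := by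
  obtain ⟨f, hf⟩ := exists_tt (R := R) p
  obtain ⟨f', hf'⟩ := exists_tt (R := R) p'
  obtain ⟨g, hg', hg⟩ := SetLike.exists_of_lt hlt
  refine zmain hlt.le (Fin.cons g f : Fin (tt R p + 1) → A) ?_ ?_ hf'
  · intro q hq hq1 hqp h
    refine hadj q hq (lt_of_le_of_ne hq1 ?_) hqp
    rintro rfl
    have := h (X 0) (by simpa using hg')
    exact hg (by simpa using this)
  · intro q hq h1 h2
    refine max_of_ind hf q hq h1 fun F hF => ?_
    have e : aeval (Fin.cons g f : Fin (tt R p + 1) → A) (rename Fin.succ F) = aeval f F := by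
      rw [aeval_rename]; rfl
    have := h2 (rename Fin.succ F) (by rwa [e])
    rwa [e] at this

open Classical in
/-- codimension-type function, strictly monotone on the spectrum -/
noncomputable def phi (R : Type*) {A : Type*} [CommRing R] [CommRing A] [Algebra R A]
    (q : PrimeSpectrum A) : ℕ :=
  tt R (⊥ : Ideal A) - tt R q.asIdeal + if (∀ r, algebraMap R A r ∈ q.asIdeal → r = 0) then 0 else 1

end

section main
variable {R A : Type*} [CommRing R] [IsDomain R] [ValuationRing R]
    [CommRing A] [IsDomain A] [Algebra R A] [Algebra.FiniteType R A]

lemma dich (hrank : ringKrullDim R = 1) (q : Ideal A) [q.IsPrime] :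
    (∀ r, algebraMap R A r ∈ q → r = 0) ∨
      (∀ r, algebraMap R A r ∈ q ↔ r ∈ IsLocalRing.maximalIdeal R) := by
  have : Ring.KrullDimLE 1 R := by
    rw [Ring.krullDimLE_iff, hrank]; rfl
  have := (Ring.krullDimLE_one_iff_of_isPrime_bot (R := R)).1 this
  by_cases h : q.under R = ⊥
  · left
    intro r hr
    have : r ∈ q.under R := hr
    rwa [h, Ideal.mem_bot] at this
  · right
    intro r
    have := IsLocalRing.eq_maximalIdeal (this (q.under R) h inferInstance)
    rw [← this]; rfl

lemma phi_strictMono (hrank : ringKrullDim R = 1) (hinj : Function.Injective (algebraMap R A)) :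
    StrictMono (phi R (A := A)) := by
  have hbot : ∀ r, algebraMap R A r ∈ (⊥ : Ideal A) → r = 0 := fun r hr =>
    (injective_iff_map_eq_zero _).1 hinj r hr
  intro q q' hlt
  have hlt' : q.asIdeal < q'.asIdeal := hlt
  have hb' : tt R q'.asIdeal ≤ tt R (⊥ : Ideal A) := tt_le bot_le hbot
  have hb : tt R q.asIdeal ≤ tt R (⊥ : Ideal A) := tt_le bot_le hbot
  unfold phi
  by_cases h' : ∀ r, algebraMap R A r ∈ q'.asIdeal → r = 0
  · have h : ∀ r, algebraMap R A r ∈ q.asIdeal → r = 0 := fun r hr => h' r (hlt'.le hr)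
    have := tt_lt (R := R) hlt' fun r hr => by rw [h' r hr]; simp
    rw [if_pos h, if_pos h']
    omega
  · by_cases h : ∀ r, algebraMap R A r ∈ q.asIdeal → r = 0
    · have := tt_le (R := R) hlt'.le h
      rw [if_pos h, if_neg h']
      omega
    · have h1 := (dich hrank q.asIdeal).resolve_left h
      have h1' := (dich hrank q'.asIdeal).resolve_left h'
      have := tt_lt (R := R) hlt' fun r hr => (h1 r).2 ((h1' r).1 hr)
      rw [if_neg h, if_neg h']
      omega

lemma lower (hrank : ringKrullDim R = 1) (hinj : Function.Injective (algebraMap R A)) (N : ℕ) :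
    ∀ x : PrimeSpectrum.zeroLocus
      (((IsLocalRing.maximalIdeal R).map (algebraMap R A) : Ideal A) : Set A),
      phi R x.1 ≤ N → (tt R (⊥ : Ideal A) : ℕ∞) ≤ Order.height x + tt R x.1.asIdeal := by
  have hphi := phi_strictMono hrank hinj
  induction N with
  | zero =>
    intro x hx
    have hb : tt R (⊥ : Ideal A) ≤ tt R x.1.asIdeal := by
      unfold phi at hx; omega
    exact le_add_left (by exact_mod_cast hb)
  | succ N ih =>
    intro x hx
    by_cases hmin : ∀ q : Ideal A, q.IsPrime →
        (IsLocalRing.maximalIdeal R).map (algebraMap R A) ≤ q → q ≤ x.1.asIdeal → q = x.1.asIdeal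
    · have := tt_bot_le _ x.2 hmin
      exact le_add_left (by exact_mod_cast this)
    · push Not at hmin
      obtain ⟨q, hq, hmq, hqx, hne⟩ := hmin
      let s : Set ℕ := {n | ∃ y : PrimeSpectrum.zeroLocus
        (((IsLocalRing.maximalIdeal R).map (algebraMap R A) : Ideal A) : Set A),
        y < x ∧ phi R y.1 = n}
      have hs : s.Nonempty := ⟨_, ⟨⟨q, hq⟩, hmq⟩, lt_of_le_of_ne hqx (by
        intro h; exact hne (by rw [← h])), rfl⟩
      have hbd : BddAbove s := ⟨phi R x.1, by
        rintro _ ⟨y, hy, rfl⟩; exact (hphi (show y.1 < x.1 from hy)).le⟩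
      obtain ⟨y, hy, hyn⟩ := Nat.sSup_mem hs hbd
      have hy' : y.1 < x.1 := hy
      have hadj : ∀ q : Ideal A, q.IsPrime → y.1.asIdeal < q → q ≤ x.1.asIdeal →
          q = x.1.asIdeal := by
        intro q hq h1 h2
        by_contra hne
        let z : PrimeSpectrum.zeroLocus
          (((IsLocalRing.maximalIdeal R).map (algebraMap R A) : Ideal A) : Set A) :=
          ⟨⟨q, hq⟩, le_trans y.2 h1.le⟩
        have hz : z < x := lt_of_le_of_ne h2 (by intro h; exact hne (by rw [← h]))
        have h3 := le_csSup hbd ⟨z, hz, rfl⟩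
        rw [← hyn] at h3
        exact absurd (hphi (show y.1 < z.1 from h1)) (by omega)
      have h1 := tt_le_succ (R := R) (show y.1.asIdeal < x.1.asIdeal from hy') hadj
      have h2 := ih y (by have := hphi hy'; omega)
      have h3 := Order.height_add_one_le hy
      calc (tt R (⊥ : Ideal A) : ℕ∞) ≤ Order.height y + tt R y.1.asIdeal := h2
        _ ≤ Order.height y + (tt R x.1.asIdeal + 1 : ℕ) := by gcongr
        _ = (Order.height y + 1) + tt R x.1.asIdeal := by push_cast; ring
        _ ≤ _ := by gcongr

lemma succ_le (hm0 : IsLocalRing.maximalIdeal R ≠ ⊥) (hinj : Function.Injective (algebraMap R A))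
    (x : PrimeSpectrum.zeroLocus
      (((IsLocalRing.maximalIdeal R).map (algebraMap R A) : Ideal A) : Set A)) :
    Order.height x + 1 ≤ Order.height x.1 := by
  have h1 : ∀ s : LTSeries (PrimeSpectrum.zeroLocus
      (((IsLocalRing.maximalIdeal R).map (algebraMap R A) : Ideal A) : Set A)),
      s.last = x → (s.length : ℕ∞) + 1 ≤ Order.height x.1 := by
    intro s hs
    have hb : (⊥ : PrimeSpectrum A) < s.head.1 := by
      rw [bot_lt_iff_ne_bot]
      intro h
      have h2 : (IsLocalRing.maximalIdeal R).map (algebraMap R A) ≤ s.head.1.asIdeal := s.head.2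
      rw [h] at h2
      apply hm0
      rw [eq_bot_iff]
      intro r hr
      have : algebraMap R A r ∈ (⊥ : Ideal A) := h2 (Ideal.mem_map_of_mem _ hr)
      exact (injective_iff_map_eq_zero _).1 hinj r this
    let t := (s.map (Subtype.val : _ → PrimeSpectrum A) (Subtype.strictMono_coe _)).cons ⊥ hb
    have := Order.length_le_height_last (p := t)
    have e : t.last = x.1 := by
      rw [← hs]; exact RelSeries.last_cons _ _ _
    rw [e] at this
    have e2 : t.length = s.length + 1 := RelSeries.cons_length _ _ _
    rw [e2] at this
    exact_mod_cast this
  obtain h | h := eq_or_ne (Order.height x.1) ⊤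
  · rw [h]; exact le_top
  · obtain ⟨n, hn⟩ := ENat.ne_top_iff_exists.1 h
    rw [← hn] at h1 ⊢
    rcases n with _ | n
    · exact absurd (h1 (RelSeries.singleton _ x) rfl) (by simp)
    · have : Order.height x ≤ n := Order.height_le fun s hs => by
        have := h1 s hs
        push_cast at this
        exact (ENat.add_le_add_iff_right (by simp)).1 this
      push_cast
      gcongr

lemma main_zeroLocus (hrank : ringKrullDim R = 1) (hinj : Function.Injective (algebraMap R A))
    (x : PrimeSpectrum.zeroLocus
      (((IsLocalRing.maximalIdeal R).map (algebraMap R A) : Ideal A) : Set A)) :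
    Order.height x.1 = Order.height x + 1 := by
  have hm0 : IsLocalRing.maximalIdeal R ≠ ⊥ := by
    intro h
    have := ringKrullDim_eq_zero_of_isField (IsLocalRing.isField_iff_maximalIdeal_eq.2 h)
    rw [hrank] at this
    exact one_ne_zero this
  refine le_antisymm ?_ (succ_le hm0 hinj x)
  have h1 := Order.height_le_height_apply_of_strictMono _ (phi_strictMono hrank hinj) x.1
  rw [Order.height_nat] at h1
  have h2 := lower hrank hinj _ x le_rfl
  have h3 : phi R x.1 ≤ tt R (⊥ : Ideal A) - tt R x.1.asIdeal + 1 := by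
    unfold phi; split_ifs <;> omega
  refine h1.trans ((Nat.cast_le.2 h3).trans ?_)
  push_cast
  gcongr
  exact tsub_le_iff_right.2 h2

end main
end SpecialFiber


/-- The height of an ideal of a commutative ring: for a prime ideal `p`, this is the
supremum of the lengths `r` of chains of primes `p₀ ⊊ p₁ ⊊ ⋯ ⊊ p_r = p`. -/
noncomputable def primeHt {A : Type*} [CommRing A] (p : Ideal A) : ℕ∞ :=
  ⨆ (h : p.IsPrime), Order.height (⟨p, h⟩ : PrimeSpectrum A)

/-- Let `R` be a valuation ring of rank 1 (a valuation domain of Krull dimension 1) with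
maximal ideal `m`, and let `A` be an integral domain that is a finitely generated `R`-algebra
with injective structure map.  Then for every prime ideal `p` of `A` containing `m·A`,
one has `ht p = ht (p / mA) + 1`, where the latter height is computed in `A ⧸ mA`. -/
theorem height_in_special_fiber_over_rank_one_valuation_ring
    {R A : Type*} [CommRing R] [IsDomain R] [ValuationRing R]
    (hrank : ringKrullDim R = 1)
    [CommRing A] [IsDomain A] [Algebra R A] [Algebra.FiniteType R A]
    (hinj : Function.Injective (algebraMap R A))
    (p : Ideal A) (hp : p.IsPrime)
    (hm : (IsLocalRing.maximalIdeal R).map (algebraMap R A) ≤ p) :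
    primeHt p =
      primeHt (p.map (Ideal.Quotient.mk
        ((IsLocalRing.maximalIdeal R).map (algebraMap R A)))) + 1 := by
  have hI : Ideal.map (algebraMap R A) (IsLocalRing.maximalIdeal R) ≤ p := hm
  have hp' : (p.map (Ideal.Quotient.mk
        ((IsLocalRing.maximalIdeal R).map (algebraMap R A)))).IsPrime :=
    Ideal.map_isPrime_of_surjective Ideal.Quotient.mk_surjective (by simpa using hm)
  have hcm : (p.map (Ideal.Quotient.mk ((IsLocalRing.maximalIdeal R).map (algebraMap R A)))).comap
      (Ideal.Quotient.mk ((IsLocalRing.maximalIdeal R).map (algebraMap R A))) = p := by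
    rw [Ideal.comap_map_of_surjective _ Ideal.Quotient.mk_surjective, ← RingHom.ker_eq_comap_bot,
      Ideal.mk_ker, sup_eq_left.2 hm]
  unfold primeHt
  rw [iSup_pos hp, iSup_pos hp']
  let e := ((IsLocalRing.maximalIdeal R).map (algebraMap R A)).primeSpectrumQuotientOrderIsoZeroLocus
  rw [← Order.height_orderIso e ⟨_, hp'⟩, ← SpecialFiber.main_zeroLocus hrank hinj]
  congr 1
  ext1
  exact hcm.symm
end

section
/- Dimension formula over rank-1 valuation rings: let R be a valuation ring of rank 1, and let A be an integral domain that is a finitely generated R-algebra whose structure map R → A is injective. Then for any prime ideals q ⊆ p of A, one has ht(p) = ht(q) + ht(p/q), where ht(p/q) denotes the height of the image of p in A/q. -/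
namespace DimForm

/-- A prime that is isolated (both minimal and maximal) in its fibre is quasi-finite. -/
lemma quasiFiniteAt_of_isolated {B A : Type*} [CommRing B] [CommRing A] [Algebra B A]
    [Algebra.FiniteType B A] (p : Ideal A) [hp : p.IsPrime]
    (h1 : ∀ q : Ideal A, q.IsPrime → q.under B = p.under B → q ≤ p → p ≤ q)
    (h2 : ∀ q : Ideal A, q.IsPrime → q.under B = p.under B → p ≤ q → q ≤ p) :
    Algebra.QuasiFiniteAt B p := by
  let x : PrimeSpectrum A := ⟨p, hp⟩
  let P := x.comap (algebraMap B A)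
  let e := PrimeSpectrum.preimageHomeomorphFiber B A P
  let e' := PrimeSpectrum.preimageOrderIsoFiber B A P
  refine Algebra.QuasiFiniteAt.of_isOpen_singleton_fiber (R := B) x ?_
  rw [← e.isOpen_image, Set.image_singleton]
  have : IsNoetherianRing (P.asIdeal.Fiber A) :=
    Algebra.FiniteType.isNoetherianRing P.asIdeal.ResidueField _
  have : IsJacobsonRing (P.asIdeal.Fiber A) :=
    isJacobsonRing_of_finiteType (A := P.asIdeal.ResidueField)
  have htfae := (PrimeSpectrum.isOpen_singleton_tfae_of_isNoetherian_of_isJacobsonRing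
    (e ⟨x, rfl⟩)).out 0 2
  refine htfae.mpr ⟨?_, ?_⟩
  · rw [PrimeSpectrum.isClosed_singleton_iff_isMaximal, ← PrimeSpectrum.isMax_iff]
    change IsMax (e' ⟨x, rfl⟩)
    rw [e'.isMax_apply]
    intro y hy
    exact h2 y.1.asIdeal y.1.2 (congrArg PrimeSpectrum.asIdeal y.2) hy
  · have hmin : IsMin (e' ⟨x, rfl⟩) := by
      rw [e'.isMin_apply]
      intro y hy
      exact h1 y.1.asIdeal y.1.2 (congrArg PrimeSpectrum.asIdeal y.2) hy
    rintro a b hab rfl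
    rw [← PrimeSpectrum.le_iff_specializes] at hab
    exact le_antisymm hab (hmin hab)

lemma isAlgebraic_of_quasiFiniteAt {B A : Type*} [CommRing B] [IsDomain B] [CommRing A]
    [IsDomain A] [Algebra B A]
    [Algebra.FiniteType B A] (p : Ideal A) [hp : p.IsPrime] [Algebra.QuasiFiniteAt B p] :
    Algebra.IsAlgebraic B A := by
  obtain ⟨r, hr, hri, H⟩ := Algebra.zariskisMainProperty_iff.mp
    (Algebra.ZariskisMainProperty.of_finiteType_of_weaklyQuasiFiniteAt (R := B) p)
  have hr0 : r ≠ 0 := by rintro rfl; exact hr p.zero_mem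
  refine ⟨fun x ↦ ?_⟩
  obtain ⟨m, hm⟩ := H x
  exact IsAlgebraic.of_mul (mem_nonZeroDivisors_of_ne_zero (pow_ne_zero m hr0))
    (hri.pow m).isAlgebraic hm.isAlgebraic

lemma trdeg_le {R : Type*} {A : Type*} [CommRing R] [CommRing A] [IsDomain A]
    [Algebra R A] [Algebra.FiniteType R A] (p : Ideal A) [hp : p.IsPrime] (s : Finset A)
    (hs : p ∈ ((p.under R).map (algebraMap R A) ⊔ Ideal.span (s : Set A)).minimalPrimes) :
    Algebra.trdeg R A ≤ Algebra.trdeg (R ⧸ p.under R) (A ⧸ p) + s.card := by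
  obtain ⟨ι, x, hx⟩ := exists_isTranscendenceBasis' (R ⧸ p.under R) (A ⧸ p)
  choose y hy using fun i ↦ Ideal.Quotient.mk_surjective (x i)
  let S : Set A := Set.range y ∪ s
  let B := Algebra.adjoin R S
  have hft : Algebra.FiniteType B A := .of_restrictScalars_finiteType R B A
  have hlift : ∀ c ∈ Algebra.adjoin (R ⧸ p.under R) (Set.range x), ∃ b : B,
      Ideal.Quotient.mk p b.1 = c := by
    intro c hc
    induction hc using Algebra.adjoin_induction with
    | mem c hc =>
      obtain ⟨i, rfl⟩ := hc
      exact ⟨⟨y i, Algebra.subset_adjoin (Or.inl ⟨i, rfl⟩)⟩, hy i⟩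
    | algebraMap r =>
      obtain ⟨r, rfl⟩ := Ideal.Quotient.mk_surjective r
      exact ⟨algebraMap R B r, rfl⟩
    | add a b _ _ ha hb =>
      obtain ⟨a, rfl⟩ := ha
      obtain ⟨b, rfl⟩ := hb
      exact ⟨a + b, by simp⟩
    | mul a b _ _ ha hb =>
      obtain ⟨a, rfl⟩ := ha
      obtain ⟨b, rfl⟩ := hb
      exact ⟨a * b, by simp⟩
  have hqf : Algebra.QuasiFiniteAt B p := by
    refine quasiFiniteAt_of_isolated p ?_ ?_
    · intro q hq hqp hle
      refine hs.2 ⟨hq, ?_⟩ hle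
      refine sup_le ?_ ?_
      · rw [Ideal.map_le_iff_le_comap]
        intro r hr
        have : algebraMap R B r ∈ p.under B := hr
        rw [← hqp] at this
        exact this
      · rw [Ideal.span_le]
        intro f hf
        have hfp : f ∈ p := hs.1.2 (Ideal.mem_sup_right (Ideal.subset_span hf))
        have : (⟨f, Algebra.subset_adjoin (Or.inr hf)⟩ : B) ∈ p.under B := hfp
        rw [← hqp] at this
        exact this
    · intro q hq hqp hle f hf
      by_contra hfp
      have hf0 : Ideal.Quotient.mk p f ≠ 0 := by
        rwa [Ne, Ideal.Quotient.eq_zero_iff_mem]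
      obtain ⟨⟨r, hr⟩, hr0, hdvd⟩ := (hx.isAlgebraic.isAlgebraic
        (Ideal.Quotient.mk p f)).exists_nonzero_dvd (mem_nonZeroDivisors_of_ne_zero hf0)
      obtain ⟨b, rfl⟩ := hlift r hr
      obtain ⟨c, hc⟩ := hdvd
      obtain ⟨c, rfl⟩ := Ideal.Quotient.mk_surjective c
      change Ideal.Quotient.mk p b.1 = _ at hc
      rw [← map_mul, Ideal.Quotient.eq] at hc
      have hbq : b ∈ q.under B := by
        change b.1 ∈ q
        have := q.add_mem (hle hc) (q.mul_mem_right c hf)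
        simpa using this
      rw [hqp] at hbq
      exact hr0 (Subtype.ext (Ideal.Quotient.eq_zero_iff_mem.mpr hbq))
  have halg : Algebra.IsAlgebraic B A := isAlgebraic_of_quasiFiniteAt p
  calc Algebra.trdeg R A ≤ Cardinal.mk S := Algebra.IsAlgebraic.trdeg_le_cardinalMk R S
    _ ≤ Cardinal.mk (Set.range y) + Cardinal.mk (s : Set A) := Cardinal.mk_union_le _ _
    _ ≤ Cardinal.mk ι + s.card := by
      gcongr
      · exact Cardinal.mk_range_le
      · simp
    _ = _ := by rw [hx.cardinalMk_eq_trdeg]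



lemma algInd_iff {R A ι : Type*} [CommRing R] [CommRing A] [Algebra R A] (p : Ideal A)
    (y : ι → A) :
    AlgebraicIndependent (R ⧸ p.under R) (fun i ↦ Ideal.Quotient.mk p (y i)) ↔
      ∀ F : MvPolynomial ι R, MvPolynomial.aeval y F ∈ p → ∀ m, F.coeff m ∈ p.under R := by
  have key : ∀ F : MvPolynomial ι R,
      MvPolynomial.aeval (fun i ↦ Ideal.Quotient.mk p (y i))
        (MvPolynomial.map (Ideal.Quotient.mk (p.under R)) F) =
      Ideal.Quotient.mk p (MvPolynomial.aeval y F) := by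
    intro F
    induction F using MvPolynomial.induction_on with
    | C a =>
      simp only [MvPolynomial.map_C, MvPolynomial.aeval_C]
      rfl
    | add f g hf hg => simp only [map_add, hf, hg]
    | mul_X f i hf => simp only [map_mul, hf, MvPolynomial.map_X, MvPolynomial.aeval_X]
  rw [algebraicIndependent_iff]
  constructor
  · intro h F hF m
    have := h (MvPolynomial.map (Ideal.Quotient.mk (p.under R)) F)
      (by rw [key]; exact Ideal.Quotient.eq_zero_iff_mem.mpr hF)
    have h2 := congrArg (MvPolynomial.coeff m) this
    rw [MvPolynomial.coeff_map, MvPolynomial.coeff_zero] at h2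
    exact Ideal.Quotient.eq_zero_iff_mem.mp h2
  · intro h F hF
    obtain ⟨F, rfl⟩ := MvPolynomial.map_surjective _ Ideal.Quotient.mk_surjective F
    rw [key] at hF
    ext m
    rw [MvPolynomial.coeff_map, MvPolynomial.coeff_zero]
    exact Ideal.Quotient.eq_zero_iff_mem.mpr (h F (Ideal.Quotient.eq_zero_iff_mem.mp hF) m)

/-- Transcendence degree of the residue ring at `p`. -/
noncomputable def tt (R : Type*) {A : Type*} [CommRing R] [CommRing A] [Algebra R A]
    (p : Ideal A) : ℕ :=
  Cardinal.toNat (Algebra.trdeg (R ⧸ p.under R) (A ⧸ p))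

lemma tt_cast (R : Type*) {A : Type*} [CommRing R] [CommRing A] [Algebra R A]
    [Algebra.FiniteType R A] (p : Ideal A) [p.IsPrime] :
    ((tt R p : ℕ) : Cardinal) = Algebra.trdeg (R ⧸ p.under R) (A ⧸ p) := by
  have h1 : Algebra.FiniteType R (A ⧸ p) :=
    Algebra.FiniteType.of_surjective (Ideal.Quotient.mkₐ R p) Ideal.Quotient.mk_surjective
  have : Algebra.FiniteType (R ⧸ p.under R) (A ⧸ p) :=
    .of_restrictScalars_finiteType R _ _
  exact Cardinal.cast_toNat_of_lt_aleph0 (trdeg_lt_aleph0_of_finiteType)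

lemma exists_basis (R : Type*) {A : Type*} [CommRing R] [CommRing A] [Algebra R A]
    [Algebra.FiniteType R A] (p : Ideal A) [p.IsPrime] :
    ∃ y : Fin (tt R p) → A,
      IsTranscendenceBasis (R ⧸ p.under R) (fun i ↦ Ideal.Quotient.mk p (y i)) := by
  obtain ⟨ι, x, hx⟩ := exists_isTranscendenceBasis' (R ⧸ p.under R) (A ⧸ p)
  have hc := hx.cardinalMk_eq_trdeg
  rw [← tt_cast] at hc
  have e : Nonempty (Fin (tt R p) ≃ ι) := by
    have : Finite ι := Cardinal.lt_aleph0_iff_finite.mp (hc ▸ Cardinal.natCast_lt_aleph0)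
    have : Nat.card ι = tt R p := by rw [Nat.card, hc, Cardinal.toNat_natCast]
    exact ⟨(Finite.equivFinOfCardEq this).symm⟩
  obtain ⟨e⟩ := e
  choose y hy using fun i ↦ Ideal.Quotient.mk_surjective (x (e i))
  refine ⟨y, ?_⟩
  simp only [hy]
  exact (isTranscendenceBasis_equiv' e rfl).mpr hx

lemma le_tt (R : Type*) {A : Type*} [CommRing R] [CommRing A] [Algebra R A]
    [Algebra.FiniteType R A] (p : Ideal A) [p.IsPrime] {n : ℕ} (y : Fin n → A)
    (hy : AlgebraicIndependent (R ⧸ p.under R) (fun i ↦ Ideal.Quotient.mk p (y i))) :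
    n ≤ tt R p := by
  have := hy.lift_cardinalMk_le_trdeg
  rw [← tt_cast] at this
  simpa using this

lemma tt_transfer {R R' : Type*} {A A' : Type*} [CommRing R] [CommRing A] [Algebra R A]
    [Algebra.FiniteType R A] [CommRing R'] [CommRing A'] [Algebra R' A']
    [Algebra.FiniteType R' A'] (p : Ideal A) [p.IsPrime] (p' : Ideal A') [p'.IsPrime]
    (g : R →+* R') (f : A →+* A') (hg : Function.Surjective g) (hf : Function.Surjective f)
    (hp : p'.comap f = p) (hgf : ∀ r, f (algebraMap R A r) = algebraMap R' A' (g r)) :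
    tt R p = tt R' p' := by
  have key : ∀ {n : ℕ} (y : Fin n → A),
      AlgebraicIndependent (R ⧸ p.under R) (fun i ↦ Ideal.Quotient.mk p (y i)) ↔
      AlgebraicIndependent (R' ⧸ p'.under R') (fun i ↦ Ideal.Quotient.mk p' (f (y i))) := by
    intro n y
    rw [algInd_iff p y, algInd_iff p' (fun i ↦ f (y i)),
      (MvPolynomial.map_surjective g hg).forall]
    refine forall_congr' fun F ↦ ?_
    have : MvPolynomial.aeval (fun i ↦ f (y i)) (MvPolynomial.map g F) =
        f (MvPolynomial.aeval y F) := by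
      induction F using MvPolynomial.induction_on with
      | C a => simp [hgf]
      | add f g hf hg => simp only [map_add, hf, hg]
      | mul_X f i hf => simp only [map_mul, hf, MvPolynomial.map_X, MvPolynomial.aeval_X]
    rw [this]
    subst hp
    refine imp_congr Iff.rfl (forall_congr' fun m ↦ ?_)
    simp only [MvPolynomial.coeff_map, Ideal.mem_comap, Ideal.under, hgf]
  apply le_antisymm
  · obtain ⟨y, hy⟩ := exists_basis R p
    exact le_tt R' p' _ ((key y).mp hy.1)
  · obtain ⟨y', hy'⟩ := exists_basis R' p'
    choose y hy using fun i ↦ hf (y' i)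
    refine le_tt R p y ((key y).mpr ?_)
    simp only [hy]
    exact hy'.1

lemma trdeg_le_tt_bot (R : Type*) {A : Type*} [CommRing R] [Nontrivial R] [CommRing A] [IsDomain A]
    [Algebra R A] [Algebra.FiniteType R A] :
    Algebra.trdeg R A ≤ (tt R (⊥ : Ideal A) : ℕ) := by
  rw [tt_cast]
  refine ciSup_le' fun ⟨s, hs⟩ ↦ ?_
  have : AlgebraicIndependent (R ⧸ (⊥ : Ideal A).under R)
      (fun i : s ↦ Ideal.Quotient.mk (⊥ : Ideal A) i.1) := by
    rw [algInd_iff]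
    intro F hF m
    have hF0 : F = 0 := (algebraicIndependent_iff.mp hs) F hF
    simp [hF0]
  exact this.cardinalMk_le_trdeg

lemma exists_dvd_all {R ι : Type*} [CommRing R] [IsDomain R] [ValuationRing R] (f : ι → R)
    (s : Finset ι) (hs : s.Nonempty) : ∃ i ∈ s, ∀ j ∈ s, f i ∣ f j := by
  induction hs using Finset.Nonempty.cons_induction with
  | singleton a => exact ⟨a, by simp, by simp⟩
  | cons a s ha hs ih =>
    obtain ⟨i, hi, h⟩ := ih
    rcases ValuationRing.dvd_total (f a) (f i) with h1 | h1
    · refine ⟨a, by simp, fun j hj ↦ ?_⟩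
      rcases Finset.mem_cons.mp hj with rfl | hj
      · exact dvd_rfl
      · exact h1.trans (h j hj)
    · refine ⟨i, by simp [hi], fun j hj ↦ ?_⟩
      rcases Finset.mem_cons.mp hj with rfl | hj
      · exact h1
      · exact h j hj

/-- Over a valuation ring, algebraic independence lifts along generalizations. -/
lemma algInd_of_le {R A ι : Type*} [CommRing R] [IsDomain R] [ValuationRing R] [CommRing A]
    [Algebra R A] (q p : Ideal A) [hq : q.IsPrime] [hp : p.IsPrime] (hqp : q ≤ p) (y : ι → A)
    (h : AlgebraicIndependent (R ⧸ p.under R) (fun i ↦ Ideal.Quotient.mk p (y i))) :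
    AlgebraicIndependent (R ⧸ q.under R) (fun i ↦ Ideal.Quotient.mk q (y i)) := by
  rw [algInd_iff] at h ⊢
  intro F hF m
  by_contra hm
  have hm0 : m ∈ F.support := by
    rw [MvPolynomial.mem_support_iff]
    intro h0
    exact hm (h0 ▸ Ideal.zero_mem _)
  obtain ⟨m₀, -, hd⟩ := exists_dvd_all (fun m ↦ F.coeff m) F.support ⟨m, hm0⟩
  have hd' : ∀ j, F.coeff m₀ ∣ F.coeff j := by
    intro j
    by_cases hj : j ∈ F.support
    · exact hd j hj
    · rw [MvPolynomial.notMem_support_iff.mp hj]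
      exact dvd_zero _
  obtain ⟨F0, hF0⟩ := MvPolynomial.C_dvd_iff_dvd_coeff _ _ |>.mpr hd'
  have hc : F.coeff m₀ ∉ q.under R := fun hc ↦ hm (Ideal.mem_of_dvd _ (hd' m) hc)
  have hc0 : F.coeff m₀ ≠ 0 := fun h0 ↦ hc (h0 ▸ Ideal.zero_mem _)
  have h1 : F0.coeff m₀ = 1 := by
    have := congrArg (MvPolynomial.coeff m₀) hF0
    rw [MvPolynomial.coeff_C_mul] at this
    exact mul_left_cancel₀ hc0 (by rw [← this, mul_one])
  have h2 : MvPolynomial.aeval y F0 ∈ q := by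
    rw [hF0, map_mul, MvPolynomial.aeval_C] at hF
    exact (hq.mem_or_mem hF).resolve_left hc
  have h3 := h F0 (hqp h2) m₀
  rw [h1] at h3
  exact (inferInstance : (p.under R).IsPrime).ne_top ((Ideal.eq_top_iff_one _).mpr h3)

lemma tt_anti {R A : Type*} [CommRing R] [IsDomain R] [ValuationRing R] [CommRing A]
    [Algebra R A] [Algebra.FiniteType R A] (q p : Ideal A) [hq : q.IsPrime] [hp : p.IsPrime]
    (hqp : q ≤ p) : tt R p ≤ tt R q := by
  obtain ⟨y, hy⟩ := exists_basis R p
  exact le_tt R q y (algInd_of_le q p hqp y hy.1)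

lemma tt_strict {R A : Type*} [CommRing R] [IsDomain R] [ValuationRing R] [CommRing A]
    [Algebra R A] [Algebra.FiniteType R A] (q p : Ideal A) [hq : q.IsPrime] [hp : p.IsPrime]
    (hqp : q < p) (hu : q.under R = p.under R) : tt R p + 1 ≤ tt R q := by
  obtain ⟨y, hy⟩ := exists_basis R p
  by_contra hlt
  have hle : tt R q ≤ tt R p := by omega
  have hyq := algInd_of_le q p hqp.le y hy.1
  have hbas : IsTranscendenceBasis (R ⧸ q.under R) (fun i ↦ Ideal.Quotient.mk q (y i)) := by
    refine hyq.isTranscendenceBasis_of_lift_trdeg_le_of_finite ?_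
    rw [← tt_cast]
    simpa using hle
  obtain ⟨f, hfp, hfq⟩ := Set.exists_of_ssubset hqp
  have hf0 : Ideal.Quotient.mk q f ≠ 0 := by
    rwa [Ne, Ideal.Quotient.eq_zero_iff_mem]
  obtain ⟨⟨r, hr⟩, hr0, hdvd⟩ := (hbas.isAlgebraic.isAlgebraic
    (Ideal.Quotient.mk q f)).exists_nonzero_dvd (mem_nonZeroDivisors_of_ne_zero hf0)
  have hG : ∃ G : MvPolynomial (Fin (tt R p)) R,
      Ideal.Quotient.mk q (MvPolynomial.aeval y G) = r := by
    clear hdvd hr0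
    induction hr using Algebra.adjoin_induction with
    | mem c hc =>
      obtain ⟨i, rfl⟩ := hc
      exact ⟨MvPolynomial.X i, by simp⟩
    | algebraMap r =>
      obtain ⟨r, rfl⟩ := Ideal.Quotient.mk_surjective r
      exact ⟨MvPolynomial.C r, by rw [MvPolynomial.aeval_C]; rfl⟩
    | add a b _ _ ha hb =>
      obtain ⟨a, rfl⟩ := ha
      obtain ⟨b, rfl⟩ := hb
      exact ⟨a + b, by simp⟩
    | mul a b _ _ ha hb =>
      obtain ⟨a, rfl⟩ := ha
      obtain ⟨b, rfl⟩ := hb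
      exact ⟨a * b, by simp⟩
  obtain ⟨G, rfl⟩ := hG
  obtain ⟨c, hc⟩ := hdvd
  obtain ⟨c, rfl⟩ := Ideal.Quotient.mk_surjective c
  change Ideal.Quotient.mk q (MvPolynomial.aeval y G) = _ at hc
  rw [← map_mul, Ideal.Quotient.eq] at hc
  have hGp : MvPolynomial.aeval y G ∈ p := by
    have := p.add_mem (hqp.le hc) (p.mul_mem_right c hfp)
    simpa using this
  have hcoef := (algInd_iff p y).mp hy.1 G hGp
  refine hr0 (Subtype.ext (Ideal.Quotient.eq_zero_iff_mem.mpr ?_))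
  rw [MvPolynomial.aeval_def, MvPolynomial.eval₂_eq]
  refine Ideal.sum_mem _ fun m _ ↦ Ideal.mul_mem_right _ _ ?_
  have := hcoef m
  rw [← hu] at this
  exact this


open Classical in
/-- Height of a prime of a domain of dimension at most one. -/
noncomputable def hh {R : Type*} [CommRing R] (P : Ideal R) : ℕ := if P = ⊥ then 0 else 1

lemma height_le {R A : Type*} [CommRing R] [IsDomain R] [ValuationRing R]
    [Ring.KrullDimLE 1 R] [CommRing A] [IsDomain A]
    [Algebra R A] [Algebra.FiniteType R A] (p : Ideal A) [hp : p.IsPrime] :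
    p.height ≤ ((tt R (⊥ : Ideal A) + hh (p.under R) - tt R p : ℕ) : ℕ∞) := by
  let D : PrimeSpectrum A → ℕ := fun p ↦
    tt R (⊥ : Ideal A) + hh (p.asIdeal.under R) - tt R p.asIdeal
  have hD : StrictMono D := by
    intro q p hqp
    have hqp' : q.asIdeal < p.asIdeal := hqp
    have h0 : tt R q.asIdeal ≤ tt R (⊥ : Ideal A) := tt_anti _ _ bot_le
    have hle := tt_anti (R := R) q.asIdeal p.asIdeal hqp'.le
    change tt R (⊥ : Ideal A) + hh (q.asIdeal.under R) - tt R q.asIdeal <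
      tt R (⊥ : Ideal A) + hh (p.asIdeal.under R) - tt R p.asIdeal
    by_cases hu : q.asIdeal.under R = p.asIdeal.under R
    · have := tt_strict (R := R) q.asIdeal p.asIdeal hqp' hu
      rw [hu]
      omega
    · have hlt : q.asIdeal.under R < p.asIdeal.under R :=
        lt_of_le_of_ne (Ideal.comap_mono hqp'.le) hu
      have hQ : q.asIdeal.under R = ⊥ := by
        by_contra hne
        have hm := Ideal.isMaximal_of_isPrime_of_ne_bot (q.asIdeal.under R) hne
        exact hu (hm.eq_of_le (inferInstance : (p.asIdeal.under R).IsPrime).ne_top hlt.le)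
      have hP : p.asIdeal.under R ≠ ⊥ := by
        rw [hQ] at hlt
        exact hlt.ne'
      simp only [hh, hQ, hP, if_true, if_false]
      omega
  have := Order.height_le_height_apply_of_strictMono D hD ⟨p, hp⟩
  rw [Order.height_nat] at this
  rwa [← PrimeSpectrum.height_eq_orderHeight] at this

open TensorProduct in
lemma exists_finset_of_under_eq_bot {R A : Type*} [CommRing R] [IsDomain R] [CommRing A]
    [Algebra R A] [Algebra.FiniteType R A] (p : Ideal A) [hp : p.IsPrime]
    (hu : p.under R = ⊥) :
    ∃ s : Finset A, p ∈ (Ideal.span (s : Set A)).minimalPrimes ∧ (s.card : ℕ∞) ≤ p.height := by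
  classical
  let K := FractionRing R
  let L := A ⊗[R] K
  let M := Algebra.algebraMapSubmonoid A (nonZeroDivisors R)
  have hloc : IsLocalization M L := inferInstance
  have hN0 : IsNoetherianRing (K ⊗[R] A) := Algebra.FiniteType.isNoetherianRing K _
  have hN : IsNoetherianRing L :=
    isNoetherianRing_of_ringEquiv _ (Algebra.TensorProduct.comm R K A).toRingEquiv
  have hdisj : Disjoint (M : Set A) (p : Set A) := by
    rw [Set.disjoint_left]
    rintro _ ⟨r, hr, rfl⟩ hrp
    have : r ∈ p.under R := hrp
    rw [hu] at this
    exact nonZeroDivisors.ne_zero hr this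
  let P := p.map (algebraMap A L)
  have hP : P.IsPrime := IsLocalization.isPrime_of_isPrime_disjoint M L p hp hdisj
  have hPp : P.under A = p := IsLocalization.comap_map_of_isPrime_disjoint M L hp hdisj
  obtain ⟨t, ht, htc⟩ := Ideal.exists_finset_card_eq_height_of_isNoetherianRing P
  obtain ⟨b, hb⟩ := IsLocalization.exist_integer_multiples_of_finset M t
  have hb' : ∀ a : L, ∃ a' : A, a ∈ t → algebraMap A L a' = algebraMap A L b.1 * a := by
    intro a
    by_cases ha : a ∈ t
    · obtain ⟨a', ha'⟩ := hb a ha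
      exact ⟨a', fun _ ↦ ha'.trans (Algebra.smul_def _ _)⟩
    · exact ⟨0, fun h ↦ absurd h ha⟩
  choose g hg using hb'
  have hbu : IsUnit (algebraMap A L b.1) := IsLocalization.map_units L b
  have hspan : (Ideal.span ((t.image g : Finset A) : Set A)).map (algebraMap A L) =
      Ideal.span (t : Set L) := by
    rw [Ideal.map_span]
    apply le_antisymm
    · rw [Ideal.span_le]
      rintro _ ⟨_, hx, rfl⟩
      obtain ⟨a, ha, rfl⟩ := Finset.mem_image.mp hx
      rw [SetLike.mem_coe, hg a ha]
      exact Ideal.mul_mem_left _ _ (Ideal.subset_span ha)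
    · rw [Ideal.span_le]
      intro a ha
      have h1 : algebraMap A L b.1 * a ∈
          Ideal.span (algebraMap A L '' ((t.image g : Finset A) : Set A)) := by
        rw [← hg a ha]
        exact Ideal.subset_span ⟨g a, Finset.mem_coe.mpr (Finset.mem_image_of_mem g ha), rfl⟩
      exact (Ideal.unit_mul_mem_iff_mem _ hbu).mp h1
  refine ⟨t.image g, ?_, ?_⟩
  · rw [← hspan, IsLocalization.minimalPrimes_map M L] at ht
    have : P.under A ∈ (Ideal.span ((t.image g : Finset A) : Set A)).minimalPrimes := ht
    rwa [hPp] at this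
  · calc ((t.image g).card : ℕ∞) ≤ t.card := by exact_mod_cast Finset.card_image_le
      _ = P.height := htc
      _ = (P.under A).height := (IsLocalization.height_under M P).symm
      _ = p.height := by rw [hPp]

lemma exists_finset_of_under_isMaximal {R A : Type*} [CommRing R] [IsDomain R] [CommRing A]
    [IsDomain A] [Algebra R A] [Algebra.FiniteType R A] (hinj : Function.Injective (algebraMap R A))
    (p : Ideal A) [hp : p.IsPrime] (hu : (p.under R).IsMaximal) (hne : p.under R ≠ ⊥) :
    ∃ s : Finset A, p ∈ ((p.under R).map (algebraMap R A) ⊔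
      Ideal.span (s : Set A)).minimalPrimes ∧ ((s.card + 1 : ℕ) : ℕ∞) ≤ p.height := by
  classical
  set I := (p.under R).map (algebraMap R A) with hI
  have hIp : I ≤ p := Ideal.map_comap_le
  have hI0 : I ≠ ⊥ := by
    intro h0
    apply hne
    rw [eq_bot_iff]
    intro r hr
    have : algebraMap R A r ∈ I := Ideal.mem_map_of_mem _ hr
    rw [h0] at this
    exact hinj (by simpa using this)
  have hN : IsNoetherianRing (A ⧸ I) := by
    letI := Ideal.Quotient.field (p.under R)
    letI : Algebra (R ⧸ p.under R) (A ⧸ I) :=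
      (Ideal.quotientMap I (algebraMap R A) Ideal.le_comap_map).toAlgebra
    have : IsScalarTower R (R ⧸ p.under R) (A ⧸ I) := IsScalarTower.of_algebraMap_eq fun r ↦ rfl
    have : Algebra.FiniteType R (A ⧸ I) :=
      Algebra.FiniteType.of_surjective (Ideal.Quotient.mkₐ R I) Ideal.Quotient.mk_surjective
    have : Algebra.FiniteType (R ⧸ p.under R) (A ⧸ I) := .of_restrictScalars_finiteType R _ _
    exact Algebra.FiniteType.isNoetherianRing (R ⧸ p.under R) _
  let π := Ideal.Quotient.mk I
  have hπ : Function.Surjective π := Ideal.Quotient.mk_surjective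
  let P := p.map π
  have hP : P.IsPrime := Ideal.map_isPrime_of_surjective hπ (by rwa [Ideal.mk_ker])
  have hPp : P.comap π = p := by
    rw [Ideal.comap_map_of_surjective π hπ, ← RingHom.ker_eq_comap_bot, Ideal.mk_ker, sup_eq_left]
    exact hIp
  obtain ⟨t, ht, htc⟩ := Ideal.exists_finset_card_eq_height_of_isNoetherianRing P
  have hπ' := hπ
  choose g hg using hπ'
  refine ⟨t.image g, ?_, ?_⟩
  · have h1 := Ideal.minimalPrimes_comap_of_surjective hπ ht
    rw [hPp] at h1
    convert h1 using 2
    have h2 : Ideal.span (t : Set (A ⧸ I)) = (Ideal.span ((t.image g : Finset A) : Set A)).map π := by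
      rw [Ideal.map_span, Finset.coe_image, ← Set.image_comp]
      congr 1
      have : (π ∘ g) = id := funext hg
      rw [this, Set.image_id]
    rw [h2, Ideal.comap_map_of_surjective π hπ, ← RingHom.ker_eq_comap_bot, Ideal.mk_ker, sup_comm]
  · obtain ⟨l, hl, hlc⟩ := Ideal.exists_ltSeries_length_eq_height P
    have hmono : StrictMono (PrimeSpectrum.comap π) := by
      intro a b hab
      refine lt_of_le_of_ne (Ideal.comap_mono hab.le) ?_
      intro h
      exact hab.ne (PrimeSpectrum.comap_injective_of_surjective π hπ h)
    let l1 := l.map (PrimeSpectrum.comap π) hmono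
    let b : PrimeSpectrum A := ⟨⊥, Ideal.isPrime_bot⟩
    have hb : b < l1.head := by
      have h1 : I ≤ l1.head.asIdeal := by
        rw [LTSeries.head_map]
        intro x hx
        change π x ∈ l.head.asIdeal
        rw [Ideal.Quotient.eq_zero_iff_mem.mpr hx]
        exact Ideal.zero_mem _
      change ⊥ < l1.head.asIdeal
      exact lt_of_lt_of_le (bot_lt_iff_ne_bot.mpr hI0) h1
    let l2 : LTSeries (PrimeSpectrum A) := l1.cons b hb
    have hlast : l2.last = ⟨p, hp⟩ := by
      rw [RelSeries.last_cons, LTSeries.last_map, hl]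
      exact PrimeSpectrum.ext hPp
    have hlen : l2.length = l.length + 1 := by
      simp only [l2, l1, RelSeries.cons_length, LTSeries.map_length]
    have := Order.length_le_height (p := l2) (x := ⟨p, hp⟩) hlast.le
    rw [hlen, ← PrimeSpectrum.height_eq_orderHeight] at this
    refine le_trans ?_ this
    have h3 : l.length = t.card := by
      have : (l.length : ℕ∞) = t.card := by rw [hlc, htc]
      exact_mod_cast this
    rw [h3]
    exact_mod_cast Nat.succ_le_succ Finset.card_image_le

lemma height_formula {R A : Type*} [CommRing R] [IsDomain R] [ValuationRing R]
    [Ring.KrullDimLE 1 R] [CommRing A] [IsDomain A]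
    [Algebra R A] [Algebra.FiniteType R A] (hinj : Function.Injective (algebraMap R A))
    (p : Ideal A) [hp : p.IsPrime] :
    ∃ n : ℕ, p.height = n ∧ n + tt R p = tt R (⊥ : Ideal A) + hh (p.under R) := by
  have hs : ∃ s : Finset A, p ∈ ((p.under R).map (algebraMap R A) ⊔
      Ideal.span (s : Set A)).minimalPrimes ∧ ((s.card + hh (p.under R) : ℕ) : ℕ∞) ≤ p.height := by
    by_cases hu : p.under R = ⊥
    · obtain ⟨s, h1, h2⟩ := exists_finset_of_under_eq_bot p hu
      refine ⟨s, ?_, ?_⟩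
      · rwa [hu, Ideal.map_bot, bot_sup_eq]
      · simpa [hh, hu] using h2
    · obtain ⟨s, h1, h2⟩ := exists_finset_of_under_isMaximal hinj p
        (Ideal.isMaximal_of_isPrime_of_ne_bot (p.under R) hu) hu
      refine ⟨s, h1, ?_⟩
      simpa [hh, hu] using h2
  obtain ⟨s, hs, hle⟩ := hs
  have hup := height_le (R := R) p
  obtain ⟨n, hn⟩ := ENat.ne_top_iff_exists.mp (ne_top_of_le_ne_top (ENat.coe_ne_top _) hup)
  refine ⟨n, hn.symm, ?_⟩
  rw [← hn] at hup hle
  have hup' := ENat.coe_le_coe.mp hup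
  have hle' := ENat.coe_le_coe.mp hle
  have hanti : tt R p ≤ tt R (⊥ : Ideal A) := tt_anti _ _ bot_le
  have htr := trdeg_le p s hs
  rw [← tt_cast] at htr
  have hbot : tt R (⊥ : Ideal A) ≤ tt R p + s.card := by
    have hb : Function.Injective (algebraMap R A) := hinj
    obtain ⟨y, hy⟩ := exists_basis R (⊥ : Ideal A)
    have hyi : AlgebraicIndependent R y := by
      rw [algebraicIndependent_iff]
      intro F hF
      ext m
      have h := (algInd_iff (R := R) (⊥ : Ideal A) y).mp hy.1 F (by rw [hF]; exact Ideal.zero_mem _) m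
      have h' : algebraMap R A (F.coeff m) = 0 := h
      rw [MvPolynomial.coeff_zero]
      exact hinj (by rw [h', map_zero])
    have h1 := hyi.lift_cardinalMk_le_trdeg
    have h2 := h1.trans (Cardinal.lift_le.mpr htr)
    simp only [Cardinal.mk_fin, Cardinal.lift_natCast, ← Nat.cast_add] at h2
    exact_mod_cast h2
  omega

lemma primeHt_eq {A : Type*} [CommRing A] (p : Ideal A) [hp : p.IsPrime] :
    primeHt p = p.height := by
  rw [primeHt, iSup_pos hp, ← PrimeSpectrum.height_eq_orderHeight]

end DimForm


/-- **Dimension formula over rank-1 valuation rings.**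
Let `R` be a valuation ring of rank 1 (a valuation domain of Krull dimension 1), and let `A`
be an integral domain that is a finitely generated `R`-algebra with injective structure map.
Then for any prime ideals `q ⊆ p` of `A`, one has `ht p = ht q + ht (p / q)`, where
`ht (p / q)` is the height of the image of `p` in `A ⧸ q`. -/
theorem dimension_formula_over_rank_one_valuation_ring
    {R A : Type*} [CommRing R] [IsDomain R] [ValuationRing R]
    (hrank : ringKrullDim R = 1)
    [CommRing A] [IsDomain A] [Algebra R A] [Algebra.FiniteType R A]
    (hinj : Function.Injective (algebraMap R A))
    (q p : Ideal A) (hq : q.IsPrime) (hp : p.IsPrime) (hqp : q ≤ p) :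
    primeHt p = primeHt q + primeHt (p.map (Ideal.Quotient.mk q)) := by
  have hK : Ring.KrullDimLE 1 R := by
    rw [Ring.krullDimLE_iff, hrank]
    rfl
  have hsurj : Function.Surjective (Ideal.Quotient.mk q) := Ideal.Quotient.mk_surjective
  have hP : (p.map (Ideal.Quotient.mk q)).IsPrime :=
    Ideal.map_isPrime_of_surjective hsurj (by rwa [Ideal.mk_ker])
  have hPp : (p.map (Ideal.Quotient.mk q)).comap (Ideal.Quotient.mk q) = p := by
    rw [Ideal.comap_map_of_surjective _ hsurj, ← RingHom.ker_eq_comap_bot, Ideal.mk_ker,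
      sup_eq_left]
    exact hqp
  have hqb : (⊥ : Ideal (A ⧸ q)).comap (Ideal.Quotient.mk q) = q := by
    rw [← RingHom.ker_eq_comap_bot, Ideal.mk_ker]
  rw [DimForm.primeHt_eq, DimForm.primeHt_eq, DimForm.primeHt_eq]
  generalize p.map (Ideal.Quotient.mk q) = P at hP hPp
  have hft : Algebra.FiniteType R (A ⧸ q) :=
    Algebra.FiniteType.of_surjective (Ideal.Quotient.mkₐ R q) hsurj
  obtain ⟨np, hnp, hp1⟩ := DimForm.height_formula hinj p
  obtain ⟨nq, hnq, hq1⟩ := DimForm.height_formula hinj q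
  have hb : (⊥ : Ideal (A ⧸ q)).IsPrime := Ideal.isPrime_bot
  by_cases hu : q.under R = ⊥
  · have hinj' : Function.Injective (algebraMap R (A ⧸ q)) := by
      rw [injective_iff_map_eq_zero]
      intro r hr
      have h0 : algebraMap R A r ∈ q := Ideal.Quotient.eq_zero_iff_mem.mp hr
      have h1 : r ∈ q.under R := h0
      rwa [hu] at h1
    obtain ⟨n, hn, h1⟩ := DimForm.height_formula hinj' P
    have e1 := DimForm.tt_transfer p P (RingHom.id R) (Ideal.Quotient.mk q)
      Function.surjective_id hsurj hPp (fun r ↦ rfl)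
    have e2 := DimForm.tt_transfer q (⊥ : Ideal (A ⧸ q)) (RingHom.id R) (Ideal.Quotient.mk q)
      Function.surjective_id hsurj hqb (fun r ↦ rfl)
    have e3 : P.under R = p.under R := by
      rw [← hPp]
      rfl
    have e4 : DimForm.hh (q.under R) = 0 := by simp [DimForm.hh, hu]
    rw [hnp, hnq, hn]
    rw [e3] at h1
    have : np = nq + n := by omega
    exact_mod_cast this
  · have hm : (q.under R).IsMaximal := Ideal.isMaximal_of_isPrime_of_ne_bot (q.under R) hu
    have hpq : q.under R = p.under R :=
      hm.eq_of_le (inferInstance : (p.under R).IsPrime).ne_top (Ideal.comap_mono hqp)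
    have hkf : IsField (R ⧸ q.under R) := (Ideal.Quotient.maximal_ideal_iff_isField_quotient _).mp hm
    have hval : ValuationRing (R ⧸ q.under R) := by
      letI := hkf.toField
      exact ValuationRing.of_field _
    have hdim : Ring.KrullDimLE 1 (R ⧸ q.under R) := by
      rw [Ring.krullDimLE_iff, ringKrullDim_eq_zero_of_isField hkf]
      exact zero_le_one
    have hft' : Algebra.FiniteType (R ⧸ q.under R) (A ⧸ q) := .of_restrictScalars_finiteType R _ _
    have hinj' : Function.Injective (algebraMap (R ⧸ q.under R) (A ⧸ q)) :=
      FaithfulSMul.algebraMap_injective _ _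
    obtain ⟨n, hn, h1⟩ := DimForm.height_formula hinj' P
    have e1 := DimForm.tt_transfer p P (Ideal.Quotient.mk (q.under R)) (Ideal.Quotient.mk q)
      Ideal.Quotient.mk_surjective hsurj hPp (fun r ↦ rfl)
    have e2 := DimForm.tt_transfer q (⊥ : Ideal (A ⧸ q)) (Ideal.Quotient.mk (q.under R))
      (Ideal.Quotient.mk q) Ideal.Quotient.mk_surjective hsurj hqb (fun r ↦ rfl)
    have e3 : P.under (R ⧸ q.under R) = ⊥ := by
      rw [eq_bot_iff]
      intro x hx
      obtain ⟨r, rfl⟩ := Ideal.Quotient.mk_surjective x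
      have h2 : algebraMap R A r ∈ P.comap (Ideal.Quotient.mk q) := hx
      rw [hPp] at h2
      have h3 : r ∈ q.under R := by
        rw [hpq]
        exact h2
      exact Ideal.Quotient.eq_zero_iff_mem.mpr h3
    have e4 : DimForm.hh (P.under (R ⧸ q.under R)) = 0 := by simp [DimForm.hh, e3]
    rw [hnp, hnq, hn]
    rw [← hpq] at hp1
    have : np = nq + n := by omega
    exact_mod_cast this
end

section
/- Codimension in fiber products over rank-1 valuation rings: let R be a valuation ring of rank 1 with maximal ideal m, and let A be a finitely generated R-algebra whose spectrum is irreducible (A has a unique minimal prime). Let p and p' be prime ideals of A, and let P be a prime ideal of A ⊗_R A minimal over the ideal generated by the images of p under a ↦ a ⊗ 1 and of p' under a ↦ 1 ⊗ a. Then ht(P) ≤ ht(p) + ht(p') (heights of P taken in A ⊗_R A, of p and p' in A). Furthermore, equality holds unless the structure map R → A/nil(A) is injective and both p and p' contain mA. -/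
open Cardinal

theorem Cod.quasiFiniteAt_of {C A : Type*} [CommRing C] [CommRing A] [Algebra C A]
    [Algebra.FiniteType C A] (q : Ideal A) [hq : q.IsPrime]
    (hmin : ∀ q' : Ideal A, q'.IsPrime → q' ≤ q → q'.comap (algebraMap C A) = q.comap (algebraMap C A) → q ≤ q')
    (hmax : ∀ q' : Ideal A, q'.IsPrime → q ≤ q' → q'.comap (algebraMap C A) = q.comap (algebraMap C A) → q' ≤ q) :
    Algebra.QuasiFiniteAt C q := by
  let Q : PrimeSpectrum A := ⟨q, hq⟩
  apply Algebra.QuasiFiniteAt.of_isOpen_singleton_fiber Q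
  let P := Q.comap (algebraMap C A)
  let e := PrimeSpectrum.preimageHomeomorphFiber C A P
  have hN : IsNoetherianRing (P.asIdeal.Fiber A) :=
    Algebra.FiniteType.isNoetherianRing P.asIdeal.ResidueField _
  have hJ : IsJacobsonRing (P.asIdeal.Fiber A) :=
    isJacobsonRing_of_finiteType (A := P.asIdeal.ResidueField)
  let z : PrimeSpectrum.comap (algebraMap C A) ⁻¹' {Q.comap (algebraMap C A)} := ⟨Q, rfl⟩
  change IsOpen {z}
  rw [← e.isOpen_image, Set.image_singleton]
  refine ((PrimeSpectrum.isOpen_singleton_tfae_of_isNoetherian_of_isJacobsonRing (e z)).out 0 2).mpr ?_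
  constructor
  · rw [← Set.image_singleton, e.isClosed_image]
    refine isClosed_induced_iff.mpr ⟨_, PrimeSpectrum.isClosed_zeroLocus (q : Set A), ?_⟩
    ext ⟨w, hw⟩
    simp only [Set.mem_preimage, PrimeSpectrum.mem_zeroLocus, Set.mem_singleton_iff]
    constructor
    · intro h
      apply Subtype.ext
      apply PrimeSpectrum.ext
      exact le_antisymm (hmax _ w.2 h (congrArg PrimeSpectrum.asIdeal hw)) h
    · intro h
      have h2 : w = Q := congrArg Subtype.val h
      rw [h2]
  · intro a b hab ha
    rw [Set.mem_singleton_iff] at ha ⊢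
    subst ha
    rw [← e.symm_apply_eq] 
    have h := (hab.map e.symm.continuous).map continuous_subtype_val
    rw [e.symm_apply_apply] at h
    have h' := (PrimeSpectrum.le_iff_specializes _ _).mpr h
    apply Subtype.ext
    apply PrimeSpectrum.ext
    exact le_antisymm h' (hmin _ (e.symm b).1.2 h' (congrArg PrimeSpectrum.asIdeal (e.symm b).2))

theorem Cod.isAlgebraic_of_quasiFiniteAt {C A : Type*} [CommRing C] [IsDomain C] [CommRing A] [IsDomain A]
    [Algebra C A] [Algebra.FiniteType C A] (q : Ideal A) [q.IsPrime] [Algebra.QuasiFiniteAt C q] :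
    Algebra.IsAlgebraic C A := by
  obtain ⟨r, hr, hri, h⟩ := Algebra.zariskisMainProperty_iff.mp
    (Algebra.ZariskisMainProperty.of_finiteType (R := C) q)
  refine ⟨fun x => ?_⟩
  obtain ⟨m, hm⟩ := h x
  have hr0 : r ≠ 0 := fun h => hr (h ▸ q.zero_mem)
  have := IsAlgebraic.of_mul (R := C) (y := r ^ m) (z := x) (mem_nonZeroDivisors_of_ne_zero (pow_ne_zero _ hr0))
    ((hri.pow m).isAlgebraic)
  exact this hm.isAlgebraic

/-- nonzero ideals in algebraic extensions meet the base -/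
theorem Cod.exists_mem_of_algebraic {S X : Type*} [CommRing S] [CommRing X] [IsDomain X] [Algebra S X]
    [Algebra.IsAlgebraic S X] (I : Ideal X) (hI : I ≠ ⊥) :
    ∃ c : S, c ≠ 0 ∧ algebraMap S X c ∈ I := by
  obtain ⟨x, hx, hx0⟩ := Submodule.exists_mem_ne_zero_of_ne_bot hI
  have := Ideal.comap_ne_bot_of_algebraic_mem hx0 hx (Algebra.IsAlgebraic.isAlgebraic (R := S) x)
  obtain ⟨c, hc, hc0⟩ := Submodule.exists_mem_ne_zero_of_ne_bot this
  exact ⟨c, hc0, hc⟩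

theorem Cod.trdeg_lt {S : Type*} {X Z : Type*} [CommRing S] [IsDomain S] [CommRing X] [IsDomain X] [CommRing Z]
    [IsDomain Z] [Algebra S X] [Algebra S Z] [FaithfulSMul S X] [FaithfulSMul S Z] [Algebra.FiniteType S X]
    (π : X →ₐ[S] Z) (hπ : Function.Surjective π) (hinj : RingHom.ker π ≠ ⊥) :
    (Algebra.trdeg S Z).toNat < (Algebra.trdeg S X).toNat := by
  have fX : Algebra.trdeg S X < ℵ₀ := trdeg_lt_aleph0_of_finiteType
  have : Algebra.FiniteType S Z := .of_surjective π hπ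
  have fZ : Algebra.trdeg S Z < ℵ₀ := trdeg_lt_aleph0_of_finiteType
  obtain ⟨s, hs⟩ := exists_isTranscendenceBasis S Z
  have hsc := hs.cardinalMk_eq_trdeg
  have : Finite s := mk_lt_aleph0_iff.mp (hsc ▸ fZ)
  choose g hg using hπ
  have hind : AlgebraicIndependent S (fun i : s => g i.1) := by
    apply AlgebraicIndependent.of_comp π
    convert hs.1 using 1
    ext i; simp [hg]
  by_contra! hle
  have hb : IsTranscendenceBasis S (fun i : s => g i.1) := by
    apply hind.isTranscendenceBasis_of_lift_trdeg_le_of_finite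
    rw [← hsc] at hle
    have h1 : toNat (lift.{_} (Algebra.trdeg S X)) ≤ toNat (lift.{_} #s) := by simpa using hle
    exact (toNat_le_iff_le_of_lt_aleph0 (by simpa using fX) (by simp)).mp h1
  have halg := hb.isAlgebraic
  obtain ⟨c, hc0, hc⟩ := Cod.exists_mem_of_algebraic
    (S := Algebra.adjoin S (Set.range (fun i : s => g i.1))) _ hinj
  apply hc0
  obtain ⟨c, hcm⟩ := c
  rw [Algebra.adjoin_range_eq_range_aeval] at hcm
  obtain ⟨F, rfl⟩ := hcm
  have hc : π (MvPolynomial.aeval (fun i : s => g i.1) F) = 0 := hc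
  have h2 : MvPolynomial.aeval (fun i : s => (i.1 : Z)) F = 0 := by
    rw [← hc, ← AlgHom.comp_apply, MvPolynomial.comp_aeval]
    congr 2; ext i; simp [hg]
  have h3 := hs.1 (h2.trans (map_zero _).symm)
  apply Subtype.ext
  simp [h3]

theorem Cod.trdeg_le_of_bezout {R S k : Type*} {X Z : Type*} [CommRing R] [CommRing S] [IsDomain S] [IsBezout S]
    [CommRing k] [IsDomain k] [CommRing X] [IsDomain X] [CommRing Z] [IsDomain Z]
    [Algebra R S] [Algebra R k] [Algebra R X] [Algebra R Z] [Algebra S X] [Algebra k Z]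
    [IsScalarTower R S X] [IsScalarTower R k Z] [FaithfulSMul S X] [FaithfulSMul k Z]
    [Algebra.FiniteType S X] [Algebra.FiniteType k Z]
    (hS : Function.Surjective (algebraMap R S)) 
    (hker : RingHom.ker (algebraMap R S) ≤ RingHom.ker (algebraMap R k))
    (π : X →ₐ[R] Z) (hπ : Function.Surjective π) :
    (Algebra.trdeg k Z).toNat ≤ (Algebra.trdeg S X).toNat := by
  have fX : Algebra.trdeg S X < ℵ₀ := trdeg_lt_aleph0_of_finiteType
  have fZ : Algebra.trdeg k Z < ℵ₀ := trdeg_lt_aleph0_of_finiteType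
  obtain ⟨s, hs⟩ := exists_isTranscendenceBasis k Z
  have hsc := hs.cardinalMk_eq_trdeg
  have : Finite s := mk_lt_aleph0_iff.mp (hsc ▸ fZ)
  choose g hg using hπ
  let f : S →+* k := RingHom.liftOfRightInverse (algebraMap R S) (Function.surjInv hS) (Function.rightInverse_surjInv hS)
    ⟨algebraMap R k, hker⟩
  have hf : ∀ r, f (algebraMap R S r) = algebraMap R k r := fun r => 
    RingHom.liftOfRightInverse_comp_apply _ _ (Function.rightInverse_surjInv hS) ⟨algebraMap R k, hker⟩ r
  have hcomp : (π : X →+* Z).comp (algebraMap S X) = (algebraMap k Z).comp f := by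
    ext c
    obtain ⟨c, rfl⟩ := hS c
    simp [hf, ← IsScalarTower.algebraMap_apply]
  have hind : AlgebraicIndependent S (fun i : s => g i.1) := by
    rw [algebraicIndependent_iff]
    intro F hF
    by_contra hF0
    classical
    -- factor out the content
    let I : Ideal S := Ideal.span (F.support.image F.coeff : Set S)
    obtain ⟨c, hc⟩ : ∃ c, I = Ideal.span {c} := by
      have := IsBezout.isPrincipal_of_FG I ⟨_, rfl⟩
      exact this.1
    have hdvd : ∀ m, ∃ b, F.coeff m = c * b := by
      intro m
      by_cases hm : m ∈ F.support
      · have : F.coeff m ∈ I := Ideal.subset_span (by simpa using ⟨m, by simpa using hm, rfl⟩)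
        rw [hc, Ideal.mem_span_singleton] at this
        exact this
      · exact ⟨0, by simpa using hm⟩
    have hCd : MvPolynomial.C c ∣ F := (MvPolynomial.C_dvd_iff_dvd_coeff _ _).mpr hdvd
    obtain ⟨G, rfl⟩ := hCd
    have hc0 : c ≠ 0 := by rintro rfl; simp at hF0
    have hG : MvPolynomial.aeval (fun i : s => g i.1) G = 0 := by
      rw [map_mul, MvPolynomial.aeval_C] at hF
      rcases mul_eq_zero.mp hF with h | h
      · exact absurd ((map_eq_zero_iff _ (FaithfulSMul.algebraMap_injective S X)).mp h) hc0
      · exact h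
    have hG2 : MvPolynomial.aeval (fun i : s => (i.1 : Z)) (MvPolynomial.map f G) = 0 := by
      have h1 := congrArg π hG
      rw [map_zero, MvPolynomial.aeval_def, ← RingHom.coe_coe, MvPolynomial.hom_eval₂, hcomp] at h1
      rw [MvPolynomial.aeval_def, MvPolynomial.eval₂_map, ← h1]
      congr 1
      ext i; simp [hg]
    have hG3 : MvPolynomial.map f G = 0 := hs.1 (hG2.trans (map_zero _).symm)
    have hle : I ≤ Ideal.span {c} * RingHom.ker f := by
      rw [Ideal.span_le]
      intro y hy
      simp only [Finset.coe_image, Set.mem_image] at hy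
      obtain ⟨m, -, rfl⟩ := hy
      rw [MvPolynomial.coeff_C_mul]
      refine Ideal.mul_mem_mul (Ideal.mem_span_singleton_self _) ?_
      rw [RingHom.mem_ker, ← MvPolynomial.coeff_map, hG3, MvPolynomial.coeff_zero]
    have hcm : c ∈ Ideal.span {c} * RingHom.ker f := hle (hc ▸ Ideal.mem_span_singleton_self _)
    rw [Ideal.mem_span_singleton_mul] at hcm
    obtain ⟨z, hz, hzc⟩ := hcm
    have : z = 1 := mul_left_cancel₀ hc0 (by rw [hzc, mul_one])
    subst this
    simp at hz
  have := hind.lift_cardinalMk_le_trdeg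
  rw [← hsc]
  have := toNat_le_toNat this (by simpa using fX)
  simpa using this

theorem Cod.trdeg_le_of_minimal {R S k : Type*} {X Z : Type*} [CommRing R] [CommRing S] [IsDomain S]
    [CommRing k] [IsDomain k] [CommRing X] [IsDomain X] [CommRing Z] [IsDomain Z]
    [Algebra R S] [Algebra R k] [Algebra R X] [Algebra R Z] [Algebra S X] [Algebra k Z]
    [IsScalarTower R S X] [IsScalarTower R k Z] [FaithfulSMul S X] [FaithfulSMul k Z]
    [Algebra.FiniteType S X] [Algebra.FiniteType k Z]
    (hk : Function.Surjective (algebraMap R k))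
    (π : X →ₐ[R] Z) (hπ : Function.Surjective π) (E : Set X) (hE : E.Finite) (hEk : E ⊆ RingHom.ker π)
    (hmin : ∀ q : Ideal X, q.IsPrime → q ≤ RingHom.ker π → E ⊆ q →
      (∀ r : R, algebraMap R k r = 0 → algebraMap R X r ∈ q) → RingHom.ker π ≤ q) :
    (Algebra.trdeg S X).toNat ≤ (Algebra.trdeg k Z).toNat + E.ncard := by
  have fX : Algebra.trdeg S X < ℵ₀ := trdeg_lt_aleph0_of_finiteType
  have fZ : Algebra.trdeg k Z < ℵ₀ := trdeg_lt_aleph0_of_finiteType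
  obtain ⟨s, hs⟩ := exists_isTranscendenceBasis k Z
  have hsc := hs.cardinalMk_eq_trdeg
  have : Finite s := mk_lt_aleph0_iff.mp (hsc ▸ fZ)
  have halg := hs.isAlgebraic
  have hπ' := hπ
  choose g hg using hπ'
  let T : Set X := Set.range (fun i : s => g i.1) ∪ E
  let C := Algebra.adjoin S T
  have hftC : Algebra.FiniteType C X := .of_restrictScalars_finiteType S C X
  have hlift : ∀ c ∈ Algebra.adjoin k (Set.range (fun i : s => (i.1 : Z))), ∃ d : C, π d = c := by
    intro c hc
    induction hc using Algebra.adjoin_induction with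
    | mem x hx =>
      obtain ⟨i, rfl⟩ := hx
      exact ⟨⟨g i.1, Algebra.subset_adjoin (Or.inl ⟨i, rfl⟩)⟩, hg _⟩
    | algebraMap r =>
      obtain ⟨r, rfl⟩ := hk r
      refine ⟨algebraMap S C (algebraMap R S r), ?_⟩
      rw [← IsScalarTower.algebraMap_apply R k Z]
      change π (algebraMap S X (algebraMap R S r)) = _
      rw [← IsScalarTower.algebraMap_apply R S X, AlgHom.commutes]
    | add x y _ _ hx hy =>
      obtain ⟨a, ha⟩ := hx
      obtain ⟨b, hb⟩ := hy
      exact ⟨a + b, by simp [ha, hb]⟩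
    | mul x y _ _ hx hy =>
      obtain ⟨a, ha⟩ := hx
      obtain ⟨b, hb⟩ := hy
      exact ⟨a * b, by simp [ha, hb]⟩
  have hprime : (RingHom.ker π).IsPrime := RingHom.ker_isPrime _
  have hqf : Algebra.QuasiFiniteAt C (RingHom.ker π) := by
    apply Cod.quasiFiniteAt_of
    · intro q hq hle hcomap
      have hmem : ∀ c : C, π c = 0 → (c : X) ∈ q := by
        intro c hc
        have : c ∈ (RingHom.ker π).comap (algebraMap C X) := hc
        rw [← hcomap] at this
        exact this
      apply hmin q hq hle
      · intro e he
        exact hmem ⟨e, Algebra.subset_adjoin (Or.inr he)⟩ (hEk he)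
      · intro r hr
        have := hmem (algebraMap S C (algebraMap R S r)) (by
          change π (algebraMap S X (algebraMap R S r)) = _
          rw [← IsScalarTower.algebraMap_apply R S X, AlgHom.commutes,
            IsScalarTower.algebraMap_apply R k Z, hr, map_zero])
        rw [IsScalarTower.algebraMap_apply R S X]
        exact this
    · intro q hq hle hcomap
      by_contra hnle
      have hne : q.map π ≠ ⊥ := by
        intro h
        apply hnle
        rw [Ideal.map_eq_bot_iff_le_ker] at h
        exact h
      obtain ⟨c, hc0, hc⟩ := Cod.exists_mem_of_algebraic
        (S := Algebra.adjoin k (Set.range (fun i : s => (i.1 : Z)))) _ hne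
      obtain ⟨d, hd⟩ := hlift c.1 c.2
      have hdq : (d : X) ∈ q := by
        have h1 : (d : X) ∈ (q.map π).comap π := by
          change π d ∈ q.map π
          rw [hd]; exact hc
        rw [Ideal.comap_map_of_surjective _ hπ] at h1
        refine (sup_le le_rfl ?_ : q ⊔ Ideal.comap π ⊥ ≤ q) h1
        exact hle
      have : d ∈ q.comap (algebraMap C X) := hdq
      rw [hcomap] at this
      have h0 : π d = 0 := this
      apply hc0
      apply Subtype.ext
      rw [← hd, h0]; rfl
  have hCX := Cod.isAlgebraic_of_quasiFiniteAt (C := C) (RingHom.ker π)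
  have hle := Algebra.IsAlgebraic.trdeg_le_cardinalMk S T
  have hTfin : T.Finite := (Set.finite_range _).union hE
  have h1 := toNat_le_toNat hle (by simpa using hTfin)
  have h2 : T.ncard ≤ (Set.range (fun i : s => g i.1)).ncard + E.ncard := Set.ncard_union_le _ _
  have h3 : (Set.range (fun i : s => g i.1)).ncard ≤ toNat #s := by
    rw [← Nat.card_coe_set_eq]
    exact Finite.card_range_le _
  have h5 : toNat (Algebra.trdeg k Z) = toNat #s := congrArg _ hsc.symm
  have h4 : toNat #T = T.ncard := Nat.card_coe_set_eq T
  omega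

theorem Cod.flat_of_injective {S L : Type*} [CommRing S] [IsDomain S] [Field L] (f : S →+* L)
    (hf : Function.Injective f) : f.Flat := by
  let g : FractionRing S →+* L := IsFractionRing.lift hf
  have h1 : (algebraMap S (FractionRing S)).Flat :=
    RingHom.flat_algebraMap_iff.mpr (IsLocalization.flat _ (nonZeroDivisors S))
  have h2 : g.Flat := RingHom.Flat.of_isField (Field.toIsField _) g
  have h3 : g.comp (algebraMap S (FractionRing S)) = f := by
    ext x; exact IsFractionRing.lift_algebraMap hf x
  rw [← h3]
  exact h1.comp h2

theorem Cod.regular_of_flat {B C : Type*} [CommRing B] [CommRing C] (f : B →+* C) (hf : f.Flat)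
    {b : B} (hb : b ∈ nonZeroDivisors B) (z : C) (hz : z * f b = 0) : z = 0 := by
  let := f.toAlgebra
  have : Module.Flat B C := hf
  have hr := Module.Flat.isSMulRegular_of_nonZeroDivisors (M := C) hb
  apply hr
  change b • z = b • (0 : C)
  rw [smul_zero, Algebra.smul_def, mul_comm]
  exact hz

theorem Cod.isAlgebraic_map {C C' X D : Type*} [CommRing C] [CommRing C'] [CommRing X] [CommRing D]
    [Algebra C X] [Algebra C' D] (g : X →+* D) (gC : C →+* C') (hgC : Function.Injective gC)
    (h : g.comp (algebraMap C X) = (algebraMap C' D).comp gC) {x : X} (hx : IsAlgebraic C x) :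
    IsAlgebraic C' (g x) := by
  obtain ⟨f, hf0, hf⟩ := hx
  refine ⟨f.map gC, ?_, ?_⟩
  · rwa [Ne, Polynomial.map_eq_zero_iff hgC]
  · have h4 := congrArg g hf
    rw [map_zero, Polynomial.aeval_def, Polynomial.hom_eval₂, h] at h4
    rw [Polynomial.aeval_def, Polynomial.eval₂_map, ← h4]

open TensorProduct in
/-- a transcendence basis of `X` stays regular after base change to `Y`. -/
theorem Cod.aeval_tmul_mem_nonZeroDivisors {S X Y ι : Type*} [CommRing S] [IsDomain S] [CommRing X] [IsDomain X]
    [CommRing Y] [IsDomain Y] [Algebra S X] [Algebra S Y] [Module.Flat S Y] {x : ι → X}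
    (hx : AlgebraicIndependent S x) (F : MvPolynomial ι Y) (hF : F ≠ 0) :
    MvPolynomial.aeval (fun i => (1 : Y) ⊗ₜ[S] x i) F ∈ nonZeroDivisors (Y ⊗[S] X) := by
  let L := FractionRing X
  let a : MvPolynomial ι S →ₐ[S] L := (IsScalarTower.toAlgHom S X L).comp (MvPolynomial.aeval x)
  have ha : Function.Injective a := (IsFractionRing.injective X L).comp hx
  have hflat : a.toRingHom.Flat := Cod.flat_of_injective a.toRingHom ha
  let e : Y ⊗[S] MvPolynomial ι S ≃ₐ[Y] MvPolynomial ι Y := MvPolynomial.algebraTensorAlgEquiv S Y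
  let Φ : Y ⊗[S] MvPolynomial ι S →ₐ[Y] Y ⊗[S] L := Algebra.TensorProduct.map (AlgHom.id Y Y) a
  have hΦ : (Φ : Y ⊗[S] MvPolynomial ι S →+* Y ⊗[S] L).Flat :=
    RingHom.Flat.tensorProductMap (S := Y) (f := AlgHom.id Y Y) (g := a) (RingHom.Flat.id _) hflat
  let J : Y ⊗[S] X →ₐ[Y] Y ⊗[S] L := Algebra.TensorProduct.map (AlgHom.id Y Y) (IsScalarTower.toAlgHom S X L)
  have hJ : Function.Injective J :=
    Module.Flat.lTensor_preserves_injective_linearMap (M := Y) (IsScalarTower.toAlgHom S X L).toLinearMap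
      (IsFractionRing.injective X L)
  have hJF : J (MvPolynomial.aeval (fun i => (1 : Y) ⊗ₜ[S] x i) F) = Φ (e.symm F) := by
    rw [← AlgHom.comp_apply]
    have : J.comp (MvPolynomial.aeval (fun i => (1 : Y) ⊗ₜ[S] x i)) = Φ.comp e.symm.toAlgHom := by
      ext i
      simp [J, Φ, e, a]
    rw [this]; rfl
  have hreg : e.symm F ∈ nonZeroDivisors (Y ⊗[S] MvPolynomial ι S) := by
    rw [mem_nonZeroDivisors_iff_right]
    intro z hz
    have := congrArg e hz
    rw [map_mul, AlgEquiv.apply_symm_apply, map_zero] at this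
    rcases mul_eq_zero.mp this with h | h
    · exact (map_eq_zero_iff e e.injective).mp h
    · exact absurd h hF
  have hreg2 : ∀ z : Y ⊗[S] L, z * Φ (e.symm F) = 0 → z = 0 :=
    Cod.regular_of_flat (Φ : Y ⊗[S] MvPolynomial ι S →+* Y ⊗[S] L) hΦ hreg
  rw [mem_nonZeroDivisors_iff_right]
  intro z hz
  have := congrArg J hz
  rw [map_mul, hJF, map_zero] at this
  exact (map_eq_zero_iff J hJ).mp (hreg2 _ this)

theorem Cod.flat_of_bezout (S X : Type*) [CommRing S] [IsDomain S] [IsBezout S] [CommRing X] [IsDomain X]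
    [Algebra S X] [FaithfulSMul S X] : Module.Flat S X := by
  rw [Module.Flat.flat_iff_torsion_eq_bot_of_isBezout, eq_bot_iff]
  rintro x ⟨⟨r, hr⟩, h⟩
  have h : r • x = 0 := h
  rw [Algebra.smul_def] at h
  rcases mul_eq_zero.mp h with h | h
  · rw [map_eq_zero_iff _ (FaithfulSMul.algebraMap_injective S X)] at h
    exact absurd h (nonZeroDivisors.ne_zero hr)
  · exact h

/-- The image of an algebraic element stays algebraic over the algebra generated by the image of
a transcendence basis. -/
theorem Cod.isAlgebraic_adjoin_map {S X Y D ι : Type*} [CommRing S] [CommRing X] [CommRing Y] [CommRing D]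
    [Algebra S X] [Algebra S Y] [Algebra S D] [Algebra Y D] [IsScalarTower S Y D]
    (gX : X →ₐ[S] D) (u : ι → X) (w : ι → D) (hw : ∀ i, gX (u i) = w i) (hindS : AlgebraicIndependent S w)
    (x : X) (hx : IsAlgebraic (Algebra.adjoin S (Set.range u)) x) :
    IsAlgebraic (Algebra.adjoin Y (Set.range w)) (gX x) := by
  have hmem : ∀ c ∈ Algebra.adjoin S (Set.range u), gX c ∈ (Algebra.adjoin Y (Set.range w)) := by
    intro c hc
    induction hc using Algebra.adjoin_induction with
    | mem x hx =>
      obtain ⟨i, rfl⟩ := hx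
      exact Algebra.subset_adjoin ⟨i, (hw i).symm⟩
    | algebraMap r =>
      rw [AlgHom.commutes, IsScalarTower.algebraMap_apply S Y D]
      exact Subalgebra.algebraMap_mem _ _
    | add x y _ _ hx hy => rw [map_add]; exact add_mem hx hy
    | mul x y _ _ hx hy => rw [map_mul]; exact mul_mem hx hy
  let gC : Algebra.adjoin S (Set.range u) →+* Algebra.adjoin Y (Set.range w) :=
    ((gX : X →+* D).comp (algebraMap (Algebra.adjoin S (Set.range u)) X)).codRestrict
      (Algebra.adjoin Y (Set.range w)) (fun c => hmem c.1 c.2)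
  have hgC : Function.Injective gC := by
    rw [injective_iff_map_eq_zero]
    rintro ⟨c, hc⟩ h
    have hc' := hc
    rw [Algebra.adjoin_range_eq_range_aeval] at hc'
    obtain ⟨F, hF⟩ := hc'
    have h : gX c = 0 := congrArg Subtype.val h
    have hF : MvPolynomial.aeval u F = c := hF
    rw [← hF, ← AlgHom.comp_apply, MvPolynomial.comp_aeval] at h
    have hw' : (fun i => gX (u i)) = w := funext hw
    rw [hw'] at h
    have h0 : F = 0 := hindS (h.trans (map_zero _).symm)
    apply Subtype.ext
    rw [h0, map_zero] at hF
    exact hF.symm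
  exact Cod.isAlgebraic_map (gX : X →+* D) gC hgC rfl hx

open TensorProduct in
theorem Cod.trdeg_tensor {S X Y D : Type*} [CommRing S] [IsDomain S] [IsBezout S] [CommRing X] [IsDomain X]
    [CommRing Y] [IsDomain Y] [CommRing D] [IsDomain D] [Algebra S X] [Algebra S Y] [Algebra S D]
    [FaithfulSMul S X] [FaithfulSMul S Y] [Algebra.FiniteType S X] [Algebra.FiniteType S Y]
    (ψ : Y ⊗[S] X →ₐ[S] D) (hψ : Function.Surjective ψ) (hker : RingHom.ker ψ ∈ minimalPrimes (Y ⊗[S] X)) :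
    Function.Injective (algebraMap S D) ∧
      (Algebra.trdeg S D).toNat = (Algebra.trdeg S Y).toNat + (Algebra.trdeg S X).toNat := by
  have := Cod.flat_of_bezout S Y
  have fX : Algebra.trdeg S X < ℵ₀ := trdeg_lt_aleph0_of_finiteType
  have fY : Algebra.trdeg S Y < ℵ₀ := trdeg_lt_aleph0_of_finiteType
  obtain ⟨s, hs⟩ := exists_isTranscendenceBasis S X
  have hsc := hs.cardinalMk_eq_trdeg
  let algYD : Algebra Y D := ((ψ : Y ⊗[S] X →+* D).comp (algebraMap Y (Y ⊗[S] X))).toAlgebra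
  have tower : IsScalarTower S Y D := by
    apply IsScalarTower.of_algebraMap_eq
    intro r
    change _ = ψ (algebraMap Y (Y ⊗[S] X) (algebraMap S Y r))
    rw [← IsScalarTower.algebraMap_apply, AlgHom.commutes]
  let ψY : Y ⊗[S] X →ₐ[Y] D := { (ψ : Y ⊗[S] X →+* D) with commutes' := fun _ => rfl }
  have hψY : ∀ z, ψY z = ψ z := fun _ => rfl
  let w : s → D := fun i => ψ ((1 : Y) ⊗ₜ[S] i.1)
  have hind : AlgebraicIndependent Y w := by
    rw [algebraicIndependent_iff]
    intro F hF
    by_contra hF0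
    have h1 := Cod.aeval_tmul_mem_nonZeroDivisors (Y := Y) hs.1 F hF0
    refine Set.disjoint_left.mp (Ideal.disjoint_nonZeroDivisors_of_mem_minimalPrimes hker) ?_ h1
    change ψY (MvPolynomial.aeval _ F) = 0
    rw [← AlgHom.comp_apply, MvPolynomial.comp_aeval, ← hF]
    rfl
  have hYD := hind.algebraMap_injective
  have fYD : FaithfulSMul Y D := (faithfulSMul_iff_algebraMap_injective _ _).mpr hYD
  have hSD : Function.Injective (algebraMap S D) := by
    rw [IsScalarTower.algebraMap_eq S Y D]
    exact hYD.comp (FaithfulSMul.algebraMap_injective S Y)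
  refine ⟨hSD, ?_⟩
  have halgX := hs.isAlgebraic
  have hbasis : IsTranscendenceBasis Y w := by
    rw [isTranscendenceBasis_iff_algebraicIndependent_isAlgebraic]
    refine ⟨hind, ⟨fun d => ?_⟩⟩
    obtain ⟨z, rfl⟩ := hψ d
    induction z using TensorProduct.induction_on with
    | zero => rw [map_zero]; exact isAlgebraic_zero
    | add a b ha hb => rw [map_add]; exact ha.add hb
    | tmul y x =>
      have h1 : y ⊗ₜ[S] x = (y ⊗ₜ[S] (1 : X)) * ((1 : Y) ⊗ₜ[S] x) := by simp
      rw [h1, map_mul]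
      refine IsAlgebraic.mul ?_ ?_
      · have : ψ (y ⊗ₜ[S] (1 : X)) =
          algebraMap (Algebra.adjoin Y (Set.range w)) D (algebraMap Y _ y) := rfl
        rw [this]
        exact isAlgebraic_algebraMap _
      · let gX : X →ₐ[S] D := ψ.comp Algebra.TensorProduct.includeRight
        exact Cod.isAlgebraic_adjoin_map gX (fun i : s => (i.1 : X)) w (fun _ => rfl)
          (hind.restrictScalars (FaithfulSMul.algebraMap_injective S Y)) x (halgX.isAlgebraic x)
  have h5 := hbasis.lift_cardinalMk_eq_trdeg
  rw [hsc] at h5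
  have h6 := lift_trdeg_add_eq S Y D
  have h5' := congrArg toNat h5
  simp only [toNat_lift] at h5'
  have fYD : Algebra.trdeg Y D < ℵ₀ := by
    have : lift.{_} (Algebra.trdeg Y D) < ℵ₀ := h5 ▸ (by simpa using fX)
    simpa using this
  have h6' := congrArg toNat h6
  rw [toNat_add (by simpa using fY) (by simpa using fYD)] at h6'
  simp only [toNat_lift] at h6'
  omega

theorem Cod.height_add {α : Type*} [PartialOrder α] (δ : α → ℕ) (hs : ∀ a b, a < b → δ b < δ a)
    (hc : ∀ a b, a ⋖ b → δ a = δ b + 1) (D : ℕ) (b : α) (hmin : ∀ a ≤ b, ∃ c ≤ a, δ c = D) :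
    Order.height b + δ b = D := by
  have hD : ∀ a ≤ b, δ a ≤ D := by
    intro a ha
    obtain ⟨c, hca, hcD⟩ := hmin a ha
    rcases hca.eq_or_lt with rfl | h
    · exact hcD.le
    · exact hcD ▸ (hs _ _ h).le
  have key : ∀ n : ℕ, ∀ a ≤ b, D - δ a = n → Order.height a = n := by
    intro n
    induction n using Nat.strong_induction_on with
    | _ n ih =>
      intro a ha hn
      have haD := hD a ha
      apply le_antisymm
      · rw [Order.height_le_coe_iff]
        intro y hy
        have h1 := hs _ _ hy
        have h2 := hD y (hy.le.trans ha)
        have h3 : D - δ y < n := by omega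
        rw [ih _ h3 y (hy.le.trans ha) rfl]
        exact_mod_cast h3
      · rcases Nat.eq_zero_or_pos n with rfl | hpos
        · simp
        obtain ⟨c0, hc0a, hc0⟩ := hmin a ha
        have hlt : c0 < a := by
          refine lt_of_le_of_ne hc0a ?_
          rintro rfl
          omega
        obtain ⟨c, hca, hcm⟩ : ∃ c ∈ {c | c < a}, ∀ c' ∈ {c | c < a}, δ c ≤ δ c' :=
          by
          obtain ⟨c, h1, h2⟩ := (measure δ).wf.has_min {c | c < a} ⟨c0, hlt⟩
          exact ⟨c, h1, fun c' h => not_lt.mp (h2 c' h)⟩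
        have hcov : c ⋖ a := by
          refine ⟨hca, ?_⟩
          intro e hce hea
          have := hcm e hea
          have := hs _ _ hce
          omega
        have h1 := hc _ _ hcov
        have h2 := ih (n - 1) (by omega) c (hcov.lt.le.trans ha) (by omega)
        have h3 := Order.height_add_one_le hcov.lt
        rw [h2] at h3
        have h4 : n = n - 1 + 1 := by omega
        rw [h4]
        exact_mod_cast h3
  rw [key _ b le_rfl rfl]
  have := hD b le_rfl
  norm_cast
  omega

noncomputable def Cod.t (R : Type*) {B : Type*} [CommRing R] [CommRing B] [Algebra R B] (p : Ideal B) : ℕ :=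
  (Algebra.trdeg (R ⧸ p.under R) (B ⧸ p)).toNat

theorem Cod.t_eq {R B : Type*} [CommRing R] [CommRing B] [Algebra R B] (p : Ideal B) (r : Ideal R)
    [h : p.LiesOver r] : Cod.t R p = (Algebra.trdeg (R ⧸ r) (B ⧸ p)).toNat := by
  obtain rfl := h.over
  rfl

section
variable {R B : Type*} [CommRing R] [CommRing B] [Algebra R B] [Algebra.FiniteType R B]

theorem Cod.t_lt {p p' : Ideal B} (hp : p.IsPrime) (hp' : p'.IsPrime) (hlt : p < p')
    (h : p.under R = p'.under R) : Cod.t R p' < Cod.t R p := by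
  have : p'.LiesOver (p.under R) := ⟨h⟩
  rw [Cod.t_eq p' (p.under R)]
  let π : B ⧸ p →ₐ[R ⧸ p.under R] B ⧸ p' :=
    { Ideal.Quotient.factor hlt.le with
      commutes' := by
        intro r
        obtain ⟨r, rfl⟩ := Ideal.Quotient.mk_surjective r
        rfl }
  refine Cod.trdeg_lt π (Ideal.Quotient.factor_surjective hlt.le) ?_
  obtain ⟨x, hx', hx⟩ := SetLike.exists_of_lt hlt
  intro hbot
  have h1 : Ideal.Quotient.mk p x ∈ RingHom.ker π := by
    change Ideal.Quotient.mk p' x = 0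
    rwa [Ideal.Quotient.eq_zero_iff_mem]
  rw [hbot, Ideal.mem_bot, Ideal.Quotient.eq_zero_iff_mem] at h1
  exact hx h1

theorem Cod.t_le [IsBezout R] {p p' : Ideal B} (hp : p.IsPrime) (hp' : p'.IsPrime) (hle : p ≤ p') :
    Cod.t R p' ≤ Cod.t R p := by
  have : IsBezout (R ⧸ p.under R) :=
    Function.Surjective.isBezout (Ideal.Quotient.mk (p.under R)) Ideal.Quotient.mk_surjective
  refine Cod.trdeg_le_of_bezout (R := R) Ideal.Quotient.mk_surjective ?_
    (Ideal.Quotient.factorₐ R hle) (Ideal.Quotient.factor_surjective hle)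
  change RingHom.ker (Ideal.Quotient.mk _) ≤ RingHom.ker (Ideal.Quotient.mk _)
  rw [Ideal.mk_ker, Ideal.mk_ker]
  exact Ideal.comap_mono hle

theorem Cod.t_le_of_min {p p' : Ideal B} (hp : p.IsPrime) (hp' : p'.IsPrime) (hle : p ≤ p')
    (E : Set B) (hE : E.Finite) (hEp : E ⊆ p')
    (hmin : ∀ q : Ideal B, q.IsPrime → p ≤ q → q ≤ p' → E ⊆ q → (∀ r ∈ p'.under R, algebraMap R B r ∈ q) →
      p' ≤ q) : Cod.t R p ≤ Cod.t R p' + E.ncard := by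
  have h := Cod.trdeg_le_of_minimal (R := R) (S := R ⧸ p.under R) (k := R ⧸ p'.under R)
    Ideal.Quotient.mk_surjective (Ideal.Quotient.factorₐ R hle) (Ideal.Quotient.factor_surjective hle)
    (Ideal.Quotient.mk p '' E) (hE.image _) ?_ ?_
  · exact h.trans (Nat.add_le_add_left (Set.ncard_image_le hE) _)
  · rintro _ ⟨x, hx, rfl⟩
    change Ideal.Quotient.mk p' x = 0
    rw [Ideal.Quotient.eq_zero_iff_mem]
    exact hEp hx
  · intro q hq hqk hEq hr
    have hmem : ∀ x : B, Ideal.Quotient.mk p x ∈ RingHom.ker (Ideal.Quotient.factorₐ R hle) ↔ x ∈ p' := by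
      intro x
      change Ideal.Quotient.mk p' x = 0 ↔ _
      rw [Ideal.Quotient.eq_zero_iff_mem]
    have h1 := hmin (q.comap (Ideal.Quotient.mk p)) inferInstance ?_ ?_ ?_ ?_
    · intro z hz
      obtain ⟨x, rfl⟩ := Ideal.Quotient.mk_surjective z
      exact h1 ((hmem x).mp hz)
    · intro x hx
      rw [Ideal.mem_comap, Ideal.Quotient.eq_zero_iff_mem.mpr hx]
      exact zero_mem _
    · intro x hx
      exact (hmem x).mp (hqk hx)
    · intro x hx
      exact hEq ⟨x, hx, rfl⟩
    · intro r hr'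
      exact hr r (Ideal.Quotient.eq_zero_iff_mem.mpr hr')

end

section
open TensorProduct

theorem Cod.tensor {R A : Type*} [CommRing R] [IsBezout R] [CommRing A] [Algebra R A] [Algebra.FiniteType R A]
    (p p' : Ideal A) (hp : p.IsPrime) (hp' : p'.IsPrime) (h : p'.under R = p.under R)
    (P : Ideal (A ⊗[R] A))
    (hP : P ∈ (p.map (Algebra.TensorProduct.includeLeft : A →ₐ[R] A ⊗[R] A) ⊔
        p'.map (Algebra.TensorProduct.includeRight : A →ₐ[R] A ⊗[R] A)).minimalPrimes) :
    P.under R = p.under R ∧ Cod.t R P = Cod.t R p + Cod.t R p' := by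
  have hPp : P.IsPrime := hP.1.1
  have hL : ∀ a ∈ p, (a ⊗ₜ[R] (1 : A)) ∈ P := fun a ha =>
    hP.1.2 (Ideal.mem_sup_left (Ideal.mem_map_of_mem _ ha))
  have hR : ∀ a ∈ p', ((1 : A) ⊗ₜ[R] a) ∈ P := fun a ha =>
    hP.1.2 (Ideal.mem_sup_right (Ideal.mem_map_of_mem _ ha))
  have hrP : p.under R ≤ P.under R := fun r hr => hL _ hr
  generalize hr : p.under R = r at *
  have o1 : p.LiesOver r := ⟨hr.symm⟩
  have o2 : p'.LiesOver r := ⟨h.symm⟩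
  have rp : r.IsPrime := by rw [← hr]; infer_instance
  have : IsBezout (R ⧸ r) :=
    Function.Surjective.isBezout (Ideal.Quotient.mk r) Ideal.Quotient.mk_surjective
  let alg : Algebra (R ⧸ r) ((A ⊗[R] A) ⧸ P) := Ideal.Quotient.algebraQuotientOfLEComap hrP
  let gL : A ⧸ p →ₐ[R ⧸ r] (A ⊗[R] A) ⧸ P :=
    { Ideal.Quotient.lift p ((Ideal.Quotient.mk P).comp
        (Algebra.TensorProduct.includeLeft : A →ₐ[R] A ⊗[R] A).toRingHom)
        (fun a ha => Ideal.Quotient.eq_zero_iff_mem.mpr (hL a ha)) with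
      commutes' := by
        intro r
        obtain ⟨r, rfl⟩ := Ideal.Quotient.mk_surjective r
        rfl }
  let gR : A ⧸ p' →ₐ[R ⧸ r] (A ⊗[R] A) ⧸ P :=
    { Ideal.Quotient.lift p' ((Ideal.Quotient.mk P).comp
        (Algebra.TensorProduct.includeRight : A →ₐ[R] A ⊗[R] A).toRingHom)
        (fun a ha => Ideal.Quotient.eq_zero_iff_mem.mpr (hR a ha)) with
      commutes' := by
        intro r
        obtain ⟨r, rfl⟩ := Ideal.Quotient.mk_surjective r
        change Ideal.Quotient.mk P ((1 : A) ⊗ₜ[R] algebraMap R A r) = Ideal.Quotient.mk P (algebraMap R _ r)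
        congr 1
        exact (Algebra.TensorProduct.includeRight : A →ₐ[R] A ⊗[R] A).commutes r }
  let ψ : (A ⧸ p) ⊗[R ⧸ r] (A ⧸ p') →ₐ[R ⧸ r] (A ⊗[R] A) ⧸ P := Algebra.TensorProduct.productMap gL gR
  let φ : A ⊗[R] A →ₐ[R] (A ⧸ p) ⊗[R ⧸ r] (A ⧸ p') :=
    Algebra.TensorProduct.productMap
      (((Algebra.TensorProduct.includeLeft : A ⧸ p →ₐ[R ⧸ r] (A ⧸ p) ⊗[R ⧸ r] (A ⧸ p')).restrictScalars R).comp
        (Ideal.Quotient.mkₐ R p))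
      (((Algebra.TensorProduct.includeRight : A ⧸ p' →ₐ[R ⧸ r] (A ⧸ p) ⊗[R ⧸ r] (A ⧸ p')).restrictScalars R).comp
        (Ideal.Quotient.mkₐ R p'))
  have hφ : ∀ a b : A, φ (a ⊗ₜ b) = (Ideal.Quotient.mk p a) ⊗ₜ (Ideal.Quotient.mk p' b) := by
    intro a b
    simp [φ]
  have hψ : ∀ a b : A, ψ ((Ideal.Quotient.mk p a) ⊗ₜ (Ideal.Quotient.mk p' b)) = Ideal.Quotient.mk P (a ⊗ₜ b) := by
    intro a b
    have h1 : a ⊗ₜ[R] b = (a ⊗ₜ[R] (1 : A)) * ((1 : A) ⊗ₜ[R] b) := by simp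
    rw [h1, map_mul]
    simp only [ψ, Algebra.TensorProduct.productMap_apply_tmul]
    rfl
  have hφs : Function.Surjective φ := by
    intro z
    induction z using TensorProduct.induction_on with
    | zero => exact ⟨0, map_zero _⟩
    | add x y hx hy =>
      obtain ⟨a, rfl⟩ := hx
      obtain ⟨b, rfl⟩ := hy
      exact ⟨a + b, map_add _ _ _⟩
    | tmul x y =>
      obtain ⟨a, rfl⟩ := Ideal.Quotient.mk_surjective x
      obtain ⟨b, rfl⟩ := Ideal.Quotient.mk_surjective y
      exact ⟨a ⊗ₜ b, hφ a b⟩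
  have hcomp : ∀ z, ψ (φ z) = Ideal.Quotient.mk P z := by
    intro z
    induction z using TensorProduct.induction_on with
    | zero => simp only [map_zero]
    | add x y hx hy => simp only [map_add, hx, hy]
    | tmul x y => rw [hφ, hψ]
  have hψs : Function.Surjective ψ := by
    intro z
    obtain ⟨b, rfl⟩ := Ideal.Quotient.mk_surjective z
    exact ⟨φ b, hcomp b⟩
  have hker : RingHom.ker ψ ∈ minimalPrimes ((A ⧸ p) ⊗[R ⧸ r] (A ⧸ p')) := by
    refine ⟨⟨RingHom.ker_isPrime _, bot_le⟩, ?_⟩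
    rintro Q ⟨hQ, -⟩ hQle
    have hle : P ≤ Q.comap φ := by
      refine hP.2 ⟨Ideal.comap_isPrime _ _, ?_⟩ ?_
      · refine sup_le ?_ ?_
        · rw [Ideal.map_le_iff_le_comap]
          intro a ha
          change φ (a ⊗ₜ 1) ∈ Q
          rw [hφ, Ideal.Quotient.eq_zero_iff_mem.mpr ha, TensorProduct.zero_tmul]
          exact zero_mem _
        · rw [Ideal.map_le_iff_le_comap]
          intro a ha
          change φ (1 ⊗ₜ a) ∈ Q
          rw [hφ, Ideal.Quotient.eq_zero_iff_mem.mpr ha, TensorProduct.tmul_zero]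
          exact zero_mem _
      · intro z hz
        have h1 : ψ (φ z) = 0 := hQle hz
        rwa [hcomp, Ideal.Quotient.eq_zero_iff_mem] at h1
    intro z hz
    obtain ⟨b, rfl⟩ := hφs z
    have h1 : ψ (φ b) = 0 := hz
    rw [hcomp, Ideal.Quotient.eq_zero_iff_mem] at h1
    exact hle h1
  obtain ⟨hinj, htr⟩ := Cod.trdeg_tensor ψ hψs hker
  have hund : P.under R = r := by
    apply le_antisymm _ hrP
    intro x hx
    rw [← Ideal.Quotient.eq_zero_iff_mem]
    apply hinj
    rw [map_zero]
    exact Ideal.Quotient.eq_zero_iff_mem.mpr hx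
  have o3 : P.LiesOver r := ⟨hund.symm⟩
  refine ⟨hund, ?_⟩
  rw [Cod.t_eq P r, Cod.t_eq p r, Cod.t_eq p' r]
  exact htr

end

section
variable {R B : Type*} [CommRing R] [CommRing B] [Algebra R B] [Algebra.FiniteType R B]

theorem Cod.spec [IsBezout R] {p q : Ideal B} (hp : p.IsPrime) (hq : q.IsPrime) (hle : p ≤ q) :
    ∃ r : Ideal B, r.IsPrime ∧ p ≤ r ∧ r ≤ q ∧ r.under R = q.under R ∧ Cod.t R r = Cod.t R p := by
  have hle' : p ⊔ (q.under R).map (algebraMap R B) ≤ q :=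
    sup_le hle (Ideal.map_le_iff_le_comap.mpr le_rfl)
  obtain ⟨r, hr, hrq⟩ := Ideal.exists_minimalPrimes_le hle'
  have hrp : r.IsPrime := hr.1.1
  have hpr : p ≤ r := le_sup_left.trans hr.1.2
  have hqr : (q.under R).map (algebraMap R B) ≤ r := le_sup_right.trans hr.1.2
  have hund : r.under R = q.under R :=
    le_antisymm (Ideal.comap_mono hrq) (Ideal.map_le_iff_le_comap.mp hqr)
  refine ⟨r, hrp, hpr, hrq, hund, le_antisymm (Cod.t_le hp hrp hpr) ?_⟩
  have h := Cod.t_le_of_min (R := R) hp hrp hpr ∅ Set.finite_empty (Set.empty_subset _) ?_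
  · simpa using h
  · intro q' hq' hpq' hq'r _ hm
    refine hr.2 ⟨hq', sup_le hpq' ?_⟩ hq'r
    rw [Ideal.map_le_iff_le_comap, ← hund]
    exact hm

open Classical in
noncomputable def Cod.e (R : Type*) {B : Type*} [CommRing R] [CommRing B] [Algebra R B] (p : Ideal B) : ℕ :=
  if p.under R = ⊥ then 1 else 0

theorem Cod.height_prime [IsDomain R] [IsBezout R] (hR : ∀ r r' : Ideal R, r.IsPrime → r'.IsPrime → r < r' → r = ⊥)
    (D : ℕ) (hD : ∀ N ∈ minimalPrimes B, Cod.t R N + Cod.e R N = D) (p : Ideal B) (hp : p.IsPrime) :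
    Order.height (⟨p, hp⟩ : PrimeSpectrum B) + (Cod.t R p + Cod.e R p : ℕ) = D := by
  have hs : ∀ a b : PrimeSpectrum B, a < b →
      Cod.t R b.asIdeal + Cod.e R b.asIdeal < Cod.t R a.asIdeal + Cod.e R a.asIdeal := by
    intro a b hab
    by_cases h : a.asIdeal.under R = b.asIdeal.under R
    · have := Cod.t_lt a.2 b.2 hab h
      unfold Cod.e
      rw [h]
      omega
    · have hlt : a.asIdeal.under R < b.asIdeal.under R :=
        lt_of_le_of_ne (Ideal.comap_mono hab.le) h
      have h0 := hR _ _ (Ideal.comap_isPrime _ _) (Ideal.comap_isPrime _ _) hlt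
      have h1 : b.asIdeal.under R ≠ ⊥ := fun h1 => h (h0.trans h1.symm)
      have := Cod.t_le (R := R) a.2 b.2 hab.le
      unfold Cod.e
      rw [if_pos h0, if_neg h1]
      omega
  refine Cod.height_add (fun q : PrimeSpectrum B => Cod.t R q.asIdeal + Cod.e R q.asIdeal) hs ?_ D ⟨p, hp⟩ ?_
  · intro a b hab
    have h1 := hs a b hab.lt
    refine le_antisymm ?_ h1
    have hcov : ∀ q : Ideal B, q.IsPrime → a.asIdeal ≤ q → q ≤ b.asIdeal → ¬ q ≤ a.asIdeal → b.asIdeal ≤ q := by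
      intro q hq haq hqb hn
      by_contra hc
      exact hab.2 (c := ⟨q, hq⟩) (lt_of_le_not_ge haq hn) (lt_of_le_not_ge hqb hc)
    by_cases h : a.asIdeal.under R = b.asIdeal.under R
    · obtain ⟨f, hfb, hfa⟩ := SetLike.exists_of_lt (show a.asIdeal < b.asIdeal from hab.lt)
      have h2 := Cod.t_le_of_min (R := R) a.2 b.2 hab.lt.le {f} (Set.finite_singleton _) (by simpa using hfb) ?_
      · rw [Set.ncard_singleton] at h2
        simp only [Cod.e]
        rw [h]
        omega
      · intro q hq haq hqb hf _
        exact hcov q hq haq hqb (fun hh => hfa (hh (hf rfl)))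
    · have hlt : a.asIdeal.under R < b.asIdeal.under R :=
        lt_of_le_of_ne (Ideal.comap_mono hab.lt.le) h
      have h0 := hR _ _ (Ideal.comap_isPrime _ _) (Ideal.comap_isPrime _ _) hlt
      have h2 : b.asIdeal.under R ≠ ⊥ := fun h1 => h (h0.trans h1.symm)
      have h3 := Cod.t_le_of_min (R := R) a.2 b.2 hab.lt.le ∅ Set.finite_empty (Set.empty_subset _) ?_
      · rw [Set.ncard_empty] at h3
        simp only [Cod.e]
        rw [if_pos h0, if_neg h2]
        omega
      · intro q hq haq hqb _ hm
        exact hcov q hq haq hqb (fun hh => not_le_of_gt hlt (fun r hr => hh (hm r hr)))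
  · intro a _
    obtain ⟨N, hN, hNa⟩ := Ideal.exists_minimalPrimes_le (I := (⊥ : Ideal B)) (J := a.asIdeal) bot_le
    exact ⟨⟨N, hN.1.1⟩, hNa, hD N hN⟩

end

section
open TensorProduct

theorem Cod.tensor' {R A : Type*} [CommRing R] [IsBezout R] [CommRing A] [Algebra R A] [Algebra.FiniteType R A]
    (p p' : Ideal A) (hp : p.IsPrime) (hp' : p'.IsPrime)
    (P : Ideal (A ⊗[R] A))
    (hP : P ∈ (p.map (Algebra.TensorProduct.includeLeft : A →ₐ[R] A ⊗[R] A) ⊔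
        p'.map (Algebra.TensorProduct.includeRight : A →ₐ[R] A ⊗[R] A)).minimalPrimes) :
    Cod.t R P = Cod.t R p + Cod.t R p' := by
  have hPp : P.IsPrime := hP.1.1
  let iL : A →ₐ[R] A ⊗[R] A := Algebra.TensorProduct.includeLeft
  let iR : A →ₐ[R] A ⊗[R] A := Algebra.TensorProduct.includeRight
  have hL : p ≤ P.comap iL := Ideal.map_le_iff_le_comap.mp (le_sup_left.trans hP.1.2)
  have hR : p' ≤ P.comap iR := Ideal.map_le_iff_le_comap.mp (le_sup_right.trans hP.1.2)
  obtain ⟨r, hr, hpr, hrP, hru, hrt⟩ := Cod.spec (R := R) hp (Ideal.comap_isPrime iL P) hL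
  obtain ⟨r', hr', hpr', hrP', hru', hrt'⟩ := Cod.spec (R := R) hp' (Ideal.comap_isPrime iR P) hR
  have e1 : (P.comap iL).under R = P.under R := by
    ext x
    change iL (algebraMap R A x) ∈ P ↔ algebraMap R _ x ∈ P
    rw [AlgHom.commutes]
  have e2 : (P.comap iR).under R = P.under R := by
    ext x
    change iR (algebraMap R A x) ∈ P ↔ algebraMap R _ x ∈ P
    rw [AlgHom.commutes]
  rw [← hrt, ← hrt']
  refine (Cod.tensor r r' hr hr' (by rw [hru, hru', e1, e2]) P ⟨⟨hPp, ?_⟩, ?_⟩).2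
  · exact sup_le (Ideal.map_le_iff_le_comap.mpr hrP) (Ideal.map_le_iff_le_comap.mpr hrP')
  · rintro Q ⟨hQ, hQle⟩ hQP
    exact hP.2 ⟨hQ, (sup_le_sup (Ideal.map_mono hpr) (Ideal.map_mono hpr')).trans hQle⟩ hQP

theorem Cod.tensor_e {R A : Type*} [CommRing R] [IsBezout R] [CommRing A] [Algebra R A] [Algebra.FiniteType R A]
    (p p' : Ideal A) (hp : p.IsPrime) (hp' : p'.IsPrime)
    (P : Ideal (A ⊗[R] A))
    (hP : P ∈ (p.map (Algebra.TensorProduct.includeLeft : A →ₐ[R] A ⊗[R] A) ⊔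
        p'.map (Algebra.TensorProduct.includeRight : A →ₐ[R] A ⊗[R] A)).minimalPrimes) :
    Cod.e R P = Cod.e R p * Cod.e R p' := by
  let iL : A →ₐ[R] A ⊗[R] A := Algebra.TensorProduct.includeLeft
  let iR : A →ₐ[R] A ⊗[R] A := Algebra.TensorProduct.includeRight
  have hL : p ≤ P.comap iL := Ideal.map_le_iff_le_comap.mp (le_sup_left.trans hP.1.2)
  have hR : p' ≤ P.comap iR := Ideal.map_le_iff_le_comap.mp (le_sup_right.trans hP.1.2)
  have e1 : p.under R ≤ P.under R := by
    intro x hx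
    have := hL hx
    change iL (algebraMap R A x) ∈ P at this
    rwa [AlgHom.commutes] at this
  have e2 : p'.under R ≤ P.under R := by
    intro x hx
    have := hR hx
    change iR (algebraMap R A x) ∈ P at this
    rwa [AlgHom.commutes] at this
  have h3 : P.under R = ⊥ ↔ p.under R = ⊥ ∧ p'.under R = ⊥ := by
    constructor
    · intro h
      rw [h] at e1 e2
      exact ⟨le_bot_iff.mp e1, le_bot_iff.mp e2⟩
    · rintro ⟨h, h'⟩
      rw [← h]
      exact (Cod.tensor p p' hp hp' (h'.trans h.symm) P hP).1
  unfold Cod.e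
  by_cases h : p.under R = ⊥ <;> by_cases h' : p'.under R = ⊥ <;> simp [h3, h, h']

end

/-- **Codimension in fiber products over rank-1 valuation rings.**
Let `R` be a valuation ring of rank 1 with maximal ideal `m`, and let `A` be a finitely
generated `R`-algebra with irreducible spectrum (a unique minimal prime).  Let `p`, `p'` be
prime ideals of `A`, and let `P` be a prime of `A ⊗_R A` minimal over the ideal generated by
the images of `p` under `a ↦ a ⊗ 1` and of `p'` under `a ↦ 1 ⊗ a`.  Then
`ht P ≤ ht p + ht p'`, and equality holds unless `R → A/nil(A)` is injective and both `p`
and `p'` contain `m·A`. -/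
theorem codimension_in_fiber_product_over_rank_one_valuation_ring
    {R A : Type*} [CommRing R] [IsDomain R] [ValuationRing R]
    (hrank : ringKrullDim R = 1)
    [CommRing A] [Algebra R A] [Algebra.FiniteType R A]
    (hirr : ∃! q : Ideal A, q ∈ minimalPrimes A)
    (p p' : Ideal A) (hp : p.IsPrime) (hp' : p'.IsPrime)
    (P : Ideal (TensorProduct R A A))
    (hP : P ∈ (p.map (Algebra.TensorProduct.includeLeft : A →ₐ[R] TensorProduct R A A) ⊔
        p'.map (Algebra.TensorProduct.includeRight : A →ₐ[R] TensorProduct R A A)).minimalPrimes) :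
    primeHt P ≤ primeHt p + primeHt p' ∧
      (¬ (Function.Injective ((Ideal.Quotient.mk (nilradical A)).comp (algebraMap R A)) ∧
          (IsLocalRing.maximalIdeal R).map (algebraMap R A) ≤ p ∧
          (IsLocalRing.maximalIdeal R).map (algebraMap R A) ≤ p') →
        primeHt P = primeHt p + primeHt p') := by
  have hdim : Ring.KrullDimLE 1 R := by
    rw [Ring.krullDimLE_iff, hrank]; rfl
  have hmax : ∀ r : Ideal R, r.IsPrime → r ≠ ⊥ → r = IsLocalRing.maximalIdeal R := fun r hr h0 =>
    IsLocalRing.eq_maximalIdeal (hr.isMaximal_of_ne_bot h0)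
  have hR : ∀ r r' : Ideal R, r.IsPrime → r'.IsPrime → r < r' → r = ⊥ := by
    intro r r' hr hr' hlt
    by_contra h0
    rw [hmax r hr h0] at hlt
    exact not_le_of_gt hlt (IsLocalRing.le_maximalIdeal hr'.ne_top)
  obtain ⟨N, hN, hNu⟩ := hirr
  have hNp : N.IsPrime := hN.1.1
  have hNle : ∀ q : Ideal A, q.IsPrime → N ≤ q := by
    intro q hq
    obtain ⟨M, hM, hMq⟩ := Ideal.exists_minimalPrimes_le (I := (⊥ : Ideal A)) (J := q) bot_le
    exact hNu M hM ▸ hMq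
  have hPp : P.IsPrime := hP.1.1
  have hA := fun q hq => Cod.height_prime (R := R) (B := A) hR (Cod.t R N + Cod.e R N)
    (fun M hM => by rw [hNu M hM]) q hq
  have he1 : ∀ q : Ideal A, Cod.e R q ≤ 1 := by
    intro q; unfold Cod.e; split_ifs <;> omega
  have heN : Cod.e R N * Cod.e R N = Cod.e R N := by
    have := he1 N
    interval_cases Cod.e R N <;> rfl
  have hft : Algebra.FiniteType R (TensorProduct R A A) :=
    Algebra.FiniteType.trans (S := A) inferInstance (Algebra.FiniteType.baseChange A)
  have hB := Cod.height_prime (R := R) (B := TensorProduct R A A) hR (Cod.t R N + Cod.t R N + Cod.e R N)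
    (fun M hM => by
      have hMp : M.IsPrime := hM.1.1
      have hM' : M ∈ (N.map (Algebra.TensorProduct.includeLeft : A →ₐ[R] TensorProduct R A A) ⊔
        N.map (Algebra.TensorProduct.includeRight : A →ₐ[R] TensorProduct R A A)).minimalPrimes := by
        refine ⟨⟨hMp, sup_le ?_ ?_⟩, fun Q hQ hQM => hM.2 ⟨hQ.1, bot_le⟩ hQM⟩
        · exact Ideal.map_le_iff_le_comap.mpr (hNle _ (Ideal.comap_isPrime _ _))
        · exact Ideal.map_le_iff_le_comap.mpr (hNle _ (Ideal.comap_isPrime _ _))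
      rw [Cod.tensor' N N hNp hNp M hM', Cod.tensor_e N N hNp hNp M hM', heN]) P hPp
  rw [Cod.tensor' p p' hp hp' P hP, Cod.tensor_e p p' hp hp' P hP] at hB
  have h1 := hA p hp
  have h2 := hA p' hp'
  have k0 : primeHt P = Order.height (⟨P, hPp⟩ : PrimeSpectrum _) := iSup_pos hPp
  have k1 : primeHt p = Order.height (⟨p, hp⟩ : PrimeSpectrum A) := iSup_pos hp
  have k2 : primeHt p' = Order.height (⟨p', hp'⟩ : PrimeSpectrum A) := iSup_pos hp'
  rw [← k0] at hB
  rw [← k1] at h1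
  rw [← k2] at h2
  have fin : ∀ (x : ℕ∞) (a b : ℕ), x + a = b → ∃ n : ℕ, x = n := by
    intro x a b h
    refine ENat.ne_top_iff_exists.mp ?_ |>.imp fun n h => h.symm
    rintro rfl
    simp at h
  obtain ⟨n, hn⟩ := fin _ _ _ hB
  obtain ⟨a, ha⟩ := fin _ _ _ h1
  obtain ⟨b, hb⟩ := fin _ _ _ h2
  rw [hn] at hB ⊢
  rw [ha] at h1 ⊢
  rw [hb] at h2 ⊢
  norm_cast at hB h1 h2 ⊢
  have heN1 := he1 N
  have hep := he1 p
  have hep' := he1 p'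
  have hmono : ∀ q : Ideal A, q.IsPrime → Cod.e R q ≤ Cod.e R N := by
    intro q hq
    unfold Cod.e
    by_cases h : q.under R = ⊥
    · have : N.under R = ⊥ := le_bot_iff.mp (h ▸ Ideal.comap_mono (hNle q hq))
      rw [if_pos this]; split_ifs <;> omega
    · rw [if_neg h]; omega
  have m1 := hmono p hp
  have m2 := hmono p' hp'
  have hcond : Cod.e R N = 1 → Cod.e R p = 0 → Cod.e R p' = 0 →
      (Function.Injective ((Ideal.Quotient.mk (nilradical A)).comp (algebraMap R A)) ∧
          (IsLocalRing.maximalIdeal R).map (algebraMap R A) ≤ p ∧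
          (IsLocalRing.maximalIdeal R).map (algebraMap R A) ≤ p') := by
    have hz : ∀ q : Ideal A, q.IsPrime → Cod.e R q = 0 →
        (IsLocalRing.maximalIdeal R).map (algebraMap R A) ≤ q := by
      intro q hq h
      have : q.under R ≠ ⊥ := by
        intro h0
        simp [Cod.e, h0] at h
      rw [Ideal.map_le_iff_le_comap]
      exact (hmax _ (Ideal.comap_isPrime _ _) this).ge
    intro i1 i2 i3
    refine ⟨?_, hz p hp i2, hz p' hp' i3⟩
    have hNb : N.under R = ⊥ := by
      by_contra h0
      simp [Cod.e, h0] at i1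
    rw [injective_iff_map_eq_zero]
    intro x hx
    have hx' : algebraMap R A x ∈ nilradical A := Ideal.Quotient.eq_zero_iff_mem.mp hx
    have hxN : x ∈ N.under R := by
      change algebraMap R A x ∈ N
      rw [mem_nilradical] at hx'
      obtain ⟨k, hk⟩ := hx'
      exact hNp.mem_of_pow_mem k (hk ▸ zero_mem _)
    rwa [hNb] at hxN
  generalize Cod.e R N = eN at *
  generalize Cod.e R p = e1 at *
  generalize Cod.e R p' = e2 at *
  interval_cases eN <;> interval_cases e1 <;> interval_cases e2 <;>
    first
      | (refine ⟨by omega, fun _ => by omega⟩)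
      | (refine ⟨by omega, fun hh => absurd (hcond rfl rfl rfl) hh⟩)
end

section
/- Coherence over rank-1 valuation rings: let R be a valuation ring of rank 1 and let A be a finitely presented R-algebra. Then A is a coherent ring: every finitely generated ideal I of A is finitely presented as an A-module. -/
namespace RankOneCoh

open MvPolynomial

/-- Coordinatewise application of a ring hom, as a semilinear map. -/
def piMap {S T : Type*} [CommRing S] [CommRing T] (ι : Type*) (φ : S →+* T) :
    (ι → S) →ₛₗ[φ] (ι → T) where
  toFun v i := φ (v i)
  map_add' v w := by ext i; simp
  map_smul' a v := by ext i; simp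

/-- Homogeneous component of a vector of polynomials. -/
noncomputable def cmp {R σ : Type*} [CommRing R] (ι : Type*) (d : ℕ) :
    (ι → MvPolynomial σ R) →ₗ[R] (ι → MvPolynomial σ R) where
  toFun v i := homogeneousComponent d (v i)
  map_add' v w := by ext1 i; simp
  map_smul' a v := by ext1 i; simp

lemma comp_mul {R σ : Type*} [CommRing R] (d e : ℕ) (a : MvPolynomial σ R) :
    ∃ a' : MvPolynomial σ R, ∀ b : MvPolynomial σ R, b.IsHomogeneous e →
      homogeneousComponent d (a * b) = a' * b := by
  classical
  induction a using MvPolynomial.induction_on' with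
  | monomial s r =>
    refine ⟨if d = s.degree + e then monomial s r else 0, fun b hb => ?_⟩
    have h : (monomial s r * b).IsHomogeneous (s.degree + e) :=
      (isHomogeneous_monomial r rfl).mul hb
    rw [homogeneousComponent_of_mem h]
    split_ifs <;> simp
  | add p q hp hq =>
    obtain ⟨p', hp'⟩ := hp
    obtain ⟨q', hq'⟩ := hq
    refine ⟨p' + q', fun b hb => ?_⟩
    rw [add_mul, map_add, hp' b hb, hq' b hb, add_mul]

lemma cmp_mem_span {R σ ι : Type*} [CommRing R] (E : Set (ι → MvPolynomial σ R))
    (hE : ∀ f ∈ E, ∃ e, ∀ i, (f i).IsHomogeneous e) (d : ℕ) (f : ι → MvPolynomial σ R)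
    (hf : f ∈ Submodule.span (MvPolynomial σ R) E) :
    cmp ι d f ∈ Submodule.span (MvPolynomial σ R) E := by
  have key : ∀ (a : MvPolynomial σ R) (g) (_ : g ∈ E),
      cmp ι d (a • g) ∈ Submodule.span (MvPolynomial σ R) E := by
    intro a g hg
    obtain ⟨e, he⟩ := hE g hg
    obtain ⟨a', ha'⟩ := comp_mul d e a
    have : cmp ι d (a • g) = a' • g := by
      ext1 i
      exact ha' _ (he i)
    rw [this]
    exact Submodule.smul_mem _ _ (Submodule.subset_span hg)
  induction hf using Submodule.closure_induction with
  | zero => simp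
  | add x y _ _ hx hy => rw [map_add]; exact Submodule.add_mem _ hx hy
  | smul_mem r x hx => exact key r x hx

lemma eq_sum_cmp {R σ ι : Type*} [CommRing R] [Finite ι] (f : ι → MvPolynomial σ R) :
    ∃ N, f = ∑ d ∈ Finset.range N, cmp ι d f := by
  cases nonempty_fintype ι
  refine ⟨(Finset.univ.sup fun i => (f i).totalDegree) + 1, ?_⟩
  ext1 i
  rw [Finset.sum_apply]
  conv_lhs => rw [← sum_homogeneousComponent (f i)]
  refine Finset.sum_subset ?_ ?_
  · intro d hd
    have := Finset.le_sup (f := fun i => (f i).totalDegree) (Finset.mem_univ i)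
    simp only [Finset.mem_range] at *
    omega
  · intro d _ hd
    exact homogeneousComponent_eq_zero _ _ (by simp only [Finset.mem_range] at hd; omega)

/-- A saturated submodule of a f.g. module over a valuation ring is f.g. -/
lemma fg_of_saturated {R M : Type*} [CommRing R] [IsDomain R] [ValuationRing R]
    [AddCommGroup M] [Module R M] (F N : Submodule R M) (hF : F.FG)
    (hN : ∀ (r : R) (f : M), r ≠ 0 → r • f ∈ N → f ∈ N) : (F ⊓ N).FG := by
  let L : Submodule R F := N.comap F.subtype
  have hfin : Module.Finite R F := Module.Finite.iff_fg.mpr hF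
  have hflat : Module.Flat R (F ⧸ L) := by
    rw [Module.Flat.flat_iff_torsion_eq_bot_of_isBezout, eq_bot_iff]
    rintro x ⟨⟨r, hr⟩, h⟩
    obtain ⟨y, rfl⟩ := L.mkQ_surjective x
    change r • L.mkQ y = 0 at h
    rw [← map_smul] at h
    simp only [Submodule.mkQ_apply, Submodule.Quotient.mk_eq_zero] at h
    simp only [Submodule.mkQ_apply, Submodule.mem_bot, Submodule.Quotient.mk_eq_zero]
    exact hN r _ (nonZeroDivisors.ne_zero hr) h
  have hfree : Module.Free R (F ⧸ L) := Module.free_of_flat_of_isLocalRing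
  have hfp : Module.FinitePresentation R (F ⧸ L) := Module.finitePresentation_of_projective _ _
  have := Module.FinitePresentation.fg_ker L.mkQ L.mkQ_surjective
  rw [Submodule.ker_mkQ] at this
  have h2 := this.map F.subtype
  rwa [Submodule.map_comap_subtype] at h2

/-- Content extraction. -/
lemma exists_content {R σ ι : Type*} [CommRing R] [IsDomain R] [ValuationRing R] [Finite ι]
    (v : ι → MvPolynomial σ R)
    (hv : ∀ i s, coeff s (v i) ∈ IsLocalRing.maximalIdeal R) :
    ∃ c ∈ IsLocalRing.maximalIdeal R, ∃ g : ι → MvPolynomial σ R, v = c • g := by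
  classical
  let X : Set R := ⋃ i, (fun s => coeff s (v i)) '' ((v i).support : Set (σ →₀ ℕ))
  have hX : X.Finite := Set.finite_iUnion fun i => (Finset.finite_toSet _).image _
  have hfg : (Ideal.span X).FG := Submodule.fg_span hX
  have hp := IsBezout.isPrincipal_of_FG _ hfg
  obtain ⟨c, hc⟩ := hp.principal
  have hcm : c ∈ IsLocalRing.maximalIdeal R := by
    have h1 : Ideal.span X ≤ IsLocalRing.maximalIdeal R := by
      rw [Ideal.span_le]
      intro x hx
      obtain ⟨i, s, _, rfl⟩ := Set.mem_iUnion.mp hx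
      exact hv i s
    apply h1
    rw [hc]
    exact Submodule.mem_span_singleton_self c
  have hdvd : ∀ i, C c ∣ v i := by
    intro i
    rw [C_dvd_iff_dvd_coeff]
    intro s
    by_cases hs : s ∈ (v i).support
    · have : coeff s (v i) ∈ Ideal.span X :=
        Ideal.subset_span (Set.mem_iUnion.mpr ⟨i, s, hs, rfl⟩)
      rw [hc] at this
      exact Ideal.mem_span_singleton.mp this
    · rw [notMem_support_iff.mp hs]; exact dvd_zero _
  choose g hg using hdvd
  refine ⟨c, hcm, g, ?_⟩
  ext1 i
  rw [hg i, Pi.smul_apply, smul_eq_C_mul]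

lemma graded_fg {R σ ι : Type*} [CommRing R] [IsDomain R] [ValuationRing R] [Finite σ] [Finite ι]
    (H : Submodule (MvPolynomial σ R) (ι → MvPolynomial σ R))
    (hsat : ∀ (r : R) f, r ≠ 0 → r • f ∈ H → f ∈ H)
    (hhom : ∀ f ∈ H, ∀ d, cmp ι d f ∈ H) : H.FG := by
  classical
  let k := IsLocalRing.ResidueField R
  let ρ : MvPolynomial σ R →+* MvPolynomial σ k := MvPolynomial.map (IsLocalRing.residue R)
  have hρ : Function.Surjective ρ := map_surjective _ IsLocalRing.residue_surjective
  have : RingHomSurjective ρ := ⟨hρ⟩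
  let π := piMap ι ρ
  let E : Set (ι → MvPolynomial σ R) := {f | f ∈ H ∧ ∃ d, ∀ i, (f i).IsHomogeneous d}
  have hfg : (Submodule.span (MvPolynomial σ k) (π '' E)).FG := IsNoetherian.noetherian _
  obtain ⟨s, hsE, hs⟩ := (Submodule.fg_span_iff_fg_span_finset_subset _).mp hfg
  obtain ⟨T, hTE, hT⟩ := (Finset.subset_set_image_iff).mp hsE
  let H' := Submodule.span (MvPolynomial σ R) (T : Set (ι → MvPolynomial σ R))
  have hH'H : H' ≤ H := Submodule.span_le.mpr fun f hf => (hTE hf).1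
  have hmap : Submodule.map π H' = Submodule.span (MvPolynomial σ k) (π '' E) := by
    rw [Submodule.map_span, hs, ← hT, Finset.coe_image]
  have hEH' : ∀ d, ∀ f ∈ H, (∀ i, (f i).IsHomogeneous d) → f ∈ H' := by
    intro d
    let F : Submodule R (ι → MvPolynomial σ R) :=
      Submodule.pi Set.univ fun _ => homogeneousSubmodule σ R d
    have hF : F.FG := Submodule.fg_pi fun _ => homogeneousSubmodule_fg _ _ d
    have hFH := fg_of_saturated F (H.restrictScalars R) hF hsat
    have hle := Submodule.le_of_le_smul_of_le_jacobson_bot (N := H'.restrictScalars R)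
      (I := IsLocalRing.maximalIdeal R) hFH
      (IsLocalRing.maximalIdeal_le_jacobson _) (by
        rintro f ⟨hfF, hfH⟩
        have hfd : ∀ i, (f i).IsHomogeneous d := fun i => hfF i trivial
        have hcf : cmp ι d f = f := by
          ext1 i
          exact homogeneousComponent_eq_self (hfd i)
        have h1 : π f ∈ Submodule.map π H' := by
          rw [hmap]
          exact Submodule.subset_span ⟨f, ⟨hfH, d, hfd⟩, rfl⟩
        obtain ⟨h, hh, hhf⟩ := h1
        obtain ⟨c, hc, g, hg⟩ := exists_content (f - h) (by
          intro i s
          have h2 : ρ (h i) = ρ (f i) := congrFun hhf i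
          have h3 : ρ (f i - h i) = 0 := by rw [map_sub, h2, sub_self]
          have h4 := congrArg (coeff s) h3
          rw [coeff_map, coeff_zero] at h4
          exact Ideal.Quotient.eq_zero_iff_mem.mp h4)
        have hfhH : f - h ∈ H := Submodule.sub_mem _ hfH (hH'H hh)
        have hch : cmp ι d h ∈ H' := cmp_mem_span _ (fun f hf => (hTE hf).2) d h hh
        have hfe : f = cmp ι d h + c • cmp ι d g := by
          have : f = h + c • g := by rw [← hg]; abel
          rw [← map_smul, ← map_add, ← this, hcf]
        by_cases hc0 : c = 0
        · apply Submodule.mem_sup_left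
          rw [hfe, hc0, zero_smul, add_zero]
          exact hch
        · rw [hfe]
          refine Submodule.add_mem_sup hch (Submodule.smul_mem_smul hc ⟨?_, ?_⟩)
          · intro i _
            exact homogeneousComponent_isHomogeneous d (g i)
          · refine hhom _ (hsat c _ hc0 ?_) d
            rw [← hg]; exact hfhH)
    intro f hf hfd
    exact hle ⟨fun i _ => hfd i, hf⟩
  refine ⟨T, le_antisymm hH'H ?_⟩
  intro f hf
  obtain ⟨N, hN⟩ := eq_sum_cmp f
  rw [hN]
  exact Submodule.sum_mem _ fun d _ =>
    hEH' d _ (hhom f hf d) fun i => homogeneousComponent_isHomogeneous d (f i)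

lemma sat_fg {R σ ι : Type*} [CommRing R] [IsDomain R] [ValuationRing R] [Finite σ] [Finite ι]
    (K : Submodule (MvPolynomial σ R) (ι → MvPolynomial σ R))
    (hsat : ∀ (r : R) f, r ≠ 0 → r • f ∈ K → f ∈ K) : K.FG := by
  classical
  cases nonempty_fintype ι
  let φ : MvPolynomial (Option σ) R →ₐ[R] MvPolynomial σ R :=
    aeval fun o => o.elim 1 X
  have hφr : ∀ p, φ (rename some p) = p := by
    intro p
    change aeval (fun o : Option σ => o.elim 1 X) (rename some p) = p
    rw [aeval_rename]
    exact aeval_X_left_apply p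
  have : RingHomSurjective φ.toRingHom := ⟨fun p => ⟨_, hφr p⟩⟩
  let Φ := piMap ι φ.toRingHom
  let E : Set (ι → MvPolynomial (Option σ) R) :=
    {f | (∃ d, ∀ i, (f i).IsHomogeneous d) ∧ Φ f ∈ K}
  let H := Submodule.span (MvPolynomial (Option σ) R) E
  have hHK : ∀ f ∈ H, Φ f ∈ K := by
    have : H ≤ K.comap Φ := Submodule.span_le.mpr fun f hf => hf.2
    exact this
  have hhom : ∀ f ∈ H, ∀ d, cmp ι d f ∈ H :=
    fun f hf d => cmp_mem_span E (fun f hf => hf.1) d f hf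
  have hHfg : H.FG := by
    refine graded_fg H ?_ hhom
    intro r f hr hf
    obtain ⟨N, hN⟩ := eq_sum_cmp f
    rw [hN]
    refine Submodule.sum_mem _ fun d _ => Submodule.subset_span
      ⟨⟨d, fun i => homogeneousComponent_isHomogeneous d (f i)⟩, ?_⟩
    apply hsat r _ hr
    have h1 := hHK _ (hhom _ hf d)
    have h2 : Φ (cmp ι d (r • f)) = r • Φ (cmp ι d f) := by
      rw [map_smul]
      ext1 i
      exact map_smul φ r _
    rwa [h2] at h1
  have : K = H.map Φ := by
    apply le_antisymm
    · intro w hw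
      let D := Finset.univ.sup fun i => (w i).totalDegree
      let W : ι → MvPolynomial (Option σ) R := fun i =>
        ∑ j ∈ Finset.range ((w i).totalDegree + 1),
          X none ^ (D - j) * rename some (homogeneousComponent j (w i))
      have hW : Φ W = w := by
        ext1 i
        change φ (W i) = w i
        simp only [W, map_sum, map_mul, map_pow, hφr]
        have : φ (X none) = 1 := by simp [φ]
        simp only [this, one_pow, one_mul]
        exact sum_homogeneousComponent _
      refine ⟨W, Submodule.subset_span ⟨⟨D, fun i => ?_⟩, ?_⟩, hW⟩
      · refine IsHomogeneous.sum _ _ _ fun j hj => ?_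
        have hD := Finset.le_sup (f := fun i => (w i).totalDegree) (Finset.mem_univ i)
        have hjD : D - j + j = D := by
          simp only [Finset.mem_range] at hj
          have : (w i).totalDegree ≤ D := hD
          omega
        have := (isHomogeneous_X_pow (R := R) (none : Option σ) (D - j)).mul
          ((homogeneousComponent_isHomogeneous j (w i)).rename_isHomogeneous (f := some))
        rwa [hjD] at this
      · rw [hW]; exact hw
    · rintro _ ⟨f, hf, rfl⟩
      exact hHK f hf
  rw [this]
  exact hHfg.map Φ

end RankOneCoh

/-- **Coherence over rank-1 valuation rings.**
Let `R` be a valuation ring of rank 1 (a valuation domain of Krull dimension 1) and let `A`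
be a finitely presented `R`-algebra.  Then `A` is a coherent ring: every finitely generated
ideal `I` of `A` is finitely presented as an `A`-module. -/
theorem coherence_over_rank_one_valuation_ring
    {R A : Type*} [CommRing R] [IsDomain R] [ValuationRing R]
    (hrank : ringKrullDim R = 1)
    [CommRing A] [Algebra R A] [Algebra.FinitePresentation R A]
    (I : Ideal A) (hI : I.FG) :
    Module.FinitePresentation A I := by
  classical
  obtain ⟨n, q, hq, hker⟩ := Algebra.FinitePresentation.out (R := R) (A := A)
  obtain ⟨m, a, ha⟩ := Submodule.fg_iff_exists_fin_generating_family.mp hI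
  obtain ⟨l, b, hb⟩ := Submodule.fg_iff_exists_fin_generating_family.mp hker
  choose a' ha' using fun i => hq (a i)
  let P := MvPolynomial (Fin n) R
  -- the relation module over the polynomial ring
  let G : (Fin m ⊕ Fin l → P) →ₗ[P] P := Fintype.linearCombination P (Sum.elim a' b)
  have hG : ∀ v, G v = (∑ i, v (Sum.inl i) * a' i) + ∑ j, v (Sum.inr j) * b j := by
    intro v
    simp [G, Fintype.linearCombination_apply]
  have hK : (LinearMap.ker G).FG := by
    refine RankOneCoh.sat_fg _ ?_
    intro r f hr hf
    rw [LinearMap.mem_ker] at hf ⊢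
    have : G (r • f) = r • G f := LinearMap.map_smul_of_tower G r f
    rw [this] at hf
    exact (smul_eq_zero.mp hf).resolve_left hr
  have : RingHomSurjective q.toRingHom := ⟨hq⟩
  let Ψ : (Fin m ⊕ Fin l → P) →ₛₗ[q.toRingHom] (Fin m → A) :=
    { toFun := fun v i => q (v (Sum.inl i))
      map_add' := fun v w => by ext i; simp
      map_smul' := fun c v => by ext i; simp }
  let L0 : (Fin m → A) →ₗ[A] A := Fintype.linearCombination A a
  have hL0 : LinearMap.range L0 = I := by
    rw [← ha]; exact Fintype.range_linearCombination A a
  let L : (Fin m → A) →ₗ[A] I := L0.codRestrict I fun v => hL0 ▸ LinearMap.mem_range_self L0 v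
  refine Module.finitePresentation_of_surjective L ?_ ?_
  · rintro ⟨x, hx⟩
    rw [← hL0] at hx
    obtain ⟨v, hv⟩ := hx
    exact ⟨v, Subtype.ext hv⟩
  · have hkb : ∀ p : P, q p = 0 ↔ ∃ c : Fin l → P, ∑ j, c j * b j = p := by
      intro p
      have : q p = 0 ↔ p ∈ Submodule.span P (Set.range b) := by
        rw [hb]; exact Iff.rfl
      rw [this, Submodule.mem_span_range_iff_exists_fun]
      rfl
    have : LinearMap.ker L = (LinearMap.ker G).map Ψ := by
      ext v
      have hv : v ∈ LinearMap.ker L ↔ ∑ i, v i * a i = 0 := by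
        rw [LinearMap.mem_ker, ← Subtype.val_inj]
        rfl
      rw [hv]
      constructor
      · intro h
        choose v' hv' using fun i => hq (v i)
        obtain ⟨c, hc⟩ := (hkb (-∑ i, v' i * a' i)).mp (by
          rw [map_neg, map_sum]
          simp only [map_mul, ha', hv', h, neg_zero])
        refine ⟨Sum.elim v' c, ?_, ?_⟩
        · change G _ = 0
          rw [hG]
          simp only [Sum.elim_inl, Sum.elim_inr, hc, add_neg_cancel]
        · ext i
          exact hv' i
      · rintro ⟨w, hw, rfl⟩
        have hw' : G w = 0 := hw
        rw [hG] at hw'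
        have h1 := congrArg q hw'
        rw [map_add, (hkb (∑ j, w (Sum.inr j) * b j)).mpr ⟨_, rfl⟩, add_zero, map_zero,
          map_sum] at h1
        simp only [map_mul, ha'] at h1
        exact h1
    rw [this]
    exact hK.map Ψ
end

section
/- Principal subschemes in flat families over an arbitrary base: let φ : B → A be a flat ring homomorphism of finite type, where B and A each have a unique minimal prime (their spectra are irreducible). Let q₀ be the minimal prime of B, with residue field κ(q₀), and let f ∈ A be an element whose image in the generic fiber ring A ⊗_B κ(q₀) is a unit (the locally principal subscheme V(f) does not meet the generic fiber). Then for every prime ideal q of B with residue field κ(q), every prime of the fiber ring A ⊗_B κ(q) that is minimal over the image of f is a minimal prime of A ⊗_B κ(q); that is, every irreducible component of V(f) in the fiber over q is an irreducible component of that fiber. -/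
theorem aux_isolated {R S : Type*} [CommRing R] [CommRing S] [Algebra R S]
    [Algebra.FiniteType R S] (P : Ideal S) [hP : P.IsPrime]
    (h1 : ∀ Q : Ideal S, Q.IsPrime → Q.under R = P.under R → Q ≤ P → Q = P)
    (h2 : ∀ Q : Ideal S, Q.IsPrime → Q.under R = P.under R → P ≤ Q → Q = P) :
    Algebra.QuasiFiniteAt R P := by
  let q : PrimeSpectrum S := ⟨P, hP⟩
  refine Algebra.QuasiFiniteAt.of_isOpen_singleton_fiber (R := R) q ?_
  let p := q.comap (algebraMap R S)
  let e := PrimeSpectrum.preimageHomeomorphFiber R S p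
  let eo := PrimeSpectrum.preimageOrderIsoFiber R S p
  have heo : ∀ x, eo x = e x := fun x => rfl
  rw [← e.isOpen_image, Set.image_singleton]
  have : IsNoetherianRing (p.asIdeal.Fiber S) :=
    Algebra.FiniteType.isNoetherianRing p.asIdeal.ResidueField _
  have : IsJacobsonRing (p.asIdeal.Fiber S) :=
    isJacobsonRing_of_finiteType (A := p.asIdeal.ResidueField)
  rw [(PrimeSpectrum.isOpen_singleton_tfae_of_isNoetherian_of_isJacobsonRing _).out 0 2 rfl rfl]
  constructor
  · rw [PrimeSpectrum.isClosed_singleton_iff_isMaximal, ← PrimeSpectrum.isMax_iff, ← heo]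
    rw [eo.isMax_apply]
    rintro ⟨⟨Q, hQ⟩, hQ'⟩ hle
    have := h2 Q hQ (congr($(hQ').asIdeal)) hle
    subst this
    exact le_rfl
  · intro a b hab hb
    rw [Set.mem_singleton_iff] at hb ⊢
    subst hb
    rw [← PrimeSpectrum.le_iff_specializes] at hab
    obtain ⟨⟨⟨Q, hQ⟩, hQ'⟩, rfl⟩ := eo.surjective b
    rw [← heo, eo.le_iff_le] at hab
    have := h1 Q hQ (congr($(hQ').asIdeal)) hab
    subst this
    rfl

theorem aux_mv_closed {σ V : Type*} [CommRing V] [IsDomain V] [IsIntegrallyClosed V] :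
    IsIntegrallyClosed (MvPolynomial σ V) := by
  let K := FractionRing V
  let : Algebra (MvPolynomial σ V) (MvPolynomial σ K) := MvPolynomial.algebraMvPolynomial
  have : IsIntegrallyClosed (MvPolynomial σ K) := UniqueFactorizationMonoid.instIsIntegrallyClosed
  suffices IsIntegrallyClosedIn (MvPolynomial σ V) (MvPolynomial σ K) from
    .of_isIntegrallyClosed_of_isIntegrallyClosedIn _ (MvPolynomial σ K)
  refine isIntegrallyClosedIn_iff.mpr
    ⟨MvPolynomial.map_injective _ (IsFractionRing.injective _ _), ?_⟩
  intro p hp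
  rw [MvPolynomial.isIntegral_iff_isIntegral_coeff] at hp
  have : p ∈ Set.range (MvPolynomial.map (σ := σ) (algebraMap V K)) := by
    rw [MvPolynomial.mem_range_map_iff_coeffs_subset]
    intro x hx
    obtain ⟨n, hn, rfl⟩ := MvPolynomial.mem_coeffs_iff.mp hx
    exact IsIntegrallyClosed.isIntegral_iff.mp (hp n)
  exact this

theorem aux_min {V : Type*} [CommRing V] [IsDomain V] [ValuationRing V] {ι : Type*}
    (s : Finset ι) (hs : s.Nonempty) (a : ι → V) : ∃ i ∈ s, ∀ j ∈ s, a i ∣ a j := by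
  classical
  induction hs using Finset.Nonempty.cons_induction with
  | singleton i => exact ⟨i, by simp, by simp⟩
  | cons i s hi hs ih =>
    obtain ⟨j, hj, h⟩ := ih
    rcases ValuationRing.dvd_total (a i) (a j) with h' | h'
    · refine ⟨i, by simp, fun k hk => ?_⟩
      rcases Finset.mem_cons.mp hk with rfl | hk
      · exact dvd_rfl
      · exact h'.trans (h k hk)
    · refine ⟨j, by simp [hj], fun k hk => ?_⟩
      rcases Finset.mem_cons.mp hk with rfl | hk
      · exact h'
      · exact h k hk

open Polynomial in
theorem aux_content {V : Type*} [CommRing V] [IsDomain V] [ValuationRing V] {σ : Type*}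
    (g : (MvPolynomial σ V)[X]) (hg : g ≠ 0) :
    ∃ (v : V) (g' : (MvPolynomial σ V)[X]), v ≠ 0 ∧ g = C (MvPolynomial.C v) * g' ∧
      ∃ i d, (g'.coeff i).coeff d = 1 := by
  classical
  let s : Finset (Σ _ : ℕ, σ →₀ ℕ) := g.support.sigma (fun i => (g.coeff i).support)
  have hs : s.Nonempty := by
    obtain ⟨i, hi⟩ := Polynomial.support_nonempty.mpr hg
    obtain ⟨d, hd⟩ := MvPolynomial.support_nonempty.mpr (Polynomial.mem_support_iff.mp hi)
    exact ⟨⟨i, d⟩, by simp only [s, Finset.mem_sigma]; exact ⟨hi, hd⟩⟩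
  obtain ⟨⟨i, d⟩, hid, hmin⟩ := aux_min s hs (fun t => (g.coeff t.1).coeff t.2)
  simp only [s, Finset.mem_sigma, MvPolynomial.mem_support_iff] at hid
  have hdvd : C (MvPolynomial.C ((g.coeff i).coeff d)) ∣ g := by
    rw [Polynomial.C_dvd_iff_dvd_coeff]
    intro j
    rw [MvPolynomial.C_dvd_iff_dvd_coeff]
    intro e
    by_cases h0 : (g.coeff j).coeff e = 0
    · rw [h0]; exact dvd_zero _
    · refine hmin ⟨j, e⟩ ?_
      simp only [s, Finset.mem_sigma, MvPolynomial.mem_support_iff, Polynomial.mem_support_iff]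
      exact ⟨fun h => h0 (by simp [h]), h0⟩
  obtain ⟨g', hg'⟩ := hdvd
  refine ⟨_, g', hid.2, hg', i, d, ?_⟩
  have := congr(($hg').coeff i |>.coeff d)
  rw [Polynomial.coeff_C_mul, MvPolynomial.coeff_C_mul] at this
  exact mul_left_cancel₀ hid.2 (by rw [← this, mul_one])

theorem aux_integral {R D : Type*} [CommRing R] [IsDomain R] [IsIntegrallyClosed R]
    [CommRing D] [IsDomain D] [Algebra R D] [FaithfulSMul R D]
    (P : Ideal D) [P.IsPrime] (x v : R) (hx : Prime x) (hv : ¬ x ∣ v)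
    (hxP : algebraMap R D x ∈ P) (s h : D) (hs : IsIntegral R s) (hh : IsIntegral R h)
    (e : v • s = x • h) : s ∈ P := by
  have hv0 : v ≠ 0 := fun h => hv (h ▸ dvd_zero _)
  have hm : (minpoly R s).scaleRoots v = (minpoly R h).scaleRoots x := by
    rw [← IsIntegrallyClosed.minpoly_smul hv0 hs, ← IsIntegrallyClosed.minpoly_smul hx.ne_zero hh, e]
  have hdeg : (minpoly R s).natDegree = (minpoly R h).natDegree := by
    have := congr(($hm).natDegree)
    simpa using this
  have hcoef : ∀ i, i < (minpoly R s).natDegree → x ∣ (minpoly R s).coeff i := by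
    intro i hi
    have := congr(($hm).coeff i)
    rw [Polynomial.coeff_scaleRoots, Polynomial.coeff_scaleRoots, ← hdeg] at this
    have h1 : x ∣ (minpoly R s).coeff i * v ^ ((minpoly R s).natDegree - i) := by
      rw [this]
      exact dvd_mul_of_dvd_right (dvd_pow_self _ (by omega)) _
    rcases hx.dvd_or_dvd h1 with h2 | h2
    · exact h2
    · exact absurd (hx.dvd_of_dvd_pow h2) hv
  have h0 := minpoly.aeval R s
  rw [Polynomial.aeval_eq_sum_range, Finset.sum_range_succ,
    (minpoly.monic hs).coeff_natDegree, one_smul] at h0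
  have hsum : ∑ i ∈ Finset.range (minpoly R s).natDegree, (minpoly R s).coeff i • s ^ i ∈ P := by
    refine Ideal.sum_mem _ fun i hi => ?_
    obtain ⟨c, hc⟩ := hcoef i (Finset.mem_range.mp hi)
    rw [Algebra.smul_def, hc, map_mul, mul_assoc]
    exact Ideal.mul_mem_right _ _ hxP
  have : s ^ (minpoly R s).natDegree ∈ P := by
    rw [← Ideal.add_mem_iff_right P hsum, h0]
    exact P.zero_mem
  exact ‹P.IsPrime›.mem_of_pow_mem _ this

open Polynomial in
theorem aux_key {V D : Type*} [CommRing V] [IsDomain V] [ValuationRing V]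
    [CommRing D] [IsDomain D] [Algebra V D] [Algebra.FiniteType V D]
    (hinj : Function.Injective (algebraMap V D)) (m : Ideal V) [hm : m.IsMaximal]
    (f h : D) (v : V) (hv : v ≠ 0) (hfh : f * h = algebraMap V D v)
    (P Q : Ideal D) [hP : P.IsPrime] [hQ : Q.IsPrime]
    [hPm : P.LiesOver m] [hQm : Q.LiesOver m] (hfP : f ∈ P)
    (hmin : ∀ Q' : Ideal D, Q'.IsPrime → f ∈ Q' → m ≤ Q'.under V → Q' ≤ P → Q' = P)
    (hQP : Q ≤ P) (hne : Q ≠ P) : False := by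
  have hfQ : f ∉ Q := fun hf => hne (hmin Q hQ hf (hQm.over.le) hQP)
  have hmker : ∀ (I : Ideal D) [I.LiesOver m] (a : V),
      algebraMap (V ⧸ m) (D ⧸ I) (Ideal.Quotient.mk m a) = Ideal.Quotient.mk I (algebraMap V D a) :=
    fun I _ a => rfl
  have : FaithfulSMul (V ⧸ m) (D ⧸ P) := inferInstance
  obtain ⟨t, ht⟩ := exists_isTranscendenceBasis (V ⧸ m) (D ⧸ P)
  choose y hy using fun i : t => Ideal.Quotient.mk_surjective (I := P) i.1
  let φ : (MvPolynomial t V)[X] →+* D := Polynomial.eval₂RingHom (MvPolynomial.aeval y : (MvPolynomial t V) →ₐ[V] D).toRingHom f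
  have hφX : φ X = f := by simp [φ]
  have hφC : ∀ c, φ (C c) = MvPolynomial.aeval y c := by intro c; simp [φ]
  let red : (MvPolynomial t V) →+* (MvPolynomial t (V ⧸ m)) := MvPolynomial.map (Ideal.Quotient.mk m)
  let θ (I : Ideal D) [I.LiesOver m] : (MvPolynomial t (V ⧸ m))[X] →+* D ⧸ I :=
    Polynomial.eval₂RingHom (MvPolynomial.aeval (fun i => Ideal.Quotient.mk I (y i)) :
      (MvPolynomial t (V ⧸ m)) →ₐ[V ⧸ m] D ⧸ I).toRingHom (Ideal.Quotient.mk I f)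
  have hθ : ∀ (I : Ideal D) [I.LiesOver m] (g : (MvPolynomial t V)[X]),
      θ I (g.map red) = Ideal.Quotient.mk I (φ g) := by
    intro I _ g
    suffices (θ I).comp (Polynomial.mapRingHom red) = (Ideal.Quotient.mk I).comp φ from
      congr($this g)
    ext1
    · ext1
      · ext a
        simp [θ, φ, red]
      · simp [θ, φ, red]
    · simp [θ, φ]
  have hredsurj : Function.Surjective red :=
    MvPolynomial.map_surjective _ Ideal.Quotient.mk_surjective
  have hindep : ∀ c : (MvPolynomial t (V ⧸ m)), MvPolynomial.aeval (fun i => Ideal.Quotient.mk P (y i)) c = 0 → c = 0 := by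
    intro c hc
    have h1 := ht.1
    have h2 : (fun i => Ideal.Quotient.mk P (y i)) = ((↑) : t → D ⧸ P) := funext hy
    rw [h2] at hc
    exact (injective_iff_map_eq_zero _).mp h1 c hc
  have hφinj : Function.Injective φ := by
    rw [injective_iff_map_eq_zero]
    intro g hg
    by_contra hg0
    obtain ⟨w, g', hw, rfl, i, d, hid⟩ := aux_content g hg0
    have hg' : φ g' = 0 := by
      rw [map_mul, hφC] at hg
      refine (mul_eq_zero.mp hg).resolve_left ?_
      simpa using (map_ne_zero_iff _ hinj).mpr hw
    have hne0 : g'.map red ≠ 0 := by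
      intro h0
      have := congr(($h0).coeff i |>.coeff d)
      rw [Polynomial.coeff_map] at this
      simp [red, MvPolynomial.coeff_map, hid] at this
    obtain ⟨u, hu, hXu⟩ := Polynomial.exists_eq_pow_rootMultiplicity_mul_and_not_dvd _ hne0 0
    rw [C_0, sub_zero] at hu hXu
    obtain ⟨u', rfl⟩ := Polynomial.map_surjective red hredsurj u
    have h1 := hθ Q g'
    rw [hg', hu, map_mul, map_pow, map_zero] at h1
    have h2 : θ Q X ≠ 0 := by
      simpa [θ, Ideal.Quotient.eq_zero_iff_mem] using hfQ
    have h3 := (mul_eq_zero.mp h1).resolve_left (pow_ne_zero _ h2)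
    rw [hθ, Ideal.Quotient.eq_zero_iff_mem] at h3
    have h4 := hθ P u'
    rw [Ideal.Quotient.eq_zero_iff_mem.mpr (hQP h3)] at h4
    apply hXu
    rw [Polynomial.X_dvd_iff]
    apply hindep
    have h5 : Ideal.Quotient.mk P f = 0 := Ideal.Quotient.eq_zero_iff_mem.mpr hfP
    simp only [θ, Polynomial.coe_eval₂RingHom, h5, Polynomial.eval₂_at_zero] at h4
    exact h4
  let : Algebra (MvPolynomial t V)[X] D := φ.toAlgebra
  have hφa : algebraMap (MvPolynomial t V)[X] D = φ := rfl
  have : FaithfulSMul (MvPolynomial t V)[X] D := (faithfulSMul_iff_algebraMap_injective _ _).mpr hφinj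
  have : IsScalarTower V (MvPolynomial t V)[X] D := IsScalarTower.of_algebraMap_eq fun a => by
    rw [hφa, Polynomial.algebraMap_apply, hφC]
    simp
  have : Algebra.FiniteType (MvPolynomial t V)[X] D := Algebra.FiniteType.of_restrictScalars_finiteType V _ _
  have hmem : ∀ (Q' : Ideal D) (g : (MvPolynomial t V)[X]), Q'.under (MvPolynomial t V)[X] = P.under (MvPolynomial t V)[X] → (φ g ∈ Q' ↔ φ g ∈ P) := by
    intro Q' g hh
    exact (SetLike.ext_iff.mp hh) g
  have hqf : Algebra.QuasiFiniteAt (MvPolynomial t V)[X] P := by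
    apply aux_isolated
    · intro Q' hQ' hu hle
      refine hmin Q' hQ' ?_ ?_ hle
      · have := (hmem Q' X hu)
        rw [hφX] at this
        exact this.mpr hfP
      · intro a ha
        have := (hmem Q' (C (MvPolynomial.C a)) hu)
        simp only [hφC, MvPolynomial.aeval_C] at this
        refine this.mpr ?_
        have h6 : a ∈ P.under V := hPm.over ▸ ha
        exact h6
    · intro Q' hQ' hu hle
      by_contra hne'
      obtain ⟨x, hxQ, hxP⟩ := SetLike.exists_of_lt (lt_of_le_of_ne hle (Ne.symm hne'))
      have halg := ht.isAlgebraic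
      have hx0 : Ideal.Quotient.mk P x ≠ 0 := by
        rwa [Ne, Ideal.Quotient.eq_zero_iff_mem]
      have h7 := Ideal.comap_ne_bot_of_algebraic_mem (I := Q'.map (Ideal.Quotient.mk P)) hx0
        (Ideal.mem_map_of_mem _ hxQ) (halg.isAlgebraic _)
      obtain ⟨⟨z, hz⟩, hzQ, hz0⟩ := Submodule.exists_mem_ne_zero_of_ne_bot h7
      rw [Algebra.adjoin_range_eq_range_aeval] at hz
      obtain ⟨c, rfl⟩ := hz
      obtain ⟨c', rfl⟩ := hredsurj c
      have h8 : (MvPolynomial.aeval ((↑) : t → D ⧸ P)) (red c') = Ideal.Quotient.mk P (φ (C c')) := by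
        rw [← hθ P]
        have h2 : (fun i => Ideal.Quotient.mk P (y i)) = ((↑) : t → D ⧸ P) := funext hy
        simp [θ, h2]
      apply hz0
      ext
      change (MvPolynomial.aeval ((↑) : t → D ⧸ P)) (red c') = 0
      rw [h8, Ideal.Quotient.eq_zero_iff_mem, ← hmem Q' _ hu]
      have h9 : (MvPolynomial.aeval ((↑) : t → D ⧸ P)) (red c') ∈ Q'.map (Ideal.Quotient.mk P) := hzQ
      rw [h8, ← Ideal.mem_comap, Ideal.comap_map_of_surjective _ Ideal.Quotient.mk_surjective,
        ← RingHom.ker_eq_comap_bot, Ideal.mk_ker, sup_eq_left.mpr hle] at h9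
      exact h9
  have hz := Algebra.ZariskisMainProperty.of_finiteType (R := (MvPolynomial t V)[X]) P
  obtain ⟨r, hr, hrint, hall⟩ := Algebra.zariskisMainProperty_iff.mp hz
  obtain ⟨k, hk⟩ := hall h
  have : IsIntegrallyClosed (MvPolynomial t V) := aux_mv_closed
  have hvX : ¬ (X : (MvPolynomial t V)[X]) ∣ C (MvPolynomial.C v) := by
    rw [Polynomial.X_dvd_iff]
    simpa using hv
  have := aux_integral P (X : (MvPolynomial t V)[X]) (C (MvPolynomial.C v)) Polynomial.prime_X hvX
    (by rw [hφa, hφX]; exact hfP) (r ^ k) (r ^ k * h) (hrint.pow k) hk (by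
      rw [Algebra.smul_def, Algebra.smul_def, hφa, hφX, hφC]
      simp only [MvPolynomial.aeval_C]
      rw [← hfh]; ring)
  exact hr (hP.mem_of_pow_mem _ this)

theorem aux_stage2 {V R : Type*} [CommRing V] [IsDomain V] [ValuationRing V]
    [CommRing R] [Algebra V R] [Module.Flat V R] [Algebra.FiniteType V R]
    (m : Ideal V) [hm : m.IsMaximal]
    (f h : R) (v : V) (hv : v ≠ 0) (hfh : f * h = algebraMap V R v)
    (P Q : Ideal R) [hP : P.IsPrime] [hQ : Q.IsPrime]
    (hPm : m ≤ P.under V) (hQm : m ≤ Q.under V) (hfP : f ∈ P)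
    (hmin : ∀ Q' : Ideal R, Q'.IsPrime → f ∈ Q' → m ≤ Q'.under V → Q' ≤ P → Q' = P)
    (hQP : Q < P) : False := by
  obtain ⟨N, hN, hNQ⟩ := Ideal.exists_minimalPrimes_le (I := (⊥ : Ideal R)) (J := Q) bot_le
  have hNp : N.IsPrime := hN.1.1
  let π := Ideal.Quotient.mk N
  have hπ : Function.Surjective π := Ideal.Quotient.mk_surjective
  have hinj : Function.Injective (algebraMap V (R ⧸ N)) := by
    rw [injective_iff_map_eq_zero]
    intro a ha
    by_contra ha0
    have h1 : algebraMap V R a ∈ N := Ideal.Quotient.eq_zero_iff_mem.mp ha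
    refine notMem_nonZeroDivisors_of_mem_mem_minimalPrimes h1 hN ?_
    rw [mem_nonZeroDivisors_iff_right]
    intro x hx
    have h2 : IsSMulRegular R a :=
      Module.Flat.isSMulRegular_of_isRegular (IsRegular.of_ne_zero ha0)
    refine h2 ?_
    change a • x = a • 0
    rw [Algebra.smul_def, mul_comm, hx, smul_zero]
  have hker : RingHom.ker π = N := Ideal.mk_ker
  have hcm : ∀ I : Ideal R, N ≤ I → (I.map π).comap π = I := by
    intro I hI
    rw [Ideal.comap_map_of_surjective _ hπ, ← RingHom.ker_eq_comap_bot, hker, sup_eq_left.mpr hI]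
  have hunder : ∀ I : Ideal (R ⧸ N), I.under V = (I.comap π).under V := fun I => rfl
  have hPp : (P.map π).IsPrime :=
    Ideal.map_isPrime_of_surjective hπ (by rw [hker]; exact hNQ.trans hQP.le)
  have hQp : (Q.map π).IsPrime := Ideal.map_isPrime_of_surjective hπ (by rw [hker]; exact hNQ)
  have hPc := hcm P (hNQ.trans hQP.le)
  have hQc := hcm Q hNQ
  have hover : ∀ I : Ideal (R ⧸ N), I.IsPrime → m ≤ (I.comap π).under V → I.LiesOver m :=
    fun I hI hle => ⟨hm.eq_of_le (Ideal.IsPrime.ne_top (hI.under V)) hle⟩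
  have := hover (P.map π) hPp (by rwa [hPc])
  have := hover (Q.map π) hQp (by rwa [hQc])
  refine aux_key hinj m (π f) (π h) v hv (by rw [← map_mul, hfh]; rfl) (P.map π) (Q.map π)
    (Ideal.mem_map_of_mem _ hfP) ?_ (Ideal.map_mono hQP.le) ?_
  · intro Q' hQ' hfQ' hmQ' hle
    have h1 := hmin (Q'.comap π) (hQ'.comap π) hfQ' hmQ' (by
      rw [← hPc]; exact Ideal.comap_mono hle)
    rw [← h1, Ideal.map_comap_of_surjective _ hπ]
  · intro heq
    apply hQP.ne
    rw [← hQc, ← hPc, heq]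

theorem aux_ext {F T : Type*} [CommRing F] [CommRing T] [Algebra F T]
    [Module.FaithfullyFlat F T] (f : F) (P : Ideal F) (hP : P ∈ (Ideal.span {f}).minimalPrimes)
    (Q : Ideal F) [hQ : Q.IsPrime] (hQP : Q < P) :
    ∃ P' Q' : Ideal T, P' ∈ (Ideal.span {algebraMap F T f}).minimalPrimes ∧ Q'.IsPrime ∧
      Q' < P' := by
  have hPp : P.IsPrime := hP.1.1
  obtain ⟨P₁, hP₁, hP₁o⟩ := Ideal.exists_isPrime_liesOver_of_faithfullyFlat (B := T) P
  have hf1 : algebraMap F T f ∈ P₁ := by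
    have : f ∈ P₁.under F := hP₁o.over ▸ hP.1.2 (Ideal.mem_span_singleton_self f)
    exact this
  obtain ⟨P', hP', hle⟩ := Ideal.exists_minimalPrimes_le
    (I := Ideal.span {algebraMap F T f}) (J := P₁) (by rwa [Ideal.span_singleton_le_iff_mem])
  have hP'p : P'.IsPrime := hP'.1.1
  have hfP' : f ∈ P'.under F := hP'.1.2 (Ideal.mem_span_singleton_self _)
  have h2 : P'.under F ≤ P := by
    rw [hP₁o.over]; exact Ideal.comap_mono hle
  have : P'.LiesOver P := ⟨le_antisymm (hP.2 ⟨hP'p.under F, by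
    rwa [Ideal.span_singleton_le_iff_mem]⟩ h2) h2⟩
  obtain ⟨Q', hlt, hQ', -⟩ := Ideal.exists_ideal_lt_liesOver_of_lt P' hQP
  exact ⟨P', Q', hP', hQ', hlt⟩

open TensorProduct in
theorem aux_stage3 {B A V k l : Type*} [CommRing B] [CommRing A] [CommRing V] [IsDomain V]
    [ValuationRing V] [Field k] [Field l] [Algebra B A] [Algebra B V] [Algebra B k] [Algebra B l]
    [Algebra V l] [Algebra k l] [IsScalarTower B V l] [IsScalarTower B k l]
    [Module.Flat B A] [Algebra.FiniteType B A]
    (hs : Function.Surjective (algebraMap V l))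
    (f : A) (h : V ⊗[B] A) (v : V) (hv : v ≠ 0)
    (hfh : ((1 : V) ⊗ₜ[B] f) * h = algebraMap V (V ⊗[B] A) v)
    (P : Ideal (k ⊗[B] A)) (hP : P ∈ (Ideal.span {(1 : k) ⊗ₜ[B] f}).minimalPrimes) :
    P ∈ minimalPrimes (k ⊗[B] A) := by
  have hPp : P.IsPrime := hP.1.1
  refine ⟨⟨hPp, bot_le⟩, ?_⟩
  rintro Q ⟨hQ, -⟩ hQP
  by_contra hlt
  have hQP' : Q < P := lt_of_le_not_ge hQP hlt
  obtain ⟨P', Q', hP', hQ', hlt'⟩ := aux_ext (T := (k ⊗[B] A) ⊗[k] l) _ P hP Q hQP'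
  have hP'p : P'.IsPrime := hP'.1.1
  let φ₀ : V ⊗[B] A →ₐ[B] l ⊗[B] A :=
    Algebra.TensorProduct.map (IsScalarTower.toAlgHom B V l) (AlgHom.id B A)
  let e₁ : l ⊗[B] A ≃+* l ⊗[k] (k ⊗[B] A) :=
    (Algebra.TensorProduct.cancelBaseChange B k k l A).symm.toRingEquiv
  let e₂ : l ⊗[k] (k ⊗[B] A) ≃+* (k ⊗[B] A) ⊗[k] l :=
    (Algebra.TensorProduct.comm k l (k ⊗[B] A)).toRingEquiv
  let ψ : V ⊗[B] A →+* (k ⊗[B] A) ⊗[k] l := ((e₁.trans e₂) : _ →+* _).comp φ₀.toRingHom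
  have hφ₀ : Function.Surjective φ₀ := TensorProduct.map_surjective hs Function.surjective_id
  have hψs : Function.Surjective ψ := (e₁.trans e₂).surjective.comp hφ₀
  let m := RingHom.ker (algebraMap V l)
  have hm : m.IsMaximal := RingHom.ker_isMaximal_of_surjective _ hs
  have hψV : ∀ a ∈ m, ψ (algebraMap V _ a) = 0 := by
    intro a ha
    have ha : algebraMap V l a = 0 := ha
    simp [ψ, φ₀, Algebra.TensorProduct.algebraMap_apply, ha]
  have hψf : ψ (1 ⊗ₜ f) = algebraMap (k ⊗[B] A) _ (1 ⊗ₜ f) := by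
    simp [ψ, φ₀, e₁, e₂]
  have hker : RingHom.ker ψ = m.map (algebraMap V (V ⊗[B] A)) := by
    have h1 : RingHom.ker ψ = RingHom.ker φ₀ := by
      ext x
      simp only [RingHom.mem_ker, ψ, RingHom.comp_apply]
      exact map_eq_zero_iff _ (e₁.trans e₂).injective
    rw [h1]
    exact Algebra.TensorProduct.rTensor_ker _ hs
  have hmle : ∀ I : Ideal ((k ⊗[B] A) ⊗[k] l), m ≤ (I.comap ψ).under V := by
    intro I a ha
    change ψ (algebraMap V _ a) ∈ I
    rw [hψV a ha]
    exact I.zero_mem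
  refine aux_stage2 m (1 ⊗ₜ f) h v hv hfh (P'.comap ψ) (Q'.comap ψ) (hmle _) (hmle _) ?_ ?_ ?_
  · rw [Ideal.mem_comap, hψf]
    exact hP'.1.2 (Ideal.mem_span_singleton_self _)
  · intro I hI hfI hmI hle
    have hkI : RingHom.ker ψ ≤ I := by rw [hker, Ideal.map_le_iff_le_comap]; exact hmI
    have hIp : (I.map ψ).IsPrime := Ideal.map_isPrime_of_surjective hψs hkI
    have hIc : (I.map ψ).comap ψ = I := by
      rw [Ideal.comap_map_of_surjective _ hψs, ← RingHom.ker_eq_comap_bot, sup_eq_left.mpr hkI]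
    refine le_antisymm hle ?_
    have h3 := hP'.2 (y := I.map ψ) ⟨hIp, by
      rw [Ideal.span_singleton_le_iff_mem, ← hψf]
      exact Ideal.mem_map_of_mem _ hfI⟩ (Ideal.map_le_iff_le_comap.mpr hle)
    rw [← hIc]
    exact Ideal.comap_mono h3
  · refine lt_of_le_not_ge (Ideal.comap_mono hlt'.le) fun hge => hlt'.not_ge ?_
    rwa [Ideal.comap_le_comap_iff_of_surjective _ hψs] at hge

open TensorProduct in
theorem aux_denom {B A V K : Type*} [CommRing B] [CommRing A] [CommRing V] [IsDomain V]
    [Field K] [Algebra B A] [Algebra B V] [Algebra B K] [Algebra V K] [IsScalarTower B V K]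
    [IsFractionRing V K] [Module.Flat B A] (f : A) (hf : IsUnit ((1 : K) ⊗ₜ[B] f)) :
    ∃ (h : V ⊗[B] A) (v : V), v ≠ 0 ∧ ((1 : V) ⊗ₜ[B] f) * h = algebraMap V (V ⊗[B] A) v := by
  let φ : V ⊗[B] A →ₐ[B] K ⊗[B] A :=
    Algebra.TensorProduct.map (IsScalarTower.toAlgHom B V K) (AlgHom.id B A)
  have hφ : Function.Injective φ :=
    Module.Flat.rTensor_preserves_injective_linearMap (M := A)
      (IsScalarTower.toAlgHom B V K).toLinearMap (IsFractionRing.injective V K)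
  have key : ∀ z : K ⊗[B] A, ∃ (h : V ⊗[B] A) (v : V), v ≠ 0 ∧
      φ h = (algebraMap V K v ⊗ₜ 1) * z := by
    intro z
    induction z with
    | zero => exact ⟨0, 1, one_ne_zero, by simp⟩
    | tmul x a =>
      obtain ⟨n, d, hd, rfl⟩ := IsFractionRing.div_surjective (A := V) x
      have hd0 : d ≠ 0 := nonZeroDivisors.ne_zero hd
      refine ⟨n ⊗ₜ a, d, hd0, ?_⟩
      have : algebraMap V K d ≠ 0 :=
        (map_ne_zero_iff _ (IsFractionRing.injective V K)).mpr hd0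
      simp only [φ, Algebra.TensorProduct.map_tmul, Algebra.TensorProduct.tmul_mul_tmul, one_mul,
        mul_div_cancel₀ _ this]
      simp
    | add x y hx hy =>
      obtain ⟨h₁, v₁, hv₁, e₁⟩ := hx
      obtain ⟨h₂, v₂, hv₂, e₂⟩ := hy
      refine ⟨(v₂ ⊗ₜ 1) * h₁ + (v₁ ⊗ₜ 1) * h₂, v₁ * v₂, mul_ne_zero hv₁ hv₂, ?_⟩
      rw [map_add, map_mul, map_mul, e₁, e₂, map_mul,
        ← mul_one (1 : A), ← Algebra.TensorProduct.tmul_mul_tmul]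
      simp only [φ, Algebra.TensorProduct.map_tmul, mul_one, map_one,
        IsScalarTower.coe_toAlgHom']
      ring
  obtain ⟨z, hz⟩ := hf.exists_right_inv
  obtain ⟨h, v, hv, e⟩ := key z
  refine ⟨h, v, hv, hφ ?_⟩
  rw [map_mul, e, Algebra.TensorProduct.algebraMap_apply]
  simp only [φ, Algebra.TensorProduct.map_tmul, map_one, IsScalarTower.coe_toAlgHom',
    AlgHom.coe_id, id_eq, Algebra.algebraMap_self, RingHom.id_apply]
  rw [mul_left_comm, hz, mul_one]

theorem aux_exists_val {B K : Type*} [CommRing B] [Field K] [Algebra B K]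
    (q : Ideal B) [hq : q.IsPrime] (hle : RingHom.ker (algebraMap B K) ≤ q) :
    ∃ (V : ValuationSubring K) (g : B →+* V), (∀ b, (g b : K) = algebraMap B K b) ∧
      ∀ b, g b ∈ IsLocalRing.maximalIdeal V ↔ b ∈ q := by
  let F : Localization.AtPrime q →+* K := IsLocalization.lift (M := q.primeCompl)
    (g := algebraMap B K) (fun y => IsUnit.mk0 _ fun h0 => y.2 (hle h0))
  obtain ⟨V, hV, hloc⟩ := IsLocalRing.exists_factor_valuationRing F
  let G : Localization.AtPrime q →+* V := F.codRestrict V.toSubring hV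
  have hG : IsLocalHom G := hloc
  refine ⟨V, G.comp (algebraMap B _), ?_, ?_⟩
  · intro b
    change F (algebraMap B _ b) = _
    simp [F]
  · intro b
    rw [RingHom.comp_apply, IsLocalRing.mem_maximalIdeal, map_mem_nonunits_iff,
      ← IsLocalRing.mem_maximalIdeal, IsLocalization.AtPrime.to_map_mem_maximal_iff _ q]

/-- **Principal subschemes in flat families over an arbitrary base.**
Let `B → A` be a flat ring map of finite type between rings with irreducible spectra (unique
minimal primes).  Let `q₀` be the minimal prime of `B` and suppose `f ∈ A` becomes a unit
in the generic fiber ring `A ⊗_B κ(q₀)` (where `κ(q₀) = Frac(B ⧸ q₀)`).  Then for every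
prime `q` of `B`, every prime of the fiber ring `A ⊗_B κ(q)` minimal over the image of `f`
is a minimal prime of `A ⊗_B κ(q)`: every irreducible component of `V(f)` in the fiber over
`q` is an irreducible component of that fiber. -/
theorem principal_subscheme_components_in_flat_family
    {B A : Type u} [CommRing B] [CommRing A] [Algebra B A]
    [Module.Flat B A] [Algebra.FiniteType B A]
    (hB : ∃! q : Ideal B, q ∈ minimalPrimes B)
    (hA : ∃! q : Ideal A, q ∈ minimalPrimes A)
    (q₀ : Ideal B) (hq₀ : q₀ ∈ minimalPrimes B)
    (f : A)
    (hf : IsUnit ((Algebra.TensorProduct.includeRight :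
        A →ₐ[B] TensorProduct B (FractionRing (B ⧸ q₀)) A) f))
    (q : Ideal B) (hq : q.IsPrime) :
    ∀ P ∈ (Ideal.span {(Algebra.TensorProduct.includeRight :
        A →ₐ[B] TensorProduct B (FractionRing (B ⧸ q)) A) f}).minimalPrimes,
      P ∈ minimalPrimes (TensorProduct B (FractionRing (B ⧸ q)) A) := by
  have hq₀p : q₀.IsPrime := hq₀.1.1
  have hle : q₀ ≤ q := by
    obtain ⟨p, hp, hpq⟩ := Ideal.exists_minimalPrimes_le (I := (⊥ : Ideal B)) (J := q) bot_le
    rwa [hB.unique hq₀ hp]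
  have hker : ∀ b, algebraMap B (FractionRing (B ⧸ q₀)) b = 0 ↔ b ∈ q₀ := by
    intro b
    rw [IsScalarTower.algebraMap_apply B (B ⧸ q₀) (FractionRing (B ⧸ q₀)),
      map_eq_zero_iff _ (IsFractionRing.injective (B ⧸ q₀) _)]
    exact Ideal.Quotient.eq_zero_iff_mem
  obtain ⟨V, g, hg, hgm⟩ := aux_exists_val (K := FractionRing (B ⧸ q₀)) q
    (fun b hb => hle ((hker b).mp hb))
  let : Algebra B V := g.toAlgebra
  have : IsScalarTower B V (FractionRing (B ⧸ q₀)) :=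
    IsScalarTower.of_algebraMap_eq fun b => (hg b).symm
  obtain ⟨h, v, hv, hfh⟩ := aux_denom (V := V) f hf
  let l := IsLocalRing.ResidueField V
  let gl : (B ⧸ q) →+* l := Ideal.Quotient.lift q ((IsLocalRing.residue V).comp g) (fun b hb => by
    rw [RingHom.comp_apply, IsLocalRing.residue_eq_zero_iff]
    exact (hgm b).mpr hb)
  have hgl : Function.Injective gl := by
    rw [injective_iff_map_eq_zero]
    intro x hx
    obtain ⟨b, rfl⟩ := Ideal.Quotient.mk_surjective x
    have hx : IsLocalRing.residue V (g b) = 0 := hx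
    rw [IsLocalRing.residue_eq_zero_iff, hgm] at hx
    exact Ideal.Quotient.eq_zero_iff_mem.mpr hx
  let : Algebra (FractionRing (B ⧸ q)) l := (IsFractionRing.lift hgl).toAlgebra
  let : Algebra B l := ((IsLocalRing.residue V).comp g).toAlgebra
  have : IsScalarTower B V l := IsScalarTower.of_algebraMap_eq fun b => rfl
  have : IsScalarTower B (FractionRing (B ⧸ q)) l := IsScalarTower.of_algebraMap_eq fun b => by
    rw [IsScalarTower.algebraMap_apply B (B ⧸ q) (FractionRing (B ⧸ q))]
    exact (IsFractionRing.lift_algebraMap (K := FractionRing (B ⧸ q)) hgl (algebraMap B (B ⧸ q) b)).symm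
  intro P hP
  exact aux_stage3 (V := V) (l := l) IsLocalRing.residue_surjective f h v hv hfh P hP
end
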